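/- arXiv:2411.19462 — 2 statements merged into one kernel-verified Lean document; each statement's English description precedes it below -/
import Mathlib

section
/- The complete multipartite graph with 2 parts of size 2 and 5 parts of size 3 has paintability 9: χ_P(K_{2⋆2,3⋆5}) = 9. -/
/-- `PainterWinsIn G r fuel U t` : in the online list coloring game on `G` with threshold `r`,
where `U` is the set of currently unpainted vertices and `t v` is the number of times vertex `v`
has been presented so far, Painter can guarantee to win within `fuel` further rounds.
In each round Lister presents a nonempty set `S` of unpainted vertices; Painter chooses an
independent subset `I ⊆ S` and paints it; Painter wins once all vertices are painted, and loses
if some unpainted vertex has been presented `r` times. -/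
def PainterWinsIn {V : Type*} [Fintype V] [DecidableEq V] (G : SimpleGraph V) (r : ℕ) :
    ℕ → Finset V → (V → ℕ) → Prop
  | 0, U, _ => U = ∅
  | fuel + 1, U, t => U = ∅ ∨
      ∀ S ⊆ U, S.Nonempty →
        ∃ I ⊆ S, (∀ u ∈ I, ∀ v ∈ I, ¬ G.Adj u v) ∧
          (U \ I = ∅ ∨
            ((∀ v ∈ U \ I, t v + (if v ∈ S then 1 else 0) < r) ∧
              PainterWinsIn G r fuel (U \ I) (fun v => t v + if v ∈ S then 1 else 0)))

/-- `G` is `r`-paintable: Painter has a winning strategy in the online list coloring game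
on `G` with threshold `r`. -/
def Paintable {V : Type*} [Fintype V] [DecidableEq V] (G : SimpleGraph V) (r : ℕ) : Prop :=
  ∃ fuel, PainterWinsIn G r fuel Finset.univ (fun _ => 0)

/-- The paintability `χ_P(G)`: the least `r` such that `G` is `r`-paintable. -/
noncomputable def paintability {V : Type*} [Fintype V] [DecidableEq V] (G : SimpleGraph V) : ℕ :=
  sInf {r | Paintable G r}

namespace OnlineColoring

open MvPolynomial

section AlonTarsi

variable {V : Type*} [DecidableEq V]

/-- The product of `X u - X v` over the pairs `(u, v)` of a list. -/
noncomputable def edgePoly (E : List (V × V)) : MvPolynomial V ℤ :=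
  (E.map fun e => X e.1 - X e.2).prod

/-- The sum of the coefficients of the monomials that agree with `μ` outside `S` and are at least
`μ` on `S`. -/
noncomputable def upperCoeff (S : Finset V) (μ : V →₀ ℕ) : MvPolynomial V ℤ →ₗ[ℤ] ℤ :=
  open Classical in
  (basisMonomials V ℤ).constr ℤ fun ν =>
    if (∀ v ∈ S, μ v ≤ ν v) ∧ ∀ v ∉ S, ν v = μ v then 1 else 0

/-- Substitution of `1` for the variables in `I`. -/
noncomputable def substOne (I : Finset V) : MvPolynomial V ℤ →ₐ[ℤ] MvPolynomial V ℤ :=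
  aeval fun u => if u ∈ I then 1 else X u

open Classical in
theorem upperCoeff_monomial {W : Type*} (S : Finset W) (μ ν : W →₀ ℕ) :
    upperCoeff S μ (monomial ν 1) =
      if (∀ v ∈ S, μ v ≤ ν v) ∧ ∀ v ∉ S, ν v = μ v then 1 else 0 := by
  have h : monomial ν 1 = basisMonomials W ℤ ν := by rw [coe_basisMonomials]
  rw [h, upperCoeff, Module.Basis.constr_basis]

theorem upperCoeff_empty (μ : V →₀ ℕ) (Q : MvPolynomial V ℤ) :
    upperCoeff ∅ μ Q = coeff μ Q := by
  classical
  have : upperCoeff ∅ μ = lcoeff ℤ μ := by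
    apply (basisMonomials V ℤ).ext
    intro ν
    rw [coe_basisMonomials, upperCoeff_monomial, lcoeff_apply, coeff_monomial]
    simp [Finsupp.ext_iff]
  rw [this, lcoeff_apply]

theorem substOne_singleton_monomial (v : V) (ν : V →₀ ℕ) :
    substOne {v} (monomial ν 1) = monomial (ν.erase v) 1 := by
  rw [substOne, aeval_monomial, map_one, one_mul, monomial_eq, map_one, one_mul,
    Finsupp.prod, Finsupp.prod, Finsupp.support_erase]
  by_cases hv : v ∈ ν.support
  · rw [← Finset.mul_prod_erase _ _ hv]
    simp only [Finset.mem_singleton, if_true, one_pow, one_mul]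
    refine Finset.prod_congr rfl fun u hu => ?_
    rw [if_neg (Finset.ne_of_mem_erase hu), Finsupp.erase_ne (Finset.ne_of_mem_erase hu)]
  · rw [Finset.erase_eq_of_notMem hv]
    refine Finset.prod_congr rfl fun u hu => ?_
    have : u ≠ v := fun h => hv (h ▸ hu)
    rw [if_neg (by simpa using this), Finsupp.erase_ne this]

theorem substOne_insert (v : V) (I : Finset V) (Q : MvPolynomial V ℤ) :
    substOne I (substOne {v} Q) = substOne (insert v I) Q := by
  rw [← AlgHom.comp_apply]
  congr 1
  apply MvPolynomial.algHom_ext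
  intro u
  by_cases hu : u = v
  · simp [substOne, hu]
  · by_cases h : u ∈ I <;> simp [substOne, hu, h]

theorem upperCoeff_insert {v : V} {S : Finset V} (hv : v ∉ S) (μ : V →₀ ℕ)
    (Q : MvPolynomial V ℤ) :
    upperCoeff (insert v S) μ Q = upperCoeff S (μ.update v 0) (substOne {v} Q) -
      ∑ j ∈ Finset.range (μ v), upperCoeff S (μ.update v j) Q := by
  classical
  have : upperCoeff (insert v S) μ = upperCoeff S (μ.update v 0) ∘ₗ (substOne {v}).toLinearMap -
      ∑ j ∈ Finset.range (μ v), upperCoeff S (μ.update v j) := by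
    apply (basisMonomials V ℤ).ext
    intro ν
    simp only [coe_basisMonomials, LinearMap.sub_apply, LinearMap.comp_apply,
      AlgHom.toLinearMap_apply, LinearMap.sum_apply, substOne_singleton_monomial,
      upperCoeff_monomial]
    set A : Prop := (∀ u ∈ S, μ u ≤ ν u) ∧ ∀ u, u ≠ v → u ∉ S → ν u = μ u with hA
    have h1 : ((∀ u ∈ insert v S, μ u ≤ ν u) ∧ ∀ u ∉ insert v S, ν u = μ u) ↔ (A ∧ μ v ≤ ν v) := by
      simp only [Finset.mem_insert, hA]
      constructor
      · rintro ⟨h, h'⟩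
        exact ⟨⟨fun u hu => h u (Or.inr hu), fun u hu hu' => h' u (by tauto)⟩, h v (Or.inl rfl)⟩
      · rintro ⟨⟨h, h'⟩, h''⟩
        refine ⟨?_, fun u hu => h' u (by tauto) (by tauto)⟩
        rintro u (rfl | hu)
        · exact h''
        · exact h u hu
    have h2 : ((∀ u ∈ S, (μ.update v 0) u ≤ (ν.erase v) u) ∧
        ∀ u ∉ S, (ν.erase v) u = (μ.update v 0) u) ↔ A := by
      simp only [hA, Finsupp.coe_update]
      constructor
      · rintro ⟨h, h'⟩
        refine ⟨fun u hu => ?_, fun u hu hu' => ?_⟩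
        · have := h u hu
          have huv : u ≠ v := fun e => hv (e ▸ hu)
          rwa [Function.update_of_ne huv, Finsupp.erase_ne huv] at this
        · have := h' u hu'
          rwa [Function.update_of_ne hu, Finsupp.erase_ne hu] at this
      · rintro ⟨h, h'⟩
        refine ⟨fun u hu => ?_, fun u hu => ?_⟩
        · have huv : u ≠ v := fun e => hv (e ▸ hu)
          rw [Function.update_of_ne huv, Finsupp.erase_ne huv]
          exact h u hu
        · by_cases huv : u = v
          · simp [huv]
          · rw [Function.update_of_ne huv, Finsupp.erase_ne huv]
            exact h' u huv hu
    have h3 : ∀ j, ((∀ u ∈ S, (μ.update v j) u ≤ ν u) ∧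
        ∀ u ∉ S, ν u = (μ.update v j) u) ↔ (A ∧ ν v = j) := by
      intro j
      simp only [hA, Finsupp.coe_update]
      constructor
      · rintro ⟨h, h'⟩
        refine ⟨⟨fun u hu => ?_, fun u hu hu' => ?_⟩, ?_⟩
        · have := h u hu
          have huv : u ≠ v := fun e => hv (e ▸ hu)
          rwa [Function.update_of_ne huv] at this
        · have := h' u hu'
          rwa [Function.update_of_ne hu] at this
        · simpa using h' v hv
      · rintro ⟨⟨h, h'⟩, h''⟩
        refine ⟨fun u hu => ?_, fun u hu => ?_⟩
        · have huv : u ≠ v := fun e => hv (e ▸ hu)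
          rw [Function.update_of_ne huv]
          exact h u hu
        · by_cases huv : u = v
          · simp [huv, h'']
          · rw [Function.update_of_ne huv]
            exact h' u huv hu
    simp only [h1, h2, h3]
    by_cases hA' : A
    · simp only [hA', true_and, if_true, Finset.sum_ite_eq, Finset.mem_range]
      split_ifs <;> omega
    · simp [hA']
  rw [this]
  simp

theorem exists_coeff_substOne_ne_zero (S : Finset V) : ∀ (μ : V →₀ ℕ) (Q : MvPolynomial V ℤ),
    upperCoeff S μ Q ≠ 0 → ∃ I ⊆ S, ∃ ν : V →₀ ℕ, coeff ν (substOne I Q) ≠ 0 ∧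
      (∀ v ∈ S, v ∉ I → ν v < μ v) ∧ ∀ v ∉ S, ν v = μ v := by
  induction S using Finset.induction_on with
  | empty =>
    intro μ Q h
    refine ⟨∅, subset_rfl, μ, ?_, by simp, by simp⟩
    have : substOne (∅ : Finset V) Q = Q := by
      have : substOne (∅ : Finset V) = AlgHom.id ℤ _ := by
        apply MvPolynomial.algHom_ext
        intro u
        simp [substOne]
      rw [this, AlgHom.id_apply]
    rwa [this, ← upperCoeff_empty]
  | insert v S hv ih =>
    intro μ Q h
    rw [upperCoeff_insert hv] at h
    by_cases h0 : upperCoeff S (μ.update v 0) (substOne {v} Q) = 0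
    · rw [h0, zero_sub, neg_ne_zero] at h
      obtain ⟨j, hj, hj'⟩ := Finset.exists_ne_zero_of_sum_ne_zero h
      obtain ⟨I, hI, ν, hν, h1, h2⟩ := ih _ _ hj'
      refine ⟨I, hI.trans (Finset.subset_insert _ _), ν, hν, fun u hu hu' => ?_, fun u hu => ?_⟩
      · rcases Finset.mem_insert.1 hu with rfl | hu
        · rw [h2 u hv]
          simpa using hj
        · have huv : u ≠ v := fun e => hv (e ▸ hu)
          simpa [Function.update_of_ne huv] using h1 u hu hu'
      · rw [Finset.mem_insert, not_or] at hu
        simpa [Function.update_of_ne hu.1] using h2 u hu.2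
    · obtain ⟨I, hI, ν, hν, h1, h2⟩ := ih _ _ h0
      refine ⟨insert v I, Finset.insert_subset_insert _ hI, ν, ?_, fun u hu hu' => ?_,
        fun u hu => ?_⟩
      · rwa [substOne_insert] at hν
      · rw [Finset.mem_insert, not_or] at hu'
        have := h1 u ((Finset.mem_insert.1 hu).resolve_left hu'.1) hu'.2
        simpa [Function.update_of_ne hu'.1] using this
      · rw [Finset.mem_insert, not_or] at hu
        simpa [Function.update_of_ne hu.1] using h2 u hu.2

theorem isHomogeneous_edgePoly {W : Type*} (E : List (W × W)) :
    (edgePoly E).IsHomogeneous E.length := by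
  induction E with
  | nil => simpa [edgePoly] using isHomogeneous_one W ℤ
  | cons e E ih =>
    have : edgePoly (e :: E) = (X e.1 - X e.2) * edgePoly E := by simp [edgePoly]
    rw [this, List.length_cons, add_comm]
    exact ((isHomogeneous_X ℤ e.1).sub (isHomogeneous_X ℤ e.2)).mul ih

theorem upperCoeff_eq_coeff {n : ℕ} {Q : MvPolynomial V ℤ} (hQ : Q.IsHomogeneous n)
    (S : Finset V) {μ : V →₀ ℕ} (hμ : coeff μ Q ≠ 0) : upperCoeff S μ Q = coeff μ Q := by
  classical
  conv_lhs => rw [Q.as_sum, map_sum]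
  rw [Finset.sum_eq_single μ]
  · rw [← mul_one (coeff μ Q), ← smul_eq_mul, ← smul_monomial, map_smul, upperCoeff_monomial]
    simp
  · intro ν hν hne
    rw [← mul_one (coeff ν Q), ← smul_eq_mul, ← smul_monomial, map_smul, upperCoeff_monomial,
      if_neg, smul_zero]
    rintro ⟨h1, h2⟩
    have hle : μ ≤ ν := fun v => by
      by_cases hv : v ∈ S
      · exact h1 v hv
      · exact (h2 v hv).ge
    have hd : μ.degree = ν.degree := by
      have h1 : μ.degree = n := by
        rw [Finsupp.degree_eq_weight_one (R := ℕ)]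
        exact hQ hμ
      have h2 : ν.degree = n := by
        rw [Finsupp.degree_eq_weight_one (R := ℕ)]
        exact hQ (mem_support_iff.1 hν)
      rw [h1, h2]
    obtain ⟨δ, rfl⟩ := exists_add_of_le hle
    apply hne
    rw [map_add] at hd
    have : δ.degree = 0 := by omega
    rw [Finsupp.degree_eq_zero_iff] at this
    simp [this]
  · intro h
    rw [notMem_support_iff] at h
    exact absurd h hμ

theorem substOne_edgePoly_eq_zero {I : Finset V} {E : List (V × V)} {u v : V} (hu : u ∈ I)
    (hv : v ∈ I) (h : (u, v) ∈ E) : substOne I (edgePoly E) = 0 := by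
  rw [edgePoly, map_list_prod, List.map_map]
  apply List.prod_eq_zero
  rw [List.mem_map]
  exact ⟨_, h, by simp [substOne, hu, hv]⟩

theorem dvd_substOne_edgePoly (I : Finset V) (E : List (V × V)) :
    edgePoly (E.filter fun e => e.1 ∉ I ∧ e.2 ∉ I) ∣ substOne I (edgePoly E) := by
  induction E with
  | nil => simp [edgePoly]
  | cons e E ih =>
    have h : ∀ e : V × V, ∀ E, edgePoly (e :: E) = (X e.1 - X e.2) * edgePoly E := by
      simp [edgePoly]
    rw [h, map_mul, List.filter_cons]
    split_ifs with hI
    · rw [h]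
      simp only [decide_eq_true_eq] at hI
      refine mul_dvd_mul ?_ ih
      simp [substOne, hI.1, hI.2]
    · exact ih.mul_left _

theorem exists_le_coeff_ne_zero_of_dvd {P Q : MvPolynomial V ℤ} (h : P ∣ Q) {ν : V →₀ ℕ}
    (hν : coeff ν Q ≠ 0) : ∃ ν' ≤ ν, coeff ν' P ≠ 0 := by
  classical
  obtain ⟨R, rfl⟩ := h
  rw [coeff_mul] at hν
  obtain ⟨x, hx, hx'⟩ := Finset.exists_ne_zero_of_sum_ne_zero hν
  refine ⟨x.1, ?_, left_ne_zero_of_mul hx'⟩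
  rw [← Finset.HasAntidiagonal.mem_antidiagonal.1 hx]
  exact le_self_add

/-- One round of the online Alon–Tarsi argument. -/
theorem exists_independent_reply (E : List (V × V)) {μ : V →₀ ℕ} (hμ : coeff μ (edgePoly E) ≠ 0)
    (S : Finset V) : ∃ I ⊆ S, (∀ u ∈ I, ∀ v ∈ I, (u, v) ∉ E) ∧ ∃ ν : V →₀ ℕ,
      coeff ν (edgePoly (E.filter fun e => e.1 ∉ I ∧ e.2 ∉ I)) ≠ 0 ∧
      ∀ v, v ∉ I → ν v + (if v ∈ S then 1 else 0) ≤ μ v := by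
  have h := upperCoeff_eq_coeff (isHomogeneous_edgePoly E) S hμ
  obtain ⟨I, hI, ν, hν, h1, h2⟩ := exists_coeff_substOne_ne_zero S μ _ (h ▸ hμ)
  refine ⟨I, hI, fun u hu v hv huv => hν ?_, ?_⟩
  · rw [substOne_edgePoly_eq_zero hu hv huv, coeff_zero]
  · obtain ⟨ν', hle, hν'⟩ := exists_le_coeff_ne_zero_of_dvd (dvd_substOne_edgePoly I E) hν
    refine ⟨ν', hν', fun v hv => ?_⟩
    have := hle v
    split_ifs with hS
    · have := h1 v hS hv
      omega
    · have := h2 v hS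
      omega

end AlonTarsi

section Game

variable {V : Type*} [Fintype V] [DecidableEq V] {G : SimpleGraph V} {r : ℕ}

theorem painterWinsIn_succ {fuel : ℕ} {U : Finset V} {t : V → ℕ}
    (h : PainterWinsIn G r fuel U t) : PainterWinsIn G r (fuel + 1) U t := by
  induction fuel generalizing U t with
  | zero => exact Or.inl h
  | succ n ih =>
    rcases h with h | h
    · exact Or.inl h
    · refine Or.inr fun S hS hS' => ?_
      obtain ⟨I, hI, hind, hI'⟩ := h S hS hS'
      exact ⟨I, hI, hind, hI'.imp_right fun h' => ⟨h'.1, ih h'.2⟩⟩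

theorem painterWinsIn_mono_fuel {m n : ℕ} (hmn : m ≤ n) {U : Finset V} {t : V → ℕ}
    (h : PainterWinsIn G r m U t) : PainterWinsIn G r n U t := by
  induction hmn with
  | refl => exact h
  | step _ ih => exact painterWinsIn_succ ih

/-- Painter is in a winning position that is not lost already. -/
def Wins (G : SimpleGraph V) (r : ℕ) (U : Finset V) (t : V → ℕ) : Prop :=
  (∀ v ∈ U, t v < r) ∧ ∃ fuel, PainterWinsIn G r fuel U t

theorem wins_of_round {U : Finset V} {t : V → ℕ} (ht : ∀ v ∈ U, t v < r)
    (h : ∀ S ⊆ U, S.Nonempty → ∃ I ⊆ S, (∀ u ∈ I, ∀ v ∈ I, ¬ G.Adj u v) ∧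
      Wins G r (U \ I) (fun v => t v + if v ∈ S then 1 else 0)) : Wins G r U t := by
  refine ⟨ht, ?_⟩
  have h' : ∀ S : Finset V, ∃ fuel, S ⊆ U → S.Nonempty →
      ∃ I ⊆ S, (∀ u ∈ I, ∀ v ∈ I, ¬ G.Adj u v) ∧
        (∀ v ∈ U \ I, t v + (if v ∈ S then 1 else 0) < r) ∧
        PainterWinsIn G r fuel (U \ I) (fun v => t v + if v ∈ S then 1 else 0) := by
    intro S
    by_cases hS : S ⊆ U ∧ S.Nonempty
    · obtain ⟨I, hI, hind, hlt, fuel, hf⟩ := h S hS.1 hS.2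
      exact ⟨fuel, fun _ _ => ⟨I, hI, hind, hlt, hf⟩⟩
    · exact ⟨0, fun h1 h2 => absurd ⟨h1, h2⟩ hS⟩
  choose f hf using h'
  refine ⟨Finset.univ.sup f + 1, Or.inr fun S hS hS' => ?_⟩
  obtain ⟨I, hI, hind, hlt, hw⟩ := hf S hS hS'
  exact ⟨I, hI, hind, Or.inr ⟨hlt,
    painterWinsIn_mono_fuel (Finset.le_sup (Finset.mem_univ S)) hw⟩⟩

/-- The online Alon–Tarsi theorem. -/
theorem wins_of_coeff_ne_zero {U : Finset V} {t : V → ℕ} (E : List (V × V)) {μ : V →₀ ℕ}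
    (hE : ∀ u ∈ U, ∀ v ∈ U, G.Adj u v → (u, v) ∈ E ∨ (v, u) ∈ E)
    (hμ : coeff μ (edgePoly E) ≠ 0) (ht : ∀ v ∈ U, μ v + t v < r) : Wins G r U t := by
  induction hN : ∑ v ∈ U, (r - t v) using Nat.strong_induction_on generalizing U t E μ with
  | _ N ih =>
  refine wins_of_round (fun v hv => (Nat.le_add_left _ _).trans_lt (ht v hv)) fun S hS hS' => ?_
  obtain ⟨I, hI, hind, ν, hν, hle⟩ := exists_independent_reply E hμ S
  refine ⟨I, hI, fun u hu v hv huv => ?_, ih _ ?_ _ ?_ hν ?_ rfl⟩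
  · exact (hE u (hS (hI hu)) v (hS (hI hv)) huv).elim (hind u hu v hv) (hind v hv u hu)
  · rw [← hN, ← Finset.sum_sdiff (hI.trans hS)]
    by_cases hne : I.Nonempty
    · apply Nat.add_lt_add_of_le_of_lt (b := ∑ v ∈ U \ I, (r - t v))
        (c := 0) (d := ∑ v ∈ I, (r - t v))
      · exact Finset.sum_le_sum fun v _ => by omega
      · obtain ⟨v, hv⟩ := hne
        refine Finset.sum_pos (fun v hv => ?_) ⟨v, hv⟩
        have := ht v (hS (hI hv))
        omega
    · rw [Finset.not_nonempty_iff_eq_empty] at hne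
      subst hne
      simp only [Finset.sdiff_empty, Finset.sum_empty, add_zero]
      obtain ⟨v, hv⟩ := hS'
      refine Finset.sum_lt_sum (fun v _ => by omega) ⟨v, hS hv, ?_⟩
      have := ht v (hS hv)
      simp only [hv, if_true]
      omega
  · intro u hu v hv huv
    rw [Finset.mem_sdiff] at hu hv
    simpa [hu.2, hv.2] using hE u hu.1 v hv.1 huv
  · intro v hv
    rw [Finset.mem_sdiff] at hv
    have := hle v hv.2
    have := ht v hv.1
    omega

end Game

section ListStates

theorem exists_perm_of_map_perm {α β : Type*} {f : α → β} {l : List α} {m : List β}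
    (h : (l.map f).Perm m) : ∃ l', l.Perm l' ∧ l'.map f = m := by
  have : Relation.Comp List.Perm (List.Forall₂ fun x y => f x = y) l m := by
    rw [← List.forall₂_comp_perm_eq_perm_comp_forall₂]
    exact ⟨_, List.forall₂_map_right_iff.2 (List.forall₂_same.2 fun _ _ => rfl), h⟩
  obtain ⟨l', h1, h2⟩ := this
  refine ⟨l', h1, ?_⟩
  clear h1 h
  induction h2 with
  | nil => rfl
  | cons h _ ih => rw [List.map_cons, h, ih]

variable {V : Type*} [Fintype V] [DecidableEq V] {G : SimpleGraph V} {r : ℕ}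

/-- The position `(U, t)` has the list state `F`: the unpainted vertices are divided into
independent parts, and the numbers in `F` bound from below how often they may still be presented. -/
def HasState (G : SimpleGraph V) (r : ℕ) (U : Finset V) (t : V → ℕ) (F : List (List ℕ)) : Prop :=
  ∃ P : List (List (V × ℕ)), P.map (List.map Prod.snd) = F ∧
    (P.flatten.map Prod.fst).Perm U.toList ∧
    (∀ p ∈ P, ∀ x ∈ p, ∀ y ∈ p, ¬ G.Adj x.1 y.1) ∧ ∀ p ∈ P, ∀ x ∈ p, x.2 + t x.1 ≤ r

/-- Painter wins from all positions with the list state `F`. -/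
def GoodState (G : SimpleGraph V) (r : ℕ) (F : List (List ℕ)) : Prop :=
  ∀ U t, HasState G r U t F → Wins G r U t

/-- The part `p` has at least as many presentations left as `q`. -/
def PartGE (p q : List ℕ) : Prop := ∃ p', p'.Perm p ∧ List.Forall₂ (· ≥ ·) p' q

theorem PartGE.refl (p : List ℕ) : PartGE p p :=
  ⟨p, List.Perm.refl p, List.forall₂_same.2 fun _ _ => le_rfl⟩

theorem GoodState.perm {F F' : List (List ℕ)} (h : GoodState G r F') (hF : F.Perm F') :
    GoodState G r F := by
  rintro U t ⟨P, rfl, hU, hind, ht⟩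
  obtain ⟨P', hP, hF'⟩ := exists_perm_of_map_perm hF
  refine h U t ⟨P', hF', ?_, fun p hp => hind p (hP.mem_iff.2 hp),
    fun p hp => ht p (hP.mem_iff.2 hp)⟩
  exact ((hP.flatten.map _).symm).trans hU

theorem PartGE.exists_lift {α : Type*} {p : List (α × ℕ)} {q : List ℕ}
    (h : PartGE (p.map Prod.snd) q) :
    ∃ p' : List (α × ℕ), p'.map Prod.snd = q ∧ (p'.map Prod.fst).Perm (p.map Prod.fst) ∧
      ∀ x ∈ p', ∃ y ∈ p, y.1 = x.1 ∧ x.2 ≤ y.2 := by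
  obtain ⟨p₁, hp₁, hq⟩ := h
  obtain ⟨p₂, hp₂, rfl⟩ := exists_perm_of_map_perm hp₁.symm
  replace hp₂ := hp₂.symm
  suffices ∃ p' : List (α × ℕ), p'.map Prod.snd = q ∧ p'.map Prod.fst = p₂.map Prod.fst ∧
      ∀ x ∈ p', ∃ y ∈ p₂, y.1 = x.1 ∧ x.2 ≤ y.2 by
    obtain ⟨p', h1, h2, h3⟩ := this
    refine ⟨p', h1, h2 ▸ hp₂.map _, fun x hx => ?_⟩
    obtain ⟨y, hy, h⟩ := h3 x hx
    exact ⟨y, hp₂.mem_iff.1 hy, h⟩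
  clear hp₁ hp₂
  induction p₂ generalizing q with
  | nil => cases hq; exact ⟨[], rfl, rfl, by simp⟩
  | cons x p₂ ih =>
    rw [List.map_cons] at hq
    cases hq with
    | @cons _ n _ q h hq =>
      obtain ⟨p', h1, h2, h3⟩ := ih hq
      refine ⟨(x.1, n) :: p', by simp [h1], by simp [h2], ?_⟩
      intro y hy
      rcases List.mem_cons.1 hy with rfl | hy
      · exact ⟨x, by simp, rfl, h⟩
      · obtain ⟨z, hz, h⟩ := h3 y hy
        exact ⟨z, List.mem_cons_of_mem _ hz, h⟩

theorem GoodState.mono {F F' : List (List ℕ)} (h : GoodState G r F')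
    (hF : List.Forall₂ PartGE F F') : GoodState G r F := by
  rintro U t ⟨P, rfl, hU, hind, ht⟩
  suffices ∃ P' : List (List (V × ℕ)), P'.map (List.map Prod.snd) = F' ∧
      (P'.flatten.map Prod.fst).Perm (P.flatten.map Prod.fst) ∧
      ∀ p' ∈ P', ∃ p ∈ P, ∀ x ∈ p', ∃ y ∈ p, y.1 = x.1 ∧ x.2 ≤ y.2 by
    obtain ⟨P', h1, h2, h3⟩ := this
    refine h U t ⟨P', h1, h2.trans hU, ?_, ?_⟩
    · intro p' hp' x hx y hy
      obtain ⟨p, hp, h⟩ := h3 p' hp'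
      obtain ⟨x', hx', hx, -⟩ := h x hx
      obtain ⟨y', hy', hy, -⟩ := h y hy
      rw [← hx, ← hy]
      exact hind p hp x' hx' y' hy'
    · intro p' hp' x hx
      obtain ⟨p, hp, h⟩ := h3 p' hp'
      obtain ⟨x', hx', hx, hle⟩ := h x hx
      rw [← hx]
      exact (Nat.add_le_add_right hle _).trans (ht p hp x' hx')
  clear hU hind ht h
  induction P generalizing F' with
  | nil => cases hF; exact ⟨[], rfl, List.Perm.refl _, by simp⟩
  | cons p P ih =>
    rw [List.map_cons] at hF
    cases hF with
    | @cons _ q _ F' h hF =>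
      obtain ⟨P', h1, h2, h3⟩ := ih hF
      obtain ⟨p', k1, k2, k3⟩ := h.exists_lift
      refine ⟨p' :: P', by simp [h1, k1], ?_, ?_⟩
      · simpa using k2.append (by simpa using h2)
      · intro q' hq'
        rcases List.mem_cons.1 hq' with rfl | hq'
        · exact ⟨p, by simp, k3⟩
        · obtain ⟨z, hz, h⟩ := h3 q' hq'
          exact ⟨z, List.mem_cons_of_mem _ hz, h⟩

/-- Puts a part in front of a state unless it is empty. -/
def consPart : List ℕ → List (List ℕ) → List (List ℕ)
  | [], F => F
  | a :: p, F => (a :: p) :: F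

theorem GoodState.of_consPart {p : List ℕ} {F : List (List ℕ)}
    (h : GoodState G r (consPart p F)) : GoodState G r (p :: F) := by
  cases p with
  | cons a p => exact h
  | nil =>
    rintro U t ⟨P, hP, hU, hind, ht⟩
    cases P with
    | nil => simp at hP
    | cons q P =>
      simp only [List.map_cons, List.cons.injEq, List.map_eq_nil_iff] at hP
      obtain ⟨rfl, rfl⟩ := hP
      exact h U t ⟨P, rfl, by simpa using hU, fun p hp => hind p (List.mem_cons_of_mem _ hp),
        fun p hp => ht p (List.mem_cons_of_mem _ hp)⟩

/-- The ways in which the vertices of a part split into presented and other ones. -/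
def splits : List ℕ → List (List ℕ × List ℕ)
  | [] => [([], [])]
  | a :: q => (splits q).map (fun x => (a :: x.1, x.2)) ++ (splits q).map fun x => (x.1, a :: x.2)

/-- The part that remains of a split part if Painter does not use it. -/
def decPart (x : List ℕ × List ℕ) : List ℕ := x.1.map Nat.pred ++ x.2

theorem filter_mem_splits {α : Type*} (f : α × ℕ → Bool) (p : List (α × ℕ)) :
    ((p.filter f).map Prod.snd, (p.filter fun x => !f x).map Prod.snd) ∈
      splits (p.map Prod.snd) := by
  induction p with
  | nil => simp [splits]
  | cons x p ih =>
    simp only [List.map_cons, splits, List.mem_append, List.mem_map, List.filter_cons]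
    cases h : f x
    · exact Or.inr ⟨_, ih, by simp⟩
    · exact Or.inl ⟨_, ih, by simp⟩

/-- Painter has a good reply to the move `M` of Lister, given by the splits of the parts. -/
def Answered (G : SimpleGraph V) (r : ℕ) (M : List (List ℕ × List ℕ)) : Prop :=
  ∃ x M', M.Perm (x :: M') ∧ GoodState G r (x.2 :: M'.map decPart)

theorem Answered.perm {M M' : List (List ℕ × List ℕ)} (h : Answered G r M') (hM : M.Perm M') :
    Answered G r M := by
  obtain ⟨x, N, hN, hg⟩ := h
  exact ⟨x, N, hM.trans hN, hg⟩

theorem goodState_of_answered {F : List (List ℕ)} (hF : ∀ p ∈ F, ∀ a ∈ p, 0 < a)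
    (h : ∀ M, List.Forall₂ (fun x p => x ∈ splits p) M F →
      Answered G r M ∨ ∀ x ∈ M, x.1 = []) : GoodState G r F := by
  rintro U t ⟨P, rfl, hU, hind, ht⟩
  have hpos : ∀ p ∈ P, ∀ x ∈ p, 0 < x.2 := fun p hp x hx =>
    hF _ (List.mem_map_of_mem hp) _ (List.mem_map_of_mem hx)
  have hmem : ∀ v, v ∈ U ↔ ∃ p ∈ P, ∃ x ∈ p, x.1 = v := by
    intro v
    rw [← Finset.mem_toList, ← hU.mem_iff]
    simp only [List.mem_map, List.mem_flatten]
    constructor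
    · rintro ⟨x, ⟨p, hp, hx⟩, rfl⟩
      exact ⟨p, hp, x, hx, rfl⟩
    · rintro ⟨p, hp, x, hx, rfl⟩
      exact ⟨x, ⟨p, hp, hx⟩, rfl⟩
  refine wins_of_round ?_ fun S hS hS' => ?_
  · intro v hv
    obtain ⟨p, hp, x, hx, rfl⟩ := (hmem v).1 hv
    have := hpos p hp x hx
    have := ht p hp x hx
    omega
  · set f : V × ℕ → Bool := fun x => decide (x.1 ∈ S) with hf
    set g : List (V × ℕ) → List ℕ × List ℕ := fun p =>
      ((p.filter f).map Prod.snd, (p.filter fun x => !f x).map Prod.snd) with hg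
    rcases h (P.map g) (List.forall₂_map_left_iff.2 (List.forall₂_map_right_iff.2
      (List.forall₂_same.2 fun p _ => filter_mem_splits f p))) with ⟨x, M', hM, hw⟩ | hnil
    · obtain ⟨p, P', hP, rfl, rfl⟩ :
          ∃ p P', P.Perm (p :: P') ∧ g p = x ∧ P'.map g = M' := by
        obtain ⟨p, hp, hx⟩ := List.mem_map.1 (hM.mem_iff.2 (List.mem_cons_self ..))
        obtain ⟨a, b, rfl⟩ := List.append_of_mem hp
        have h1 : (a ++ p :: b).Perm (p :: (a ++ b)) := List.perm_middle
        have h2 : ((a ++ b).map g).Perm M' := by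
          have := (h1.map g).symm.trans hM
          rw [List.map_cons, hx] at this
          exact this.cons_inv
        obtain ⟨P', h3, h4⟩ := exists_perm_of_map_perm h2
        exact ⟨p, P', h1.trans (h3.cons p), hx, h4⟩
      have hp : p ∈ P := hP.mem_iff.2 (List.mem_cons_self ..)
      have hPn : ∀ q ∈ P', q ∈ P := fun q hq => hP.mem_iff.2 (List.mem_cons_of_mem _ hq)
      have hnodup : ((p :: P').flatten.map Prod.fst).Nodup :=
        ((hP.flatten.map _).symm.trans hU).nodup_iff.2 U.nodup_toList
      rw [List.flatten_cons, List.map_append, List.nodup_append] at hnodup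
      obtain ⟨hn1, hn2, hn3⟩ := hnodup
      refine ⟨((p.filter f).map Prod.fst).toFinset, ?_, ?_, hw _ _ ?_⟩
      · intro v hv
        simp only [List.mem_toFinset, List.mem_map, List.mem_filter] at hv
        obtain ⟨y, ⟨-, hy⟩, rfl⟩ := hv
        simpa [hf] using hy
      · intro u hu v hv
        simp only [List.mem_toFinset, List.mem_map, List.mem_filter] at hu hv
        obtain ⟨y, ⟨hy, -⟩, rfl⟩ := hu
        obtain ⟨z, ⟨hz, -⟩, rfl⟩ := hv
        exact hind p hp y hy z hz
      · refine ⟨(p.filter fun x => !f x) :: P'.map (fun q =>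
          ((q.filter f).map fun x => (x.1, x.2.pred)) ++ q.filter fun x => !f x), ?_, ?_, ?_, ?_⟩
        · simp [hg, decPart, Function.comp_def]
        · have hfl : ∀ Q : List (List (V × ℕ)), ((Q.map (fun q =>
              ((q.filter f).map fun x => (x.1, x.2.pred)) ++
                q.filter fun x => !f x)).flatten.map Prod.fst).Perm
              (Q.flatten.map Prod.fst) := by
            intro Q
            induction Q with
            | nil => exact List.Perm.refl _
            | cons q Q ih =>
              simp only [List.map_cons, List.flatten_cons, List.map_append]
              refine List.Perm.append ?_ ih
              rw [List.map_map]
              have := (List.filter_append_perm f q).map Prod.fst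
              rw [List.map_append] at this
              exact this
          rw [List.flatten_cons, List.map_append]
          refine (List.Perm.append_left _ (hfl P')).trans ?_
          refine (List.perm_ext_iff_of_nodup ?_ (Finset.nodup_toList _)).2 ?_
          · rw [List.nodup_append]
            refine ⟨hn1.sublist (List.filter_sublist.map _), hn2, fun a ha b hb => ?_⟩
            exact hn3 a ((List.filter_sublist.map _).subset ha) b hb
          · intro v
            rw [Finset.mem_toList, Finset.mem_sdiff, ← Finset.mem_toList,
              ← ((hP.flatten.map _).symm.trans hU).mem_iff, List.flatten_cons, List.map_append,
              List.mem_append, List.mem_append, List.mem_toFinset]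
            constructor
            · rintro (hv | hv)
              · obtain ⟨y, hy, rfl⟩ := List.mem_map.1 hv
                rw [List.mem_filter] at hy
                refine ⟨Or.inl (List.mem_map_of_mem hy.1), fun hv' => ?_⟩
                obtain ⟨z, hz, hzy⟩ := List.mem_map.1 hv'
                rw [List.mem_filter] at hz
                simp only [hf] at hy hz
                rw [hzy] at hz
                simp [hz.2] at hy
              · refine ⟨Or.inr hv, fun hv' => ?_⟩
                exact hn3 v ((List.filter_sublist.map _).subset hv') v hv rfl
            · rintro ⟨hv | hv, hv'⟩
              · left
                obtain ⟨y, hy, rfl⟩ := List.mem_map.1 hv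
                refine List.mem_map_of_mem (List.mem_filter.2 ⟨hy, ?_⟩)
                cases hfy : f y
                · rfl
                · exact absurd (List.mem_map_of_mem (List.mem_filter.2 ⟨hy, hfy⟩)) hv'
              · exact Or.inr hv
        · intro q hq
          rcases List.mem_cons.1 hq with rfl | hq
          · intro y hy z hz
            exact hind p hp y (List.mem_of_mem_filter hy) z (List.mem_of_mem_filter hz)
          · obtain ⟨q, hq', rfl⟩ := List.mem_map.1 hq
            have key : ∀ y ∈ ((q.filter f).map fun x => (x.1, x.2.pred)) ++
                q.filter (fun x => !f x), ∃ y' ∈ q, y'.1 = y.1 := by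
              intro y hy
              rcases List.mem_append.1 hy with hy | hy
              · obtain ⟨y', hy', rfl⟩ := List.mem_map.1 hy
                exact ⟨y', List.mem_of_mem_filter hy', rfl⟩
              · exact ⟨y, List.mem_of_mem_filter hy, rfl⟩
            intro y hy z hz
            obtain ⟨y', hy', e⟩ := key y hy
            obtain ⟨z', hz', e'⟩ := key z hz
            rw [← e, ← e']
            exact hind q (hPn q hq') y' hy' z' hz'
        · have key : ∀ q ∈ P, ∀ y ∈ q.filter (fun x => !f x),
              y.2 + (t y.1 + if y.1 ∈ S then 1 else 0) ≤ r := by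
            intro q hq y hy
            rw [List.mem_filter] at hy
            have h1 : y.1 ∉ S := by simpa [hf] using hy.2
            simpa [h1] using ht q hq y hy.1
          intro q hq
          rcases List.mem_cons.1 hq with rfl | hq
          · exact key p hp
          · obtain ⟨q, hq', rfl⟩ := List.mem_map.1 hq
            intro y hy
            rcases List.mem_append.1 hy with hy | hy
            · obtain ⟨y', hy', rfl⟩ := List.mem_map.1 hy
              rw [List.mem_filter] at hy'
              have h1 : y'.1 ∈ S := by simpa [hf] using hy'.2
              have h2 := ht q (hPn q hq') y' hy'.1
              have h3 := hpos q (hPn q hq') y' hy'.1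
              simp only [h1, if_true, Nat.pred_eq_sub_one]
              omega
            · exact key q (hPn q hq') y hy
    · obtain ⟨v, hv⟩ := hS'
      obtain ⟨p, hp, x, hx, rfl⟩ := (hmem v).1 (hS hv)
      have := hnil _ (List.mem_map_of_mem hp)
      simp only [hg, List.map_eq_nil_iff, List.filter_eq_nil_iff] at this
      exact absurd (by simpa [hf] using hv) (this x hx)

end ListStates

section MoveTrees

/-- Insertion into a sorted list. -/
def insertSorted (a : ℕ) : List ℕ → List ℕ
  | [] => [a]
  | b :: l => bif Nat.ble a b then a :: b :: l else b :: insertSorted a l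

/-- A sorted rearrangement of a list. -/
def sortPart : List ℕ → List ℕ
  | [] => []
  | a :: l => insertSorted a (sortPart l)

theorem insertSorted_perm (a : ℕ) (l : List ℕ) : (insertSorted a l).Perm (a :: l) := by
  induction l with
  | nil => exact List.Perm.refl _
  | cons b l ih =>
    rw [insertSorted]
    cases Nat.ble a b
    · exact (ih.cons b).trans (List.Perm.swap _ _ _)
    · exact List.Perm.refl _

theorem sortPart_perm (l : List ℕ) : (sortPart l).Perm l := by
  induction l with
  | nil => exact List.Perm.refl _
  | cons a l ih => exact (insertSorted_perm a _).trans (ih.cons a)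

/-- Entrywise comparison. -/
def tokensGE : List ℕ → List ℕ → Bool
  | [], [] => true
  | a :: p, b :: q => Nat.ble b a && tokensGE p q
  | _, _ => false

theorem forall₂_of_tokensGE {p q : List ℕ} (h : tokensGE p q = true) :
    List.Forall₂ (· ≥ ·) p q := by
  induction p generalizing q with
  | nil => cases q with
    | nil => exact List.Forall₂.nil
    | cons => cases h
  | cons a p ih => cases q with
    | nil => cases h
    | cons b q =>
      rw [tokensGE, Bool.and_eq_true] at h
      exact List.Forall₂.cons (Nat.le_of_ble_eq_true h.1) (ih h.2)

theorem partGE_of_tokensGE {p q : List ℕ} (h : tokensGE (sortPart p) q = true) : PartGE p q :=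
  ⟨_, sortPart_perm p, forall₂_of_tokensGE h⟩

/-- `stateGE F F'` holds if the parts of `F` can be matched with those of `F'` such that each of
them is entrywise at least its partner. -/
def stateGE : List (List ℕ) → List (List ℕ) → Bool
  | F, [] => F.isEmpty
  | F, q :: F' => aux F' (fun F₀ => stateGE F₀ F') q [] F
where
  /-- Tries the elements of the last argument as partners of `q`. -/
  aux (F' : List (List ℕ)) (k : List (List ℕ) → Bool) (q : List ℕ) :
      List (List ℕ) → List (List ℕ) → Bool
  | _, [] => false
  | pre, p :: F => (tokensGE p q && k (pre ++ F)) || aux F' k q (p :: pre) F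

theorem stateGE_aux {F' : List (List ℕ)} {k : List (List ℕ) → Bool} {q : List ℕ}
    {pre F : List (List ℕ)} (h : stateGE.aux F' k q pre F = true) :
    ∃ p F₀, (pre ++ F).Perm (p :: F₀) ∧ tokensGE p q = true ∧ k F₀ = true := by
  induction F generalizing pre with
  | nil => cases h
  | cons p F ih =>
    rw [stateGE.aux, Bool.or_eq_true, Bool.and_eq_true] at h
    rcases h with h | h
    · exact ⟨p, _, List.perm_middle, h⟩
    · obtain ⟨p', F₀, h1, h2⟩ := ih h
      exact ⟨p', F₀, (List.perm_middle.trans h1), h2⟩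

theorem exists_of_stateGE {F F' : List (List ℕ)} (h : stateGE F F' = true) :
    ∃ F₁, F.Perm F₁ ∧ List.Forall₂ PartGE F₁ F' := by
  induction F' generalizing F with
  | nil =>
    rw [stateGE, List.isEmpty_iff] at h
    exact ⟨[], h ▸ List.Perm.refl _, List.Forall₂.nil⟩
  | cons q F' ih =>
    rw [stateGE] at h
    obtain ⟨p, F₀, h1, h2, h3⟩ := stateGE_aux h
    obtain ⟨F₁, h4, h5⟩ := ih h3
    exact ⟨p :: F₁, h1.trans (h4.cons p),
      List.Forall₂.cons ⟨p, List.Perm.refl p, forall₂_of_tokensGE h2⟩ h5⟩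

/-- Trees that tell how to reply to the moves in a state. A leaf gives the index of the part that
Painter uses and the number of a good state that bounds the outcome; a node branches on whether
some part is split in the first way that is still possible. -/
inductive MoveTree
  | leaf (i k : ℕ)
  | node (l r : MoveTree)
  | impossible
  | idle

/-- Groups of parts of which only the possible splits are known: the pair `(os, k)` stands
for `k + 1` parts each of which is split in one of the ways in `os`. -/
abbrev Groups := List (List (List ℕ × List ℕ) × ℕ)

/-- `M` is a possible list of splits for the groups. -/
def Groups.Allows : Groups → List (List ℕ × List ℕ) → Prop
  | [], M => M = []
  | (os, k) :: gs, M => ∃ A B, M = A ++ B ∧ A.length = k + 1 ∧ (∀ x ∈ A, x ∈ os) ∧ Allows gs B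

/-- The entrywise minimum of what remains of a part after the given splits. -/
def worstPart : List (List ℕ × List ℕ) → List ℕ
  | [] => []
  | [x] => sortPart (decPart x)
  | x :: os => List.zipWith min (sortPart (decPart x)) (worstPart os)

/-- A lower bound for what remains of the parts in the groups. -/
def Groups.worst : Groups → List (List ℕ)
  | [] => []
  | (os, k) :: gs => List.replicate (k + 1) (worstPart os) ++ worst gs

/-- Correctness of `Groups.worst`. -/
def Groups.checkWorst : Groups → Bool
  | [] => true
  | (os, _) :: gs =>
    os.all (fun x => tokensGE (sortPart (decPart x)) (worstPart os)) && checkWorst gs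

/-- The groups after one of `k + 1` parts has been removed from the first group. -/
def Groups.takeOne (os : List (List ℕ × List ℕ)) (k : ℕ) (gs : Groups) : Groups :=
  match k with
  | 0 => gs
  | k + 1 => (os, k) :: gs

/-- Checks a tree of moves and replies. -/
def MoveTree.check (T : List (List (List ℕ))) :
    MoveTree → List (List ℕ × List ℕ) → Groups → Bool
  | leaf i k, pre, gs =>
    match pre[i]?, T[k]? with
    | some x, some F =>
      gs.checkWorst && stateGE (consPart (sortPart x.2)
        ((pre.eraseIdx i).map (fun y => sortPart (decPart y)) ++ gs.worst)) F
    | _, _ => false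
  | node l r, pre, (o :: os, k) :: gs =>
    l.check T (o :: pre) (Groups.takeOne (o :: os) k gs) && r.check T pre ((os, k) :: gs)
  | impossible, _, ([], _) :: _ => true
  | idle, pre, [] => pre.all fun x => x.1.isEmpty
  | _, _, _ => false

theorem Groups.forall₂_worst {gs : Groups} {M : List (List ℕ × List ℕ)} (h : gs.Allows M)
    (hgs : gs.checkWorst = true) : List.Forall₂ PartGE (M.map decPart) gs.worst := by
  induction gs generalizing M with
  | nil => cases h; exact List.Forall₂.nil
  | cons g gs ih =>
    obtain ⟨os, k⟩ := g
    obtain ⟨A, B, rfl, hA, hos, hB⟩ := h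
    rw [Groups.checkWorst, Bool.and_eq_true, List.all_eq_true] at hgs
    rw [List.map_append, Groups.worst, ← hA]
    refine List.rel_append ?_ (ih hB hgs.2)
    clear hA
    induction A with
    | nil => exact List.Forall₂.nil
    | cons x A ihA =>
      exact List.Forall₂.cons (partGE_of_tokensGE (hgs.1 x (hos x (by simp))))
        (ihA fun y hy => hos y (by simp [hy]))

variable {V : Type*} [Fintype V] [DecidableEq V] {G : SimpleGraph V} {r : ℕ}

theorem goodState_of_stateGE {F F' : List (List ℕ)} (h : GoodState G r F')
    (hF : stateGE F F' = true) : GoodState G r F := by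
  obtain ⟨F₁, h1, h2⟩ := exists_of_stateGE hF
  exact (h.mono h2).perm h1

theorem MoveTree.answered_of_check {T : List (List (List ℕ))} (hT : ∀ F ∈ T, GoodState G r F)
    {c : MoveTree} {pre : List (List ℕ × List ℕ)} {gs : Groups} (h : c.check T pre gs = true)
    {M : List (List ℕ × List ℕ)} (hM : gs.Allows M) :
    Answered G r (pre ++ M) ∨ ∀ x ∈ pre ++ M, x.1 = [] := by
  induction c generalizing pre gs M with
  | leaf i k =>
    rw [MoveTree.check] at h
    split at h
    · rename_i x F hx hF
      rw [Bool.and_eq_true] at h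
      obtain ⟨hi, hx⟩ := List.getElem?_eq_some_iff.1 hx
      have hperm : pre.Perm (x :: pre.eraseIdx i) := by
        rw [← hx]
        exact (List.getElem_cons_eraseIdx_perm hi).symm
      refine Or.inl ⟨x, pre.eraseIdx i ++ M, hperm.append_right M, ?_⟩
      have h1 := goodState_of_stateGE (hT F (List.mem_of_getElem? hF)) h.2
      refine h1.of_consPart.mono (List.Forall₂.cons ⟨_, sortPart_perm _,
        List.forall₂_same.2 fun _ _ => le_rfl⟩ ?_)
      rw [List.map_append]
      refine List.rel_append ?_ (Groups.forall₂_worst hM h.1)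
      rw [List.forall₂_map_left_iff, List.forall₂_map_right_iff]
      exact List.forall₂_same.2 fun y _ =>
        ⟨_, sortPart_perm _, List.forall₂_same.2 fun _ _ => le_rfl⟩
    · cases h
  | node c₁ c₂ ihl ihr =>
    match gs with
    | [] => cases h
    | ([], k) :: gs => cases h
    | (o :: os, k) :: gs =>
      rw [MoveTree.check, Bool.and_eq_true] at h
      obtain ⟨A, B, rfl, hA, hos, hB⟩ := hM
      by_cases ho : o ∈ A
      · obtain ⟨A', hA'⟩ : ∃ A', A.Perm (o :: A') := ⟨_, List.perm_cons_erase ho⟩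
        have hlen : A'.length = k := by
          have := hA'.length_eq
          rw [hA, List.length_cons] at this
          omega
        have hperm : (pre ++ (A ++ B)).Perm ((o :: pre) ++ (A' ++ B)) := by
          refine (List.Perm.append_left pre (hA'.append_right B)).trans ?_
          exact List.perm_middle
        have key : Answered G r ((o :: pre) ++ (A' ++ B)) ∨
            ∀ x ∈ (o :: pre) ++ (A' ++ B), x.1 = [] := by
          refine ihl h.1 ?_
          cases k with
          | zero =>
            rw [List.length_eq_zero_iff] at hlen
            subst hlen
            exact hB
          | succ k =>
            exact ⟨A', B, rfl, hlen, fun x hx => hos x (hA'.mem_iff.2 (by simp [hx])), hB⟩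
        exact key.imp (fun h => h.perm hperm) fun h x hx => h x (hperm.mem_iff.1 hx)
      · refine ihr h.2 ⟨A, B, rfl, hA, fun x hx => ?_, hB⟩
        rcases List.mem_cons.1 (hos x hx) with rfl | h
        · exact absurd hx ho
        · exact h
  | impossible =>
    match gs with
    | [] => cases h
    | ([], k) :: gs =>
      obtain ⟨A, B, rfl, hA, hos, hB⟩ := hM
      cases A with
      | nil => simp at hA
      | cons a A => exact absurd (hos a (by simp)) (by simp)
    | (o :: os, k) :: gs => cases h
  | idle =>
    match gs with
    | g :: gs => cases h
    | [] =>
      cases hM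
      rw [MoveTree.check, List.all_eq_true] at h
      exact Or.inr fun x hx => List.isEmpty_iff.1 (h x (by simpa using hx))

/-- The state with `k + 1` parts `p` for each `(p, k)` in the list. -/
def expandState : List (List ℕ × ℕ) → List (List ℕ)
  | [] => []
  | (p, k) :: gs => List.replicate (k + 1) p ++ expandState gs

/-- Checks a sequence of trees, where each may use the states of the earlier ones. -/
def checkTrees (T : List (List (List ℕ))) : List (List (List ℕ × ℕ) × MoveTree) → Bool
  | [] => true
  | (gs, c) :: L =>
    gs.all (fun g => g.1.all fun a => Nat.ble 1 a) &&
      c.check T [] (gs.map fun g => ((splits g.1).dedup, g.2)) &&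
      checkTrees (T ++ [expandState gs]) L

theorem allows_of_forall₂ {gs : List (List ℕ × ℕ)} {M : List (List ℕ × List ℕ)}
    (h : List.Forall₂ (fun x p => x ∈ splits p) M (expandState gs)) :
    Groups.Allows (gs.map fun g => ((splits g.1).dedup, g.2)) M := by
  induction gs generalizing M with
  | nil => cases h; rfl
  | cons g gs ih =>
    obtain ⟨p, k⟩ := g
    rw [expandState] at h
    have h1 := List.forall₂_take_append _ _ _ h
    have h2 := List.forall₂_drop_append _ _ _ h
    refine ⟨_, _, (List.take_append_drop _ M).symm, ?_, ?_, ih h2⟩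
    · simpa using h1.length_eq
    · intro x hx
      obtain ⟨n, hn, rfl⟩ := List.getElem_of_mem hx
      have := h1.get hn (h1.length_eq ▸ hn)
      simpa using this

theorem goodState_of_checkTrees {T : List (List (List ℕ))} (hT : ∀ F ∈ T, GoodState G r F)
    {L : List (List (List ℕ × ℕ) × MoveTree)} (h : checkTrees T L = true) :
    ∀ x ∈ L, GoodState G r (expandState x.1) := by
  induction L generalizing T with
  | nil => simp
  | cons x L ih =>
    obtain ⟨gs, c⟩ := x
    rw [checkTrees, Bool.and_eq_true, Bool.and_eq_true] at h
    obtain ⟨⟨h1, h2⟩, h3⟩ := h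
    have key : GoodState G r (expandState gs) := by
      refine goodState_of_answered ?_ fun M hM => ?_
      · clear h2 h3
        induction gs with
        | nil => simp [expandState]
        | cons g gs ih =>
          obtain ⟨p, k⟩ := g
          rw [List.all_cons, Bool.and_eq_true, List.all_eq_true] at h1
          intro q hq
          rw [expandState, List.mem_append] at hq
          rcases hq with hq | hq
          · intro a ha
            rw [List.eq_of_mem_replicate hq] at ha
            exact Nat.le_of_ble_eq_true (h1.1 a ha)
          · exact ih h1.2 q hq
      · exact MoveTree.answered_of_check hT h2 (allows_of_forall₂ hM)
    intro x hx
    rcases List.mem_cons.1 hx with rfl | hx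
    · exact key
    · refine ih (fun F hF => ?_) h3 x hx
      rcases List.mem_append.1 hF with hF | hF
      · exact hT F hF
      · rw [List.mem_singleton.1 hF]
        exact key

end MoveTrees

section Removal

variable {R : Type*} [CommRing R]

/-- The operator on functions of finite sets that removes `e`, with the sign of its position. It
kills everything if `e` is not below `N`. -/
def removal (R : Type*) [CommRing R] (N e : ℕ) : Module.End R (Finset ℕ → R) where
  toFun Φ A := if e < N ∧ e ∈ A then (-1) ^ (A.filter (· < e)).card * Φ (A.erase e) else 0
  map_add' Φ Ψ := by
    ext A
    simp only [Pi.add_apply]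
    split_ifs <;> ring
  map_smul' c Φ := by
    ext A
    simp only [Pi.smul_apply, smul_eq_mul, RingHom.id_apply]
    split_ifs <;> ring

theorem removal_apply (N e : ℕ) (Φ : Finset ℕ → R) (A : Finset ℕ) : removal R N e Φ A =
    if e < N ∧ e ∈ A then (-1) ^ (A.filter (· < e)).card * Φ (A.erase e) else 0 := rfl

theorem removal_of_le {N e : ℕ} (h : N ≤ e) : removal R N e = 0 := by
  ext Φ A
  rw [removal_apply, if_neg fun h' => absurd h'.1 (not_lt.2 h)]
  rfl

theorem removal_mul_self (N e : ℕ) : removal R N e * removal R N e = 0 := by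
  ext Φ A
  rw [Module.End.mul_apply, removal_apply, removal_apply]
  simp

theorem removal_mul_comm_of_lt {N a b : ℕ} (hab : a < b) :
    removal R N a * removal R N b = -(removal R N b * removal R N a) := by
  ext Φ A
  rw [LinearMap.neg_apply, Pi.neg_apply, Module.End.mul_apply, Module.End.mul_apply,
    removal_apply, removal_apply, removal_apply, removal_apply]
  by_cases h : (a < N ∧ a ∈ A) ∧ b < N ∧ b ∈ A
  · obtain ⟨⟨ha, haA⟩, hb, hbA⟩ := h
    have h1 : (A.erase a).filter (· < b) = (A.filter (· < b)).erase a := Finset.filter_erase ..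
    have h2 : (A.erase b).filter (· < a) = A.filter (· < a) := by
      rw [Finset.filter_erase, Finset.erase_eq_of_notMem]
      simp [hab.le]
    have h3 : (A.filter (· < b)).card = ((A.filter (· < b)).erase a).card + 1 :=
      (Finset.card_erase_add_one (by simp [haA, hab])).symm
    simp only [ha, haA, hb, hbA, Finset.mem_erase, hab.ne, hab.ne', true_and, ne_eq,
      not_false_eq_true, if_true, h1, h2, h3]
    rw [Finset.erase_right_comm]
    ring
  · simp only [Finset.mem_erase]
    rw [not_and_or] at h
    rcases h with h | h
    · simp only [h, if_false]
      rw [if_neg (c := a < N ∧ a ≠ b ∧ a ∈ A) fun h' => h ⟨h'.1, h'.2.2⟩]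
      simp
    · simp only [h, if_false]
      rw [if_neg (c := b < N ∧ b ≠ a ∧ b ∈ A) fun h' => h ⟨h'.1, h'.2.2⟩]
      simp

theorem removal_mul_comm (N a b : ℕ) :
    removal R N a * removal R N b = -(removal R N b * removal R N a) := by
  rcases lt_trichotomy a b with h | rfl | h
  · exact removal_mul_comm_of_lt h
  · rw [removal_mul_self, neg_zero]
  · rw [removal_mul_comm_of_lt h, neg_neg]

/-- The product of removal operators. -/
def removals (R : Type*) [CommRing R] (N : ℕ) (es : List ℕ) : Module.End R (Finset ℕ → R) :=
  (es.map (removal R N)).prod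

theorem removals_cons (N e : ℕ) (es : List ℕ) :
    removals R N (e :: es) = removal R N e * removals R N es := List.prod_cons

theorem removals_append (N : ℕ) (es es' : List ℕ) :
    removals R N (es ++ es') = removals R N es * removals R N es' := by
  rw [removals, List.map_append, List.prod_append]
  rfl

theorem det_eq_removals {N n : ℕ} (e c : Fin n → ℕ) (hc : StrictMono c) (hN : ∀ i, c i < N) :
    (Matrix.of fun i j => if e i = c j then (1 : R) else 0).det =
      removals R N (List.ofFn e) (fun _ => 1) (Finset.univ.image c) := by
  induction n with
  | zero => simp [removals]
  | succ n ih =>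
    rw [Matrix.det_succ_row_zero, List.ofFn_succ, removals_cons, Module.End.mul_apply,
      removal_apply]
    have hsub : ∀ j : Fin (n + 1),
        ((Matrix.of fun i j => if e i = c j then (1 : R) else 0).submatrix
        Fin.succ j.succAbove).det = removals R N (List.ofFn fun i => e (Fin.succ i)) (fun _ => 1)
          ((Finset.univ.image c).erase (c j)) := by
      intro j
      have := ih (fun i => e i.succ) (fun i => c (j.succAbove i))
        (hc.comp (Fin.strictMono_succAbove j)) (fun i => hN _)
      rw [show (Finset.univ.image c).erase (c j) =
        Finset.univ.image (fun i => c (j.succAbove i)) from ?_, ← this]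
      · rfl
      · change _ = Finset.univ.image (c ∘ j.succAbove)
        rw [← Finset.image_image, Fin.image_succAbove_univ]
        ext x
        simp only [Finset.mem_erase, Finset.mem_image, Finset.mem_univ, true_and,
          Finset.mem_compl, Finset.mem_singleton]
        constructor
        · rintro ⟨h, i, rfl⟩
          exact ⟨i, fun hi => h (hi ▸ rfl), rfl⟩
        · rintro ⟨i, hi, rfl⟩
          exact ⟨fun h => hi (hc.injective h), i, rfl⟩
    by_cases h : ∃ j, e 0 = c j
    · obtain ⟨j, hj⟩ := h
      rw [Finset.sum_eq_single j, hsub, if_pos ⟨hj ▸ hN j, by rw [hj]; simp⟩]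
      · have : ((Finset.univ.image c).filter (· < e 0)).card = j := by
          rw [Finset.filter_image, Finset.card_image_of_injective _ hc.injective]
          simp only [hj, hc.lt_iff_lt]
          rw [Finset.filter_gt_eq_Iio, Fin.card_Iio]
        rw [this, hj]
        simp [hj]
      · intro i _ hi
        have : e 0 ≠ c i := fun h' => hi (hc.injective (h'.symm.trans hj))
        simp [this]
      · simp
    · rw [if_neg]
      · refine Finset.sum_eq_zero fun j _ => ?_
        have : e 0 ≠ c j := fun h' => h ⟨j, h'⟩
        simp [this]
      · rintro ⟨-, h'⟩
        obtain ⟨j, -, hj⟩ := Finset.mem_image.1 h'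
        exact h ⟨j, hj.symm⟩

end Removal

section Vandermonde

variable {V : Type*}

theorem coeff_prod_sub {n : ℕ} {v : Fin n → V} (hv : Function.Injective v) (e : Fin n → ℕ) :
    coeff (∑ i, Finsupp.single (v i) (e i))
        (∏ i : Fin n, ∏ j ∈ Finset.Ioi i, (X (v j) - X (v i)) : MvPolynomial V ℤ) =
      (Matrix.of fun i j : Fin n => if e i = (j : ℕ) then (1 : ℤ) else 0).det := by
  classical
  rw [← Matrix.det_vandermonde fun i => (X (v i) : MvPolynomial V ℤ), Matrix.det_apply',
    Matrix.det_apply', coeff_sum]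
  refine Finset.sum_congr rfl fun σ _ => ?_
  have h1 : ∏ i, Matrix.vandermonde (fun i => (X (v i) : MvPolynomial V ℤ)) (σ i) i =
      monomial (∑ i, Finsupp.single (v i) ((σ⁻¹ i : Fin n) : ℕ)) 1 := by
    rw [← Equiv.prod_comp σ⁻¹, monomial_sum_one]
    refine Finset.prod_congr rfl fun i _ => ?_
    simp [Matrix.vandermonde_apply, X_pow_eq_monomial]
  have h2 : ∏ i, (Matrix.of fun i j : Fin n => if e i = (j : ℕ) then (1 : ℤ) else 0) (σ i) i =
      if ∑ i, Finsupp.single (v i) ((σ⁻¹ i : Fin n) : ℕ) = ∑ i, Finsupp.single (v i) (e i)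
        then 1 else 0 := by
    rw [← Equiv.prod_comp σ⁻¹]
    have : (∑ i, Finsupp.single (v i) ((σ⁻¹ i : Fin n) : ℕ) = ∑ i, Finsupp.single (v i) (e i)) ↔
        ∀ i ∈ Finset.univ, e i = ((σ⁻¹ i : Fin n) : ℕ) := by
      constructor
      · intro h k _
        have := DFunLike.congr_fun h (v k)
        simpa [Finsupp.finsetSum_apply, Finsupp.single_apply, hv.eq_iff, eq_comm] using this
      · intro h
        exact Finset.sum_congr rfl fun i hi => by rw [h i hi]
    simp only [if_congr this rfl rfl, Matrix.of_apply, ← Equiv.Perm.mul_apply, mul_inv_cancel,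
      Equiv.Perm.one_apply]
    rw [Finset.prod_ite_zero]
    simp
  rw [h1, h2, show ((Equiv.Perm.sign σ : ℤ) : MvPolynomial V ℤ) = C (Equiv.Perm.sign σ : ℤ) by simp,
    coeff_C_mul, coeff_monomial]
  rfl

/-- The pairs of entries of a list, the later entry first. -/
def pairs : List V → List (V × V)
  | [] => []
  | a :: l => l.map (fun b => (b, a)) ++ pairs l

/-- The monomial with the given variables and exponents. -/
noncomputable def exponents : List V → List ℕ → V →₀ ℕ
  | v :: vs, e :: es => Finsupp.single v e + exponents vs es
  | _, _ => 0

theorem edgePoly_append (E E' : List (V × V)) :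
    edgePoly (E ++ E') = edgePoly E * edgePoly E' := by
  simp [edgePoly]

theorem edgePoly_perm {E E' : List (V × V)} (h : E.Perm E') : edgePoly E = edgePoly E' :=
  (h.map _).prod_eq

theorem edgePoly_pairs_ofFn {n : ℕ} (v : Fin n → V) : edgePoly (pairs (List.ofFn v)) =
    ∏ i : Fin n, ∏ j ∈ Finset.Ioi i, (X (v j) - X (v i)) := by
  induction n with
  | zero => simp [pairs, edgePoly]
  | succ n ih =>
    rw [List.ofFn_succ, pairs, edgePoly_append, ih, Fin.prod_univ_succ, Fin.prod_Ioi_zero]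
    congr 1
    · simp [edgePoly, List.map_ofFn, Function.comp_def, List.prod_ofFn]
    · exact Finset.prod_congr rfl fun i _ => by rw [Fin.prod_Ioi_succ]

theorem exponents_ofFn {n : ℕ} (v : Fin n → V) (e : Fin n → ℕ) :
    exponents (List.ofFn v) (List.ofFn e) = ∑ i, Finsupp.single (v i) (e i) := by
  induction n with
  | zero => simp [exponents]
  | succ n ih => rw [List.ofFn_succ, List.ofFn_succ, exponents, ih, Fin.sum_univ_succ]

theorem coeff_edgePoly_pairs (R : Type*) [CommRing R] {vs : List V} (hvs : vs.Nodup) {es : List ℕ}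
    (hes : es.length = vs.length) : ((coeff (exponents vs es) (edgePoly (pairs vs)) : ℤ) : R) =
      removals R vs.length es (fun _ => 1) (Finset.range vs.length) := by
  obtain ⟨n, v, rfl⟩ : ∃ n, ∃ v : Fin n → V, vs = List.ofFn v :=
    ⟨_, vs.get, (List.ofFn_get vs).symm⟩
  rw [List.length_ofFn] at hes ⊢
  subst hes
  obtain ⟨e, he⟩ : ∃ e : Fin es.length → ℕ, es = List.ofFn e := ⟨_, (List.ofFn_get es).symm⟩
  generalize es.length = n at *
  subst he
  rw [edgePoly_pairs_ofFn, exponents_ofFn, coeff_prod_sub (List.nodup_ofFn.1 hvs)]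
  have := det_eq_removals (R := R) e (fun i : Fin n => (i : ℕ)) Fin.val_strictMono (fun i => i.2)
  rw [show Finset.range n = Finset.univ.image (fun i : Fin n => (i : ℕ)) by
    ext x; simp [Fin.exists_iff], ← this, Int.cast_det]
  congr 1
  ext i j
  by_cases h : e i = j <;> simp [h]

end Vandermonde

section Division

variable {V : Type*}

theorem sum_flatMap {α M : Type*} [AddMonoid M] (l : List α) (f : α → List M) :
    (l.flatMap f).sum = (l.map fun a => (f a).sum).sum := by
  induction l with
  | nil => rfl
  | cons a l ih => simp [ih]

theorem coeff_divide {P Q : MvPolynomial V ℤ} {a b : V} (hQ : Q = P * (X b - X a)) (hab : a ≠ b)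
    {κ : V →₀ ℕ} (hκ : κ a = 0) (x y : ℕ) :
    coeff (κ + (Finsupp.single a x + Finsupp.single b y)) P = ((List.range (x + 1)).map fun j =>
      coeff (κ + (Finsupp.single a (x - j) + Finsupp.single b (y + j + 1))) Q).sum := by
  classical
  have step : ∀ x y, coeff (κ + (Finsupp.single a x + Finsupp.single b (y + 1))) Q =
      coeff (κ + (Finsupp.single a x + Finsupp.single b y)) P -
        coeff (κ + (Finsupp.single a x + Finsupp.single b (y + 1))) (P * X a) := by
    intro x y
    rw [hQ, mul_sub, coeff_sub, Finsupp.single_add, ← add_assoc, ← add_assoc, coeff_mul_X,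
      add_assoc, add_assoc, add_assoc]
  induction x generalizing y with
  | zero =>
    simp only [zero_add, List.range_one, List.map_cons, List.map_nil, List.sum_cons, List.sum_nil,
      Nat.sub_self, add_zero]
    rw [step, coeff_mul_X', if_neg, sub_zero]
    simp [hκ, hab]
  | succ x ih =>
    rw [List.range_succ_eq_map, List.map_cons, List.sum_cons, List.map_map]
    have h : coeff (κ + (Finsupp.single a (x + 1) + Finsupp.single b (y + 1))) (P * X a) =
        coeff (κ + (Finsupp.single a x + Finsupp.single b (y + 1))) P := by
      rw [Finsupp.single_add, show κ + (Finsupp.single a x + Finsupp.single a 1 +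
        Finsupp.single b (y + 1)) = κ + (Finsupp.single a x + Finsupp.single b (y + 1)) +
          Finsupp.single a 1 by abel, coeff_mul_X]
    rw [Nat.sub_zero, add_zero, step, h, ih (y + 1)]
    simp only [Function.comp_def, Nat.succ_eq_add_one, Nat.add_sub_add_right, add_right_comm y,
      add_assoc y, add_comm 1, sub_add_cancel]

/-- The exponents of the monomials that remain after dividing the Vandermonde product of a part of
at most three vertices out. -/
def divisionTerms : List ℕ → List (List ℕ)
  | [x] => [[x]]
  | [x, y] => (List.range (x + 1)).map fun j => [x - j, y + j + 1]
  | [x, y, z] => (List.range (x + 1)).flatMap fun i => (List.range (x - i + 1)).flatMap fun j =>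
      (List.range (y + i + 1 + 1)).map fun k => [x - i - j, y + i + 1 - k, z + j + 1 + k + 1]
  | _ => []

theorem length_of_mem_divisionTerms {M t : List ℕ} (h : t ∈ divisionTerms M) :
    t.length = M.length := by
  unfold divisionTerms at h
  split at h <;> simp at h
  · simp [h]
  · obtain ⟨_, _, rfl⟩ := h
    rfl
  · obtain ⟨_, _, _, _, _, _, rfl⟩ := h
    rfl

theorem coeff_divisionTerms {P Q : MvPolynomial V ℤ} {p : List V} {M : List ℕ} (hp : p.Nodup)
    (hM : M.length = p.length) (h1 : 1 ≤ p.length) (h3 : p.length ≤ 3)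
    (hQ : Q = P * edgePoly (pairs p)) {κ : V →₀ ℕ} (hκ : ∀ v ∈ p, κ v = 0) :
    coeff (κ + exponents p M) P =
      ((divisionTerms M).map fun t => coeff (κ + exponents p t) Q).sum := by
  match p, M with
  | [a], [x] => simp [divisionTerms, hQ, pairs, edgePoly]
  | [a, b], [x, y] =>
    simp only [divisionTerms, List.map_map]
    rw [show exponents [a, b] [x, y] = Finsupp.single a x + Finsupp.single b y by
      simp [exponents]]
    refine (coeff_divide (P := P) (Q := Q) (κ := κ) (a := a) (b := b) ?_ ?_ ?_ x y).trans ?_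
    · simp [hQ, pairs, edgePoly]
    · simpa using hp
    · exact hκ a (by simp)
    · simp [exponents, Function.comp_def]
  | [a, b, c], [x, y, z] =>
    simp only [List.nodup_cons, List.mem_cons, List.not_mem_nil, or_false, not_or] at hp
    obtain ⟨⟨hab, hac⟩, hbc, -⟩ := hp
    have ha := hκ a (by simp)
    have hb := hκ b (by simp)
    have hc := hκ c (by simp)
    rw [show κ + exponents [a, b, c] [x, y, z] =
      κ + Finsupp.single c z + (Finsupp.single a x + Finsupp.single b y) by
        simp only [exponents]; abel]
    rw [coeff_divide (Q := P * (X b - X a)) rfl hab (by simp [ha, hac])]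
    simp only [divisionTerms, List.map_flatMap, sum_flatMap, List.map_map]
    congr 1
    refine List.map_congr_left fun i _ => ?_
    rw [show κ + Finsupp.single c z + (Finsupp.single a (x - i) + Finsupp.single b (y + i + 1)) =
      κ + Finsupp.single b (y + i + 1) + (Finsupp.single a (x - i) + Finsupp.single c z) by abel,
      coeff_divide (Q := P * (X b - X a) * (X c - X a)) rfl hac (by simp [ha, hab])]
    congr 1
    refine List.map_congr_left fun j _ => ?_
    rw [show κ + Finsupp.single b (y + i + 1) +
        (Finsupp.single a (x - i - j) + Finsupp.single c (z + j + 1)) =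
      κ + Finsupp.single a (x - i - j) +
        (Finsupp.single b (y + i + 1) + Finsupp.single c (z + j + 1)) by abel,
      coeff_divide (Q := Q) ?_ hbc (by simp [hb, Ne.symm hab])]
    · congr 1
      refine List.map_congr_left fun k _ => ?_
      simp only [Function.comp_apply, exponents]
      congr 1
      abel
    · simp [hQ, pairs, edgePoly, mul_assoc]

end Division

section Parts

variable {V : Type*}

/-- The operator that a part with the given exponents contributes. -/
def partOperator (R : Type*) [CommRing R] (N : ℕ) (M : List ℕ) : Module.End R (Finset ℕ → R) :=
  ((divisionTerms M).map (removals R N)).sum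

theorem sum_end_apply {R α : Type*} [CommRing R] (l : List α)
    (g : α → Module.End R (Finset ℕ → R)) (Φ : Finset ℕ → R) (A : Finset ℕ) :
    (l.map g).sum Φ A = (l.map fun t => g t Φ A).sum := by
  induction l with
  | nil => rfl
  | cons t l ih => simp [ih]

theorem exponents_append {vs ws : List V} {es fs : List ℕ} (h : es.length = vs.length) :
    exponents (vs ++ ws) (es ++ fs) = exponents vs es + exponents ws fs := by
  induction vs generalizing es with
  | nil => simp [List.length_eq_zero_iff.1 h, exponents]
  | cons v vs ih =>
    cases es with
    | nil => simp at h
    | cons e es =>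
      simp only [List.cons_append, exponents]
      rw [ih (by simpa using h), add_assoc]

theorem exponents_eq_zero {vs : List V} {es : List ℕ} {v : V} (h : v ∉ vs) :
    exponents vs es v = 0 := by
  induction vs generalizing es with
  | nil => simp [exponents]
  | cons w vs ih =>
    rw [List.mem_cons, not_or] at h
    cases es with
    | nil => simp [exponents]
    | cons e es => simp [exponents, ih h.2, h.1]

theorem coeff_eq_partOperators (R : Type*) [CommRing R] {ps : List (List V)}
    {Ms : List (List ℕ)} (hM : Ms.map List.length = ps.map List.length)
    (h3 : ∀ p ∈ ps, 1 ≤ p.length ∧ p.length ≤ 3) {N : ℕ} {vs : List V} {es : List ℕ}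
    (hes : es.length = vs.length) (hnd : (vs ++ ps.flatten).Nodup)
    (hN : (vs ++ ps.flatten).length = N) {P : MvPolynomial V ℤ}
    (hP : P * edgePoly (ps.flatMap pairs) = edgePoly (pairs (vs ++ ps.flatten))) :
    ((coeff (exponents (vs ++ ps.flatten) (es ++ Ms.flatten)) P : ℤ) : R) =
      (removals R N es * (Ms.map (partOperator R N)).prod) (fun _ => 1) (Finset.range N) := by
  induction ps generalizing Ms vs es P with
  | nil =>
    obtain rfl : Ms = [] := by simpa using hM
    simp only [List.flatten_nil, List.append_nil, List.map_nil, List.prod_nil, mul_one,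
      List.flatMap_nil] at *
    rw [show edgePoly ([] : List (V × V)) = 1 from rfl, mul_one] at hP
    rw [hP, coeff_edgePoly_pairs R hnd hes, hN]
  | cons p ps ih =>
    obtain _ | ⟨M, Ms⟩ := Ms
    · simp at hM
    simp only [List.map_cons, List.cons.injEq] at hM
    obtain ⟨hlen, hM⟩ := hM
    obtain ⟨hp1, hp3⟩ := h3 p (by simp)
    rw [List.flatten_cons] at hnd hN hP ⊢
    rw [List.flatMap_cons, edgePoly_append, ← mul_assoc] at hP
    have hnd' := hnd
    rw [← List.append_assoc] at hnd' hN hP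
    have hdis := List.nodup_append.1 hnd
    have hdis' := List.nodup_append.1 hdis.2.1
    have key : exponents (vs ++ (p ++ ps.flatten)) (es ++ (M :: Ms).flatten) =
        exponents vs es + exponents ps.flatten Ms.flatten + exponents p M := by
      rw [List.flatten_cons, exponents_append hes, exponents_append hlen]
      abel
    rw [key, coeff_divisionTerms hdis'.1 hlen hp1 hp3 rfl]
    · rw [List.map_cons, List.prod_cons, partOperator, ← List.sum_map_mul_right,
        ← List.sum_map_mul_left, sum_end_apply, Int.cast_list_sum, List.map_map]
      congr 1
      refine List.map_congr_left fun t ht => ?_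
      have hlt := (length_of_mem_divisionTerms ht).trans hlen
      have := ih hM (fun q hq => h3 q (by simp [hq])) (vs := vs ++ p) (es := es ++ t)
        (by simp [hes, hlt]) hnd' hN hP
      rw [removals_append, List.append_assoc, List.append_assoc, exponents_append hes,
        exponents_append hlt] at this
      rw [← mul_assoc, ← this, Function.comp_apply]
      congr 2
      abel
    · intro v hv
      rw [Finsupp.add_apply, exponents_eq_zero, exponents_eq_zero]
      · exact fun h => hdis'.2.2 v hv v h rfl
      · exact fun h => hdis.2.2 v h v (by simp [hv]) rfl

end Parts

section CrossPairs

variable {V : Type*}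

theorem mem_pairs {l : List V} {u v : V} (hu : u ∈ l) (hv : v ∈ l) (huv : u ≠ v) :
    (u, v) ∈ pairs l ∨ (v, u) ∈ pairs l := by
  induction l with
  | nil => simp at hu
  | cons a l ih =>
    simp only [pairs, List.mem_append, List.mem_map, Prod.mk.injEq]
    rcases List.mem_cons.1 hu with rfl | hul <;> rcases List.mem_cons.1 hv with rfl | hvl
    · exact absurd rfl huv
    · exact Or.inr (Or.inl ⟨v, hvl, rfl, rfl⟩)
    · exact Or.inl (Or.inl ⟨u, hul, rfl, rfl⟩)
    · exact (ih hul hvl).imp Or.inr Or.inr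

theorem mem_of_mem_pairs {l : List V} {e : V × V} (h : e ∈ pairs l) : e.1 ∈ l ∧ e.2 ∈ l := by
  induction l with
  | nil => simp [pairs] at h
  | cons a l ih =>
    rcases List.mem_append.1 h with h | h
    · obtain ⟨b, hb, rfl⟩ := List.mem_map.1 h
      simp [hb]
    · exact (ih h).imp (List.mem_cons_of_mem a) (List.mem_cons_of_mem a)

theorem exists_pairs_append (p l : List V) :
    ∃ E, (E ++ pairs p ++ pairs l).Perm (pairs (p ++ l)) := by
  induction p with
  | nil => exact ⟨[], List.Perm.refl _⟩
  | cons a p ih =>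
    obtain ⟨E, hE⟩ := ih
    refine ⟨l.map (fun b => (b, a)) ++ E, ?_⟩
    rw [List.cons_append, pairs, pairs, List.map_append]
    refine List.Perm.trans ?_ (hE.append_left _)
    classical
    rw [List.perm_iff_count]
    intro e
    simp only [List.count_append]
    omega

theorem exists_pairs_flatten (ps : List (List V)) :
    ∃ E, (E ++ ps.flatMap pairs).Perm (pairs ps.flatten) := by
  induction ps with
  | nil => exact ⟨[], List.Perm.refl _⟩
  | cons p ps ih =>
    obtain ⟨E, hE⟩ := ih
    obtain ⟨E', hE'⟩ := exists_pairs_append p ps.flatten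
    refine ⟨E' ++ E, ?_⟩
    rw [List.flatten_cons, List.flatMap_cons]
    refine List.Perm.trans ?_ hE'
    refine List.Perm.trans ?_ (hE.append_left _)
    classical
    rw [List.perm_iff_count]
    intro e
    simp only [List.count_append]
    omega

theorem exponents_add_one {L : List (V × ℕ)} {es : List ℕ} (hL : (L.map Prod.fst).Nodup)
    (hes : L.map Prod.snd = es.map (· + 1)) {x : V × ℕ} (hx : x ∈ L) :
    exponents (L.map Prod.fst) es x.1 + 1 = x.2 := by
  induction L generalizing es with
  | nil => simp at hx
  | cons y L ih =>
    obtain _ | ⟨e, es⟩ := es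
    · simp at hes
    simp only [List.map_cons, List.cons.injEq, List.nodup_cons] at hes hL ⊢
    rw [exponents, Finsupp.add_apply]
    rcases List.mem_cons.1 hx with rfl | hx
    · simp [exponents_eq_zero hL.1, hes.1]
    · have : y.1 ≠ x.1 := fun h => hL.1 (h ▸ List.mem_map_of_mem hx)
      simp [this, ih hL.2 hes.2 hx]

end CrossPairs

section PartOperators

variable {V : Type*} [Fintype V] [DecidableEq V] {G : SimpleGraph V} {r : ℕ}

/-- A list state is good if the corresponding coefficient of the graph polynomial of the complete
multipartite graph does not vanish. -/
theorem goodState_of_partOperators {R : Type*} [CommRing R] {Ms : List (List ℕ)}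
    (hM : ∀ M ∈ Ms, 1 ≤ M.length ∧ M.length ≤ 3)
    (h : (Ms.map (partOperator R Ms.flatten.length)).prod (fun _ => 1)
      (Finset.range Ms.flatten.length) ≠ 0) : GoodState G r (Ms.map (List.map (· + 1))) := by
  rintro U t ⟨P, hP, hU, hind, ht⟩
  set ps := P.map (List.map Prod.fst) with hps
  have hflat : ps.flatten = P.flatten.map Prod.fst := List.map_flatten.symm
  have hsnd : P.flatten.map Prod.snd = Ms.flatten.map (· + 1) := by
    rw [List.map_flatten, hP, List.map_flatten]
  have hlen : Ms.map List.length = ps.map List.length := by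
    have := congrArg (List.map List.length) hP
    simpa [hps, Function.comp_def] using this.symm
  have hnd : ps.flatten.Nodup := hflat ▸ hU.nodup_iff.2 U.nodup_toList
  have hN : ps.flatten.length = Ms.flatten.length := by
    rw [List.length_flatten, List.length_flatten, hlen]
  have h3 : ∀ p ∈ ps, 1 ≤ p.length ∧ p.length ≤ 3 := by
    intro p hp
    have : p.length ∈ Ms.map List.length := hlen ▸ List.mem_map_of_mem hp
    obtain ⟨M, hMs, hMp⟩ := List.mem_map.1 this
    exact hMp ▸ hM M hMs
  obtain ⟨E, hE⟩ := exists_pairs_flatten ps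
  have hcoeff := coeff_eq_partOperators R hlen h3 (vs := []) (es := []) rfl hnd hN
    (P := edgePoly E) (by rw [← edgePoly_append, edgePoly_perm hE]; rfl)
  refine wins_of_coeff_ne_zero E (μ := exponents ps.flatten Ms.flatten) ?_ ?_ ?_
  · intro u hu v hv huv
    have hmem : ∀ w ∈ U, w ∈ ps.flatten := fun w hw =>
      hflat ▸ hU.mem_iff.2 (Finset.mem_toList.2 hw)
    have hnot : ∀ e : V × V, e ∈ ps.flatMap pairs → ¬ G.Adj e.1 e.2 := by
      intro e he
      obtain ⟨p, hp, hep⟩ := List.mem_flatMap.1 he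
      obtain ⟨q, hq, rfl⟩ := List.mem_map.1 hp
      obtain ⟨h1, h2⟩ := mem_of_mem_pairs hep
      obtain ⟨x, hx, hx'⟩ := List.mem_map.1 h1
      obtain ⟨y, hy, hy'⟩ := List.mem_map.1 h2
      exact hx' ▸ hy' ▸ hind q hq x hx y hy
    have hp := mem_pairs (hmem u hu) (hmem v hv) huv.ne
    rw [← hE.mem_iff, ← hE.mem_iff, List.mem_append, List.mem_append] at hp
    exact hp.imp (fun h => h.resolve_right fun h' => hnot _ h' huv)
      (fun h => h.resolve_right fun h' => hnot _ h' huv.symm)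
  · intro h0
    refine h ?_
    simp only [List.nil_append] at hcoeff
    rw [h0, Int.cast_zero] at hcoeff
    rw [hcoeff]
    simp [removals]
  · intro v hv
    obtain ⟨x, hx, rfl⟩ := List.mem_map.1 (hU.mem_iff.2 (Finset.mem_toList.2 hv))
    obtain ⟨p, hp, hxp⟩ := List.mem_flatten.1 hx
    have h1 := exponents_add_one (hflat ▸ hnd) hsnd hx
    have h2 := ht p hp x hxp
    rw [hflat]
    omega

end PartOperators

/-- Finite formal sums of natural numbers with natural numbers as coefficients. -/
inductive SumTree
  | nil
  | node (l : SumTree) (k c : ℕ) (r : SumTree)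

/-- The formal sum `t + c • k`, with coefficients modulo `2 ^ 31`; the binary digits of `h` are the
way to the node. -/
noncomputable def SumTree.add (t : SumTree) : ℕ → ℕ → ℕ → SumTree :=
  SumTree.rec (fun _ k c => .node .nil k c .nil)
    (fun l key c' r il ir h k c =>
      Bool.rec
        (Bool.rec (.node l key c' (ir (Nat.div h (nat_lit 2)) k c))
          (.node (il (Nat.div h (nat_lit 2)) k c) key c' r)
          (Nat.beq (Nat.mod h (nat_lit 2)) (nat_lit 0)))
        (.node l key (Nat.mod (Nat.add c' c) (nat_lit 2147483648)) r) (Nat.beq k key)) t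

/-- The terms of a formal sum, in front of a given list. -/
noncomputable def SumTree.terms (t : SumTree) : List (ℕ × ℕ) → List (ℕ × ℕ) :=
  SumTree.rec (fun acc => acc) (fun _ k c _ il ir acc => il ((k, c) :: ir acc)) t

/-- `neg c` represents `-c` modulo `2 ^ 31`. -/
def neg (c : ℕ) : ℕ := Nat.sub (nat_lit 2147483648) (Nat.mod c (nat_lit 2147483648))

/-- `force n k` is `k n`, but evaluates `n` first. -/
noncomputable def force {α : Type} (n : ℕ) (k : ℕ → α) : α :=
  Nat.rec (k (nat_lit 0)) (fun i _ => k (Nat.succ i)) n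

theorem force_eq {α : Type} (n : ℕ) (k : ℕ → α) : force n k = k n := by
  cases n <;> rfl

/-- The parity of the number of ones among the last `4 * f` binary digits of `x`. -/
noncomputable def parity (f : ℕ) : ℕ → Bool :=
  Nat.rec (fun _ => false) (fun _ ih x => xor
    (Nat.beq (Nat.mod (Nat.div (nat_lit 27030) (Nat.pow (nat_lit 2) (Nat.mod x (nat_lit 16))))
      (nat_lit 2)) (nat_lit 1)) (ih (Nat.div x (nat_lit 16)))) f

/-- The `e`-th binary digit of `m`. -/
def digit (m e : ℕ) : Bool :=
  Nat.beq (Nat.mod (Nat.div m (Nat.pow (nat_lit 2) e)) (nat_lit 2)) (nat_lit 1)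

/-- Adds `c` times the result of removing the elements of `es` from the set `m` to `t`. -/
noncomputable def addRemovals (es : List ℕ) : ℕ → ℕ → SumTree → SumTree :=
  List.rec (fun m c t => force m fun m => t.add m m c)
    (fun e _ ih m c t => Bool.rec t
      (ih (Nat.xor m (Nat.pow (nat_lit 2) e))
        (Bool.rec c (neg c)
          (parity (Nat.succ (Nat.div e (nat_lit 4))) (Nat.mod m (Nat.pow (nat_lit 2) e)))) t)
      (digit m e)) es

/-- Adds `c` times the sum of the terms of `L`, applied to the set `m`, to `t`. -/
noncomputable def addCombination (L : List (ℕ × List ℕ)) (m c : ℕ) (t : SumTree) : SumTree :=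
  List.rec t (fun y _ ih => addRemovals y.2 m (Nat.mod (Nat.mul c y.1) (nat_lit 2147483648)) ih) L

/-- Applies the sum of the terms of `L` to a formal sum of sets. -/
noncomputable def applyCombination (L : List (ℕ × List ℕ)) (D : List (ℕ × ℕ)) : SumTree :=
  List.rec SumTree.nil (fun x _ ih => force x.1 fun m => force x.2 fun c =>
    Bool.rec (addCombination L m c ih) ih (Nat.beq c (nat_lit 0))) D

section Soundness

/-- The coefficient ring of the computations. -/
def Residue : Type := ZMod 2147483648

instance : CommRing Residue := inferInstanceAs (CommRing (ZMod 2147483648))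

theorem cast_eq_zero_iff (n : ℕ) : (n : Residue) = 0 ↔ 2147483648 ∣ n :=
  ZMod.natCast_eq_zero_iff n 2147483648

theorem cast_mod (n : ℕ) : ((Nat.mod n (nat_lit 2147483648) : ℕ) : Residue) = n :=
  ZMod.natCast_mod n 2147483648

theorem cast_neg (c : ℕ) : ((neg c : ℕ) : Residue) = -c := by
  have h : neg c + c % 2147483648 = 2147483648 :=
    Nat.sub_add_cancel (Nat.mod_lt c (by norm_num : 0 < 2147483648)).le
  have h' := congrArg (Nat.cast (R := Residue)) h
  rw [(cast_eq_zero_iff _).2 dvd_rfl, Nat.cast_add] at h'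
  exact eq_neg_of_add_eq_zero_left ((congrArg _ (cast_mod c).symm).trans h')

variable {M : Type*} [AddCommGroup M] [Module Residue M]

/-- The value of a formal sum. -/
def SumTree.value (Φ : ℕ → M) : SumTree → M
  | .nil => 0
  | .node l k c r => l.value Φ + (c : Residue) • Φ k + r.value Φ

theorem SumTree.value_add (Φ : ℕ → M) (t : SumTree) (h k c : ℕ) :
    (t.add h k c).value Φ = t.value Φ + (c : Residue) • Φ k := by
  induction t generalizing h with
  | nil => simp [SumTree.add, SumTree.value]
  | node l k' c' r ihl ihr =>
    change SumTree.value Φ (Bool.rec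
        (Bool.rec (.node l k' c' (r.add (Nat.div h (nat_lit 2)) k c))
          (.node (l.add (Nat.div h (nat_lit 2)) k c) k' c' r)
          (Nat.beq (Nat.mod h (nat_lit 2)) (nat_lit 0)))
        (.node l k' (Nat.mod (Nat.add c' c) (nat_lit 2147483648)) r) (Nat.beq k k')) = _
    cases hk : Nat.beq k k' with
    | true =>
      obtain rfl := Nat.eq_of_beq_eq_true hk
      simp only [SumTree.value, cast_mod, Nat.add_eq, Nat.cast_add, add_smul]
      abel
    | false =>
      cases Nat.beq (Nat.mod h (nat_lit 2)) (nat_lit 0) with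
      | true =>
        simp only [SumTree.value, ihl]
        abel
      | false =>
        simp only [SumTree.value, ihr]
        abel

theorem SumTree.sum_terms (Φ : ℕ → M) (t : SumTree) (acc : List (ℕ × ℕ)) :
    ((t.terms acc).map fun x => (x.2 : Residue) • Φ x.1).sum =
      t.value Φ + (acc.map fun x => (x.2 : Residue) • Φ x.1).sum := by
  induction t generalizing acc with
  | nil => simp [SumTree.terms, SumTree.value]
  | node l k c r ihl ihr =>
    change ((l.terms ((k, c) :: r.terms acc)).map _).sum = _
    rw [ihl, List.map_cons, List.sum_cons, ihr, SumTree.value]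
    abel

/-- The set of the positions of the ones among the last `N` binary digits of `m`. -/
def digits (N m : ℕ) : Finset ℕ := (Finset.range N).filter fun i => m.testBit i = true

theorem digit_eq (m e : ℕ) : digit m e = m.testBit e := by
  rw [Nat.testBit_eq_decide_div_mod_eq, digit, Bool.eq_iff_iff, decide_eq_true_iff,
    Nat.beq_eq]
  rfl

theorem digits_xor {N m e : ℕ} (h : m.testBit e = true) :
    digits N (Nat.xor m (Nat.pow (nat_lit 2) e)) = (digits N m).erase e := by
  ext i
  have hx : (Nat.xor m (Nat.pow (nat_lit 2) e)).testBit i = (m.testBit i ^^ decide (e = i)) :=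
    (Nat.testBit_xor ..).trans (congrArg _ Nat.testBit_two_pow)
  simp only [digits, Finset.mem_filter, Finset.mem_erase, hx]
  by_cases hei : e = i
  · subst hei
    simp [h]
  · simp [hei, Ne.symm hei]

theorem sign_parity (f x : ℕ) : (bif parity f x then -1 else 1 : Residue) =
    (-1) ^ (digits (4 * f) x).card := by
  induction f generalizing x with
  | zero => simp [parity, digits]
  | succ f ih =>
    have h1 : parity (f + 1) x = xor (Nat.beq (27030 / 2 ^ (x % 16) % 2) 1) (parity f (x / 16)) :=
      rfl
    have h2 : (digits (4 * (f + 1)) x).card =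
        (digits (4 * f) (x / 16)).card + (digits 4 (x % 16)).card := by
      simp only [digits, Finset.card_filter, mul_add, mul_one]
      rw [add_comm (4 * f) 4, Finset.sum_range_add, add_comm]
      congr 1
      · refine Finset.sum_congr rfl fun i _ => ?_
        rw [show (16 : ℕ) = 2 ^ 4 by norm_num, Nat.testBit_div_two_pow, add_comm]
      · refine Finset.sum_congr rfl fun i hi => ?_
        rw [show (16 : ℕ) = 2 ^ 4 by norm_num, Nat.testBit_mod_two_pow]
        simp [Finset.mem_range.1 hi]
    have h3 : (bif Nat.beq (27030 / 2 ^ (x % 16) % 2) 1 then -1 else 1 : Residue) =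
        (-1) ^ (digits 4 (x % 16)).card := by
      have := Nat.mod_lt x (by norm_num : 0 < 16)
      have hodd : ∀ y < 16, if Nat.beq (27030 / 2 ^ y % 2) 1 = true then Odd (digits 4 y).card
          else Even (digits 4 y).card := by decide
      have hx := hodd _ this
      cases hb : Nat.beq (27030 / 2 ^ (x % 16) % 2) 1 with
      | true => rw [hb, if_pos rfl] at hx; rw [hx.neg_one_pow]; rfl
      | false => rw [hb, if_neg Bool.false_ne_true] at hx; rw [hx.neg_one_pow]; rfl
    rw [h1, h2, pow_add, ← ih, ← h3]
    cases Nat.beq (27030 / 2 ^ (x % 16) % 2) 1 <;> cases parity f (x / 16) <;>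
      simp

theorem sign_parity_mod {N e : ℕ} (he : e < N) (m : ℕ) :
    (bif parity (Nat.succ (Nat.div e (nat_lit 4))) (Nat.mod m (Nat.pow (nat_lit 2) e))
      then -1 else 1 : Residue) = (-1) ^ ((digits N m).filter (· < e)).card := by
  rw [sign_parity]
  congr 2
  ext i
  have hx : (Nat.mod m (Nat.pow (nat_lit 2) e)).testBit i = (decide (i < e) && m.testBit i) :=
    Nat.testBit_mod_two_pow ..
  have hd : e < 4 * (Nat.div e (nat_lit 4)).succ := by
    have : e < 4 * (e / 4 + 1) := by omega
    exact this
  simp only [digits, Finset.mem_filter, Finset.mem_range, hx, Bool.and_eq_true, decide_eq_true_iff]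
  constructor
  · rintro ⟨-, h, h'⟩
    exact ⟨⟨h.trans he, h'⟩, h⟩
  · rintro ⟨⟨-, h'⟩, h⟩
    exact ⟨h.trans hd, h, h'⟩

theorem value_addRemovals {N : ℕ} {es : List ℕ} (hes : ∀ e ∈ es, e < N) (m c : ℕ) (t : SumTree)
    (Φ : Finset ℕ → Residue) : (addRemovals es m c t).value (fun m => Φ (digits N m)) =
      t.value (fun m => Φ (digits N m)) + c * removals Residue N es Φ (digits N m) := by
  induction es generalizing m c with
  | nil =>
    change SumTree.value _ (force m fun m => t.add m m c) = _
    rw [force_eq, SumTree.value_add]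
    rfl
  | cons e es ih =>
    have he := hes e (by simp)
    change SumTree.value _ (Bool.rec t (addRemovals es (Nat.xor m (Nat.pow (nat_lit 2) e))
        (Bool.rec c (neg c)
          (parity (Nat.succ (Nat.div e (nat_lit 4))) (Nat.mod m (Nat.pow (nat_lit 2) e)))) t)
      (digit m e)) = _
    have hs := sign_parity_mod he m
    rw [digit_eq, removals_cons, Module.End.mul_apply, removal_apply]
    cases h : m.testBit e with
    | false => simp [digits, h]
    | true =>
      rw [if_pos ⟨he, by simp [digits, h, he]⟩, ← hs, ← digits_xor h]
      refine (ih (fun e' h' => hes e' (by simp [h'])) _ _).trans ?_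
      cases parity (Nat.succ (Nat.div e (nat_lit 4))) (Nat.mod m (Nat.pow (nat_lit 2) e)) <;>
        simp [cast_neg]

/-- The operator with the given coefficients and removals. -/
def combination (N : ℕ) (L : List (ℕ × List ℕ)) : Module.End Residue (Finset ℕ → Residue) :=
  (L.map fun y => (y.1 : Residue) • removals Residue N y.2).sum

theorem value_addCombination {N : ℕ} {L : List (ℕ × List ℕ)} (hL : ∀ y ∈ L, ∀ e ∈ y.2, e < N)
    (m c : ℕ) (t : SumTree) (Φ : Finset ℕ → Residue) :
    (addCombination L m c t).value (fun m => Φ (digits N m)) =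
      t.value (fun m => Φ (digits N m)) + c * combination N L Φ (digits N m) := by
  induction L with
  | nil => simp [addCombination, combination]
  | cons y L ih =>
    change SumTree.value _ (addRemovals y.2 m (Nat.mod (Nat.mul c y.1) (nat_lit 2147483648))
      (addCombination L m c t)) = _
    rw [value_addRemovals (hL y (by simp)), ih fun z hz => hL z (by simp [hz]), cast_mod,
      Nat.mul_eq, Nat.cast_mul, combination, combination, List.map_cons, List.sum_cons,
      LinearMap.add_apply, Pi.add_apply, LinearMap.smul_apply, Pi.smul_apply, smul_eq_mul]
    ring

theorem value_applyCombination {N : ℕ} {L : List (ℕ × List ℕ)} (hL : ∀ y ∈ L, ∀ e ∈ y.2, e < N)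
    (D : List (ℕ × ℕ)) (Φ : Finset ℕ → Residue) :
    (applyCombination L D).value (fun m => Φ (digits N m)) =
      (D.map fun x => (x.2 : Residue) • combination N L Φ (digits N x.1)).sum := by
  induction D with
  | nil => rfl
  | cons x D ih =>
    change SumTree.value _ (force x.1 fun m => force x.2 fun c => Bool.rec
      (addCombination L m c (applyCombination L D)) (applyCombination L D)
        (Nat.beq c (nat_lit 0))) = _
    rw [force_eq, force_eq, List.map_cons, List.sum_cons, ← ih]
    cases h : Nat.beq x.2 (nat_lit 0) with
    | true =>
      rw [show x.2 = 0 from Nat.eq_of_beq_eq_true h]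
      simp
    | false => rw [value_addCombination hL, smul_eq_mul, add_comm]

end Soundness

/-- `upTo n f acc` applies `f 0`, …, `f (n - 1)` to `acc`. -/
noncomputable def upTo {α : Type} (n : ℕ) (f : ℕ → α → α) (acc : α) : α :=
  Nat.rec acc (fun i ih => f i ih) n

/-- The number of ways in which `divisionTerms [x, y, z]` moves `s` to the third exponent while the
smaller one of the other two exponents becomes `a`. -/
def moveCount (a x y s : ℕ) : ℕ :=
  Nat.sub (Nat.succ (bif Nat.ble s (Nat.sub x a) then s else Nat.sub x a))
    (Nat.sub (Nat.add s a) y)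

/-- The terms of `divisionTerms [x, y, z]` up to signs and reordering, with multiplicities. -/
noncomputable def tripleTerms (x y z : ℕ) : List (ℕ × List ℕ) :=
  upTo (Nat.succ x) (fun a acc => upTo (Nat.succ (Nat.add x y)) (fun s acc =>
    force (Nat.add (Nat.add z (nat_lit 2)) s) fun c =>
    force (Nat.sub (Nat.sub (Nat.add x (Nat.succ y)) a) s) fun b =>
    bif Nat.ble b a then acc else
    bif Nat.ble c b then acc else
    force (Nat.sub (moveCount a x y s) (bif Nat.ble (Nat.add z (nat_lit 2)) b then
      moveCount a x y (Nat.sub b (Nat.add z (nat_lit 2))) else (nat_lit 0))) fun w =>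
    bif Nat.beq w (nat_lit 0) then acc else (w, [c, a, b]) :: acc) acc) []

/-- The terms of the operator of a part. -/
noncomputable def partTerms : List ℕ → List (ℕ × List ℕ)
  | [x, y, z] => tripleTerms x y z
  | M => (divisionTerms M).map fun t => (1, t)

/-- Adds `w` times a triple to `t`, where transpositions in the triple change the sign. The first
two entries of the triple must be increasing. -/
noncomputable def addIncreasing (p q r w : ℕ) (t : SumTree) : SumTree :=
  if r < p then force ((r * 32 + p) * 32 + q) fun k => t.add k k w
  else if r = p then t
  else if r < q then force ((p * 32 + r) * 32 + q) fun k => t.add k k (neg w)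
  else if r = q then t
  else force ((p * 32 + q) * 32 + r) fun k => t.add k k w

/-- Adds `w` times a triple to `t`, where transpositions in the triple change the sign. -/
noncomputable def addTriple (w : ℕ) (t : SumTree) : List ℕ → SumTree
  | [p, q, r] => if p < q then addIncreasing p q r w t
    else if q < p then addIncreasing q p r (neg w) t else t
  | _ => t

/-- Adds the triples in `L` to the empty sum. -/
noncomputable def triplesTree (L : List (ℕ × List ℕ)) : SumTree :=
  List.rec SumTree.nil (fun y _ ih => addTriple y.1 ih y.2) L

/-- Whether a list is a triple of numbers less than `32`. -/
def isSmallTriple : List ℕ → Bool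
  | [p, q, r] => decide (p < 32) && decide (q < 32) && decide (r < 32)
  | _ => false

/-- Checks that a list of terms represents zero. -/
noncomputable def representsZero (L : List (ℕ × List ℕ)) : Bool :=
  (L.all fun y => isSmallTriple y.2) &&
    ((triplesTree L).terms []).all fun x => Nat.beq x.2 0

/-- Checks that `partTerms M` are the terms of the operator of the part `M`. -/
noncomputable def checkPartTerms (M : List ℕ) : Bool :=
  representsZero ((divisionTerms M).map (fun t => (1, t)) ++
    (partTerms M).map fun y => (neg y.1, y.2))

/-- The value of the product of the operators of the parts at a formal sum of sets. -/
noncomputable def runParts (N : ℕ) (Ms : List (List ℕ)) : List (ℕ × ℕ) → ℕ :=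
  List.rec (fun D => List.rec (nat_lit 0) (fun x _ ih => Nat.add (Prod.snd x) ih) D)
    (fun M _ ih D => ih ((applyCombination
      ((partTerms M).filter fun y => y.2.all fun e => Nat.blt e N) D).terms [])) Ms

/-- Checks that a coefficient does not vanish. -/
noncomputable def checkCoefficient (Ms : List (List ℕ)) : Bool :=
  force Ms.flatten.length fun N =>
    !Nat.beq (Nat.mod (runParts N Ms [(Nat.sub (Nat.pow 2 N) 1, 1)]) (nat_lit 2147483648)) 0

section Soundness

variable (N : ℕ)

theorem end_mul_neg (A B : Module.End Residue (Finset ℕ → Residue)) : A * -B = -(A * B) := by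
  ext
  simp [Module.End.mul_apply]

theorem end_neg_mul (A B : Module.End Residue (Finset ℕ → Residue)) : -A * B = -(A * B) := by
  ext
  simp [Module.End.mul_apply]

theorem end_smul_neg (c : Residue) (A : Module.End Residue (Finset ℕ → Residue)) :
    c • -A = -(c • A) := by
  ext
  simp

theorem end_neg_smul (c : Residue) (A : Module.End Residue (Finset ℕ → Residue)) :
    -c • A = -(c • A) := by
  ext
  simp

/-- The operator that is encoded by a number with three digits in base `32`. -/
def codeOperator (k : ℕ) : Module.End Residue (Finset ℕ → Residue) :=
  removals Residue N [k / 1024, k / 32 % 32, k % 32]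

theorem codeOperator_eq {p q r : ℕ} (hq : q < 32) (hr : r < 32) :
    codeOperator N ((p * 32 + q) * 32 + r) =
      removal Residue N p * (removal Residue N q * removal Residue N r) := by
  rw [codeOperator, show ((p * 32 + q) * 32 + r) / 1024 = p by omega,
    show ((p * 32 + q) * 32 + r) / 32 % 32 = q by omega,
    show ((p * 32 + q) * 32 + r) % 32 = r by omega]
  simp [removals]

theorem value_addIncreasing {p q r : ℕ} (hp : p < 32) (hq : q < 32) (hr : r < 32) (w : ℕ)
    (t : SumTree) : (addIncreasing p q r w t).value (codeOperator N) = t.value (codeOperator N) +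
      (w : Residue) • removals Residue N [p, q, r] := by
  have hprod : removals Residue N [p, q, r] =
    removal Residue N p * (removal Residue N q * removal Residue N r) := by simp [removals]
  have hqr : removals Residue N [p, q, r] =
      -(removal Residue N p * (removal Residue N r * removal Residue N q)) := by
    rw [hprod, removal_mul_comm N q r, end_mul_neg]
  have hpr : removals Residue N [p, q, r] =
      removal Residue N r * (removal Residue N p * removal Residue N q) := by
    rw [hqr, ← mul_assoc, removal_mul_comm N p r, end_neg_mul, neg_neg, mul_assoc]
  unfold addIncreasing
  split_ifs with h1 h2 h3 h4
  · rw [force_eq, SumTree.value_add, codeOperator_eq N hp hq, hpr]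
  · subst h2
    rw [hpr, ← mul_assoc, removal_mul_self]
    simp
  · rw [force_eq, SumTree.value_add, codeOperator_eq N hr hq, hqr, cast_neg,
      end_neg_smul, end_smul_neg]
  · subst h4
    rw [hprod, removal_mul_self]
    simp
  · rw [force_eq, SumTree.value_add, codeOperator_eq N hq hr, hprod]

theorem value_addTriple {l : List ℕ} (hl : isSmallTriple l = true) (w : ℕ) (t : SumTree) :
    (addTriple w t l).value (codeOperator N) = t.value (codeOperator N) +
      (w : Residue) • removals Residue N l := by
  unfold isSmallTriple at hl
  split at hl
  · rename_i p q r
    simp only [Bool.and_eq_true, decide_eq_true_eq] at hl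
    obtain ⟨⟨hp, hq⟩, hr⟩ := hl
    unfold addTriple
    dsimp only
    have hcomm : removals Residue N [p, q, r] = -removals Residue N [q, p, r] := by
      simp only [removals, List.map_cons, List.prod_cons]
      rw [← mul_assoc, removal_mul_comm N p q, end_neg_mul, mul_assoc]
    split_ifs with h1 h2
    · exact value_addIncreasing N hp hq hr w t
    · rw [value_addIncreasing N hq hp hr, hcomm, cast_neg, end_neg_smul, end_smul_neg]
    · obtain rfl : p = q := by omega
      rw [removals_cons, removals_cons, ← mul_assoc, removal_mul_self]
      simp
  · simp at hl

theorem value_triplesTree {L : List (ℕ × List ℕ)}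
    (hL : (L.all fun y => isSmallTriple y.2) = true) :
    (triplesTree L).value (codeOperator N) = combination N L := by
  induction L with
  | nil => rfl
  | cons y L ih =>
    rw [List.all_cons, Bool.and_eq_true] at hL
    change SumTree.value _ (addTriple y.1 (triplesTree L) y.2) = _
    rw [value_addTriple N hL.1, ih hL.2, combination, combination, List.map_cons, List.sum_cons,
      add_comm]

theorem combination_eq_zero {L : List (ℕ × List ℕ)} (h : representsZero L = true) :
    combination N L = 0 := by
  rw [representsZero, Bool.and_eq_true, List.all_eq_true (p := fun x : ℕ × ℕ => _)] at h
  have := SumTree.sum_terms (codeOperator N) (triplesTree L) []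
  rw [List.map_nil, List.sum_nil, add_zero, value_triplesTree N h.1] at this
  rw [← this]
  refine List.sum_eq_zero fun φ hφ => ?_
  obtain ⟨x, hx, rfl⟩ := List.mem_map.1 hφ
  rw [Nat.eq_of_beq_eq_true (h.2 x hx)]
  simp

theorem combination_append (L L' : List (ℕ × List ℕ)) :
    combination N (L ++ L') = combination N L + combination N L' := by
  simp [combination]

theorem combination_one (L : List (List ℕ)) :
    combination N (L.map fun t => (1, t)) = (L.map (removals Residue N)).sum := by
  simp [combination, Function.comp_def]

theorem combination_neg (L : List (ℕ × List ℕ)) :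
    combination N (L.map fun y => (neg y.1, y.2)) = -combination N L := by
  induction L with
  | nil => simp [combination]
  | cons y L ih =>
    simp only [combination, List.map_cons, List.sum_cons, cast_neg] at ih ⊢
    rw [ih, neg_add, end_neg_smul]

theorem combination_partTerms {M : List ℕ} (h : checkPartTerms M = true) :
    combination N (partTerms M) = partOperator Residue N M := by
  have := combination_eq_zero N h
  rw [combination_append, combination_one, combination_neg] at this
  exact (eq_of_sub_eq_zero ((sub_eq_add_neg _ _).trans this)).symm

theorem combination_partTerms_of_ne {M : List ℕ} (h : M.length ≠ 3) :
    combination N (partTerms M) = partOperator Residue N M := by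
  unfold partTerms
  split
  · simp at h
  · exact combination_one N _

theorem combination_filter (L : List (ℕ × List ℕ)) :
    combination N (L.filter fun y => y.2.all fun e => Nat.blt e N) = combination N L := by
  induction L with
  | nil => rfl
  | cons y L ih =>
    cases h : y.2.all fun e => Nat.blt e N with
    | true =>
      rw [List.filter_cons_of_pos (p := fun y : ℕ × List ℕ => y.2.all fun e => Nat.blt e N) h,
        combination, combination, List.map_cons, List.map_cons,
        List.sum_cons, List.sum_cons]
      exact congrArg _ ih
    | false =>
      rw [List.filter_cons_of_neg (p := fun y : ℕ × List ℕ => y.2.all fun e => Nat.blt e N)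
        (by rw [h]; exact Bool.false_ne_true), ih]
      obtain ⟨e, he, heN⟩ := List.all_eq_false.1 h
      have : removals Residue N y.2 = 0 := List.prod_eq_zero (List.mem_map.2
        ⟨e, he, removal_of_le (not_lt.1 fun hlt => heN (Nat.ble_eq_true_of_le hlt))⟩)
      simp [combination, this]

theorem cast_runParts {Ms : List (List ℕ)}
    (hMs : ∀ M ∈ Ms, combination N (partTerms M) = partOperator Residue N M)
    (D : List (ℕ × ℕ)) : ((runParts N Ms D : ℕ) : Residue) =
      (D.map fun x => (x.2 : Residue) • (Ms.map (partOperator Residue N)).prod (fun _ => 1)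
        (digits N x.1)).sum := by
  induction Ms generalizing D with
  | nil =>
    induction D with
    | nil => exact Nat.cast_zero
    | cons x D ih =>
      refine (Nat.cast_add x.2 (runParts N [] D)).trans ?_
      rw [ih]
      simp
  | cons M Ms ih =>
    change ((runParts N Ms ((applyCombination
      ((partTerms M).filter fun y => y.2.all fun e => Nat.blt e N) D).terms []) : ℕ) : Residue) = _
    rw [ih fun M' h => hMs M' (by simp [h]), SumTree.sum_terms (fun m =>
      (Ms.map (partOperator Residue N)).prod (fun _ => 1) (digits N m)) _ [],
    value_applyCombination,
      combination_filter, hMs M (by simp)]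
    · simp
    · intro y hy e he
      have := (List.mem_filter.1 hy).2
      exact Nat.le_of_ble_eq_true (List.all_eq_true.1 this e he)

variable {N}

theorem partOperators_ne_zero {Ms : List (List ℕ)} (h : checkCoefficient Ms = true)
    (hMs : ∀ M ∈ Ms, M.length = 3 → checkPartTerms M = true) :
    (Ms.map (partOperator Residue Ms.flatten.length)).prod (fun _ => 1)
      (Finset.range Ms.flatten.length) ≠ 0 := by
  intro h0
  rw [checkCoefficient, force_eq] at h
  set N := Ms.flatten.length
  have hd : digits N (2 ^ N - 1) = Finset.range N := by
    ext i
    simp [digits]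
  have hrun := cast_runParts N (Ms := Ms) (fun M hM => by
    by_cases h3 : M.length = 3
    · exact combination_partTerms N (hMs M hM h3)
    · exact combination_partTerms_of_ne N h3) [(2 ^ N - 1, 1)]
  rw [List.map_singleton, List.sum_singleton, hd, h0, smul_zero,
    cast_eq_zero_iff] at hrun
  have hb : Nat.beq (Nat.mod (runParts N Ms [(Nat.sub (Nat.pow 2 N) 1, 1)])
    (nat_lit 2147483648)) 0 = true :=
    (Nat.beq_eq).mpr (Nat.mod_eq_zero_of_dvd hrun)
  rw [hb] at h
  exact Bool.false_ne_true h

end Soundness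

/-- Exponents of monomials that occur in the graph polynomials of complete multipartite graphs. -/
def monomials : List (List (List ℕ)) := [
  [[6], [6, 6, 6], [5, 6, 7], [6, 7, 7], [5, 6], [6, 6, 7]],
  [[7], [6], [6, 6, 6], [6, 7, 7], [6, 6], [5, 7], [6, 6, 7]],
  [[7], [4, 7], [5, 6], [4, 6, 7], [3, 6, 7], [5, 6, 7]],
  [[6], [1, 6], [5], [5, 6, 6], [6, 6, 6], [5, 5, 5]],
  [[7], [8], [4, 7, 8], [6, 6, 7], [6, 7], [6, 7, 8], [6, 7, 7]],
  [[4, 6], [1, 6, 7], [4, 6, 7], [5, 7, 7], [5, 6, 7]],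
  [[5, 7, 8], [6, 7, 7], [6, 7, 8], [6, 7], [6, 7], [5, 7, 7]],
  [[7], [6, 6, 7], [5, 6, 8], [5, 6, 7], [5, 6], [4, 6, 8]],
  [[6, 7], [6, 7], [6, 7], [4, 4, 7], [5, 7, 7], [6, 7, 7]],
  [[3, 6, 8], [3, 7, 7], [4, 7, 8], [4, 7, 7], [5, 7, 7]],
  [[6], [5], [7], [5, 6, 7], [3, 6], [6, 6, 7], [5, 5, 7]],
  [[7], [5, 6, 8], [4, 7, 8], [6, 6, 7], [6, 7, 8], [6, 7, 7]],
  [[6], [1, 6, 6], [3, 5, 5], [4, 6, 6], [6, 6, 6]],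
  [[7], [6], [6, 7, 8], [7, 7, 7], [6, 6, 7], [6, 7], [6, 7, 7]],
  [[8], [5, 6], [7], [4, 7], [6, 6, 8], [4, 6, 8], [5, 6, 8]],
  [[7], [5], [5, 5, 6], [3, 6, 7], [5, 6, 6], [6, 6, 6]],
  [[7, 8], [7, 8], [7, 8], [7, 8], [6, 7, 8], [6, 8, 8], [6, 7, 7]],
  [[5, 5, 7], [5, 6, 6], [3, 6], [3, 6, 7], [6, 6, 7]],
  [[5, 7, 7], [6, 6, 7], [7, 7, 7], [6, 7], [7, 7], [6, 7, 7]],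
  [[7], [8], [4, 8, 8], [6, 6, 8], [6, 7, 8], [7, 8, 8], [6, 8, 8]],
  [[6], [5, 6, 8], [5, 7, 7], [4, 7, 7], [5, 7], [5, 6, 7]],
  [[4, 6, 7], [5, 5, 7], [5, 6, 6], [6, 7, 7], [6, 6, 7]],
  [[6, 8, 8], [7], [7, 7, 8], [8, 8], [5, 7, 8], [7, 7], [6, 7, 8]],
  [[6], [5, 7, 7], [6, 6, 7], [6, 7, 7], [6, 6, 8], [7, 7, 7]],
  [[4, 8, 8], [5, 7, 8], [5, 8, 8], [5, 8], [6, 7], [5, 6, 8]],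
  [[7], [6], [5], [6, 6, 6], [5, 7, 7], [7, 7, 7], [5, 6, 6]],
  [[6, 7], [8], [6, 7], [6, 7, 7], [5, 7, 7], [7, 7], [7, 7, 7]],
  [[6], [7], [6, 7, 7], [5, 7, 8], [5, 6], [6, 8, 8], [6, 7, 8]],
  [[8], [6, 7], [6, 7], [6, 7], [5, 7, 8], [6, 7, 7], [6, 7, 8]],
  [[7], [6, 8, 8], [7, 7, 8], [8, 8], [6, 7, 8], [6, 8], [5, 7, 8]],
  [[6], [4, 7, 7], [4, 6, 8], [6, 6, 8], [6, 8, 8], [6, 7, 8]],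
  [[8], [6, 7, 8], [5, 8, 8], [6, 8, 8], [8, 8], [7, 7], [6, 6, 8]],
  [[7], [7, 7, 7], [5, 8, 8], [6, 7, 7], [4, 7, 7], [5, 6, 7]],
  [[7], [6, 7, 7], [7, 7], [6, 8], [6, 6, 7], [6, 7], [7, 7, 7]],
  [[7, 8], [7, 8], [7, 8], [7, 8], [6, 7, 8], [5, 7, 8], [7, 7, 8]],
  [[8], [6, 7, 8], [5, 8, 8], [8, 8], [6, 8], [6, 6, 8], [6, 8, 8]]]

/-- The exponents of the parts with three vertices in `monomials`. -/
def triples : List (List ℕ) := [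
  [1, 6, 6], [1, 6, 7], [3, 5, 5], [3, 6, 7], [3, 6, 8], [3, 7, 7], [4, 4, 7], [4, 6, 6],
  [4, 6, 7], [4, 6, 8], [4, 7, 7], [4, 7, 8], [4, 8, 8], [5, 5, 5], [5, 5, 6], [5, 5, 7],
  [5, 6, 6], [5, 6, 7], [5, 6, 8], [5, 7, 7], [5, 7, 8], [5, 8, 8], [6, 6, 6], [6, 6, 7],
  [6, 6, 8], [6, 7, 7], [6, 7, 8], [6, 8, 8], [7, 7, 7], [7, 7, 8], [7, 8, 8]]

theorem checkPartTerms_triples : (triples.all checkPartTerms) = true := by decide +kernel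

theorem checkCoefficient_monomials : (monomials.all checkCoefficient) = true := by decide +kernel
open MoveTree in
/-- States in which Painter wins, with the replies. -/
def moveTrees : List (List (List ℕ × ℕ) × MoveTree) := [
  ([([8, 8, 8], 4), ([8], 0)],
    (node (leaf 0 12) (node (leaf 0 15) (node (leaf 0 0) (node (node (node (node (node (node
    (leaf 0 21) (node idle impossible)) impossible) impossible) impossible) impossible)
    impossible))))),
  ([([8, 8, 8], 3), ([7, 9], 0), ([8], 1)],
    (node (leaf 0 3) (node (leaf 0 10) (node (node (node (node (node (node (leaf 0 0) (leaf 4 1))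
    (node (node (leaf 0 0) (leaf 4 1)) (node (node (leaf 0 0) (leaf 4 1)) (node (node (leaf 0 0)
    (leaf 4 1)) impossible)))) (node (node (node (leaf 0 0) (leaf 4 1)) (node (leaf 0 25) (node
    (node (leaf 0 0) (leaf 4 1)) (node (node (leaf 0 0) (leaf 4 1)) impossible)))) impossible))
    (node (node (node (node (leaf 0 0) (leaf 4 1)) (node (leaf 0 25) (node (node (leaf 0 0)
    (leaf 4 1)) (node (node (leaf 0 0) (leaf 4 1)) impossible)))) impossible) impossible)) (node
    (node (node (node (node (leaf 0 0) (leaf 4 1)) (node (leaf 0 25) (node (node (leaf 0 0)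
    (leaf 4 1)) (node (node (leaf 0 0) (leaf 4 1)) impossible)))) impossible) impossible)
    impossible)) (node (node (node (node (node (node (leaf 0 0) (leaf 0 15)) (node (leaf 0 25)
    (node (node (leaf 0 0) (leaf 0 25)) (node (node (leaf 0 0) (node (node idle impossible)
    impossible)) impossible)))) impossible) impossible) impossible) impossible))))),
  ([([8, 8, 8], 3), ([8, 8], 0), ([8], 1)],
    (node (leaf 0 3) (node (leaf 0 10) (node (node (node (node (node (node (leaf 0 0) (leaf 4 1))
    (node (node (leaf 0 0) (leaf 4 1)) (node (node (leaf 0 0) (leaf 4 1)) impossible))) (node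
    (node (node (leaf 0 0) (leaf 4 1)) (node (leaf 0 25) (node (node (leaf 0 0) (leaf 4 1))
    impossible))) impossible)) (node (node (node (node (leaf 0 0) (leaf 4 1)) (node (leaf 0 25)
    (node (node (leaf 0 0) (leaf 4 1)) impossible))) impossible) impossible)) (node (node (node
    (node (node (leaf 0 0) (leaf 4 1)) (node (leaf 0 25) (node (node (leaf 0 0) (leaf 4 1))
    impossible))) impossible) impossible) impossible)) (node (node (node (node (node (node
    (leaf 0 0) (leaf 0 15)) (node (leaf 0 25) (node (node (leaf 0 0) (node (node idle impossible)
    impossible)) impossible))) impossible) impossible) impossible) impossible))))),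
  ([([8, 8, 9], 4), ([7, 9], 0)],
    (node (leaf 0 17) (node (node (node (leaf 2 7) (leaf 1 0)) (leaf 0 0)) (node (leaf 0 0) (node
    (node (node (node (node (node (leaf 0 9) (node (leaf 0 11) (leaf 4 6))) (node (node
    (leaf 0 9) (node (leaf 0 11) (leaf 4 6))) (node (node (leaf 0 9) (node (leaf 0 11)
    (leaf 4 6))) impossible))) (node (node (node (leaf 0 9) (node (leaf 0 11) (leaf 4 6))) (node
    (node (leaf 0 9) (node (leaf 0 11) (leaf 4 6))) impossible)) (node (node (node (leaf 0 9)
    (node (leaf 0 11) (leaf 4 6))) impossible) impossible))) (node (node (node (node (leaf 0 9)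
    (node (leaf 0 23) (leaf 4 18))) (node (node (leaf 0 9) (node (leaf 0 11) (leaf 4 6)))
    impossible)) (node (node (node (leaf 0 9) (node (leaf 0 11) (leaf 4 6))) impossible)
    impossible)) (node (node (node (node (leaf 0 9) (node (leaf 0 11) (leaf 4 6))) impossible)
    impossible) impossible))) (node (node (node (node (node (leaf 0 21) (node (leaf 0 23)
    (leaf 4 18))) (node (node (leaf 0 9) (node (leaf 0 23) (leaf 4 18))) impossible)) (node (node
    (node (leaf 0 9) (node (leaf 0 11) (leaf 4 6))) impossible) impossible)) (node (node (node
    (node (leaf 0 9) (node (leaf 0 11) (leaf 4 6))) impossible) impossible) impossible)) (node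
    (node (node (node (node (leaf 0 9) (node (leaf 0 11) (leaf 4 6))) impossible) impossible)
    impossible) impossible))) (node (node (node (node (node (node (leaf 0 21) (node (leaf 0 36)
    (leaf 4 18))) (node (node (leaf 0 21) (node (leaf 0 23) (leaf 4 18))) impossible)) (node
    (node (node (leaf 0 9) (node (leaf 0 23) (leaf 4 6))) impossible) impossible)) (node (node
    (node (node (leaf 0 9) (node (leaf 0 11) (leaf 4 6))) impossible) impossible) impossible))
    (node (node (node (node (node (leaf 0 9) (node (leaf 0 11) (leaf 4 6))) impossible)
    impossible) impossible) impossible)) (node (node (node (node (node (node (leaf 0 9) (node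
    (leaf 0 11) (node (leaf 0 23) (node idle impossible)))) impossible) impossible) impossible)
    impossible) impossible))))))),
  ([([8, 8, 9], 4), ([8, 8], 0)],
    (node (leaf 0 17) (node (node (node (leaf 2 7) (leaf 1 0)) (leaf 0 0)) (node (leaf 0 0) (node
    (node (node (node (node (node (leaf 0 9) (leaf 4 6)) (node (node (leaf 0 9) (leaf 4 6)) (node
    (node (leaf 0 9) (leaf 4 6)) impossible))) (node (node (node (leaf 0 9) (leaf 4 6)) (node
    (node (leaf 0 9) (leaf 4 6)) impossible)) (node (node (node (leaf 0 9) (leaf 4 6))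
    impossible) impossible))) (node (node (node (node (leaf 0 9) (leaf 4 18)) (node (node
    (leaf 0 9) (leaf 4 6)) impossible)) (node (node (node (leaf 0 9) (leaf 4 6)) impossible)
    impossible)) (node (node (node (node (leaf 0 9) (leaf 4 6)) impossible) impossible)
    impossible))) (node (node (node (node (node (leaf 0 21) (leaf 4 18)) (node (node (leaf 0 9)
    (leaf 4 18)) impossible)) (node (node (node (leaf 0 9) (leaf 4 6)) impossible) impossible))
    (node (node (node (node (leaf 0 9) (leaf 4 6)) impossible) impossible) impossible)) (node
    (node (node (node (node (leaf 0 9) (leaf 4 6)) impossible) impossible) impossible)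
    impossible))) (node (node (node (node (node (node (leaf 0 21) (leaf 4 18)) (node (node
    (leaf 0 21) (leaf 4 18)) impossible)) (node (node (node (leaf 0 9) (leaf 4 6)) impossible)
    impossible)) (node (node (node (node (leaf 0 9) (leaf 4 6)) impossible) impossible)
    impossible)) (node (node (node (node (node (leaf 0 9) (leaf 4 6)) impossible) impossible)
    impossible) impossible)) (node (node (node (node (node (node (leaf 0 9) (node (leaf 0 11)
    (node idle impossible))) impossible) impossible) impossible) impossible) impossible))))))),
  ([([7, 9, 9], 0), ([8, 8, 9], 3), ([7, 9], 0)],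
    (node (leaf 0 17) (node (node (leaf 0 5) (node (node (leaf 2 7) (leaf 1 0)) (leaf 0 0)))
    (node (node (leaf 0 5) (node (node (leaf 1 7) (leaf 0 0)) (node (leaf 0 0) (node (node (node
    (node (node (leaf 0 9) (node (leaf 0 11) (leaf 4 6))) (node (node (leaf 0 9) (node
    (leaf 0 11) (leaf 4 6))) (node (node (leaf 0 9) (node (leaf 0 11) (leaf 4 6))) impossible)))
    (node (node (node (leaf 0 9) (node (leaf 0 11) (leaf 4 6))) (node (node (leaf 0 9) (node
    (leaf 0 11) (leaf 4 6))) impossible)) (node (node (node (leaf 0 9) (node (leaf 0 11)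
    (leaf 4 6))) impossible) impossible))) (node (node (node (node (leaf 0 9) (node (leaf 0 23)
    (leaf 4 18))) (node (node (leaf 0 9) (node (leaf 0 11) (leaf 4 6))) impossible)) (node (node
    (node (leaf 0 9) (node (leaf 0 11) (leaf 4 6))) impossible) impossible)) (node (node (node
    (node (leaf 0 9) (node (leaf 0 11) (leaf 4 6))) impossible) impossible) impossible))) (node
    (node (node (node (node (leaf 0 21) (node (leaf 0 32) (leaf 4 18))) (node (node (leaf 0 9)
    (node (leaf 0 23) (leaf 4 18))) impossible)) (node (node (node (leaf 0 9) (node (leaf 0 11)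
    (leaf 4 6))) impossible) impossible)) (node (node (node (node (leaf 0 9) (node (leaf 0 11)
    (leaf 4 6))) impossible) impossible) impossible)) (node (node (node (node (node (leaf 0 9)
    (node (leaf 0 11) (leaf 4 6))) impossible) impossible) impossible) impossible)))))) (node
    (node (leaf 0 5) (node (leaf 0 0) (leaf 0 0))) (node (node (leaf 0 5) (node (leaf 0 0) (node
    (leaf 0 0) (node (node (node (node (node (leaf 0 9) (node (leaf 0 11) (leaf 4 6))) (node
    (node (leaf 0 9) (node (leaf 0 11) (leaf 4 6))) (node (node (leaf 0 9) (node (leaf 0 11)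
    (leaf 4 6))) impossible))) (node (node (node (leaf 0 9) (node (leaf 0 11) (leaf 4 6))) (node
    (node (leaf 0 9) (node (leaf 0 11) (leaf 4 6))) impossible)) (node (node (node (leaf 0 9)
    (node (leaf 0 11) (leaf 4 6))) impossible) impossible))) (node (node (node (node (leaf 0 9)
    (node (leaf 0 23) (leaf 3 18))) (node (node (leaf 0 9) (node (leaf 0 11) (leaf 4 6)))
    impossible)) (node (node (node (leaf 0 9) (node (leaf 0 11) (leaf 4 6))) impossible)
    impossible)) (node (node (node (node (leaf 0 9) (node (leaf 0 11) (leaf 4 6))) impossible)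
    impossible) impossible))) (node (node (node (node (node (leaf 0 21) (node (leaf 0 23)
    (leaf 3 18))) (node (node (leaf 0 9) (node (leaf 0 23) (leaf 3 6))) impossible)) (node (node
    (node (leaf 0 9) (node (leaf 0 11) (leaf 4 6))) impossible) impossible)) (node (node (node
    (node (leaf 0 9) (node (leaf 0 11) (leaf 4 6))) impossible) impossible) impossible)) (node
    (node (node (node (node (leaf 0 9) (node (leaf 0 11) (leaf 4 6))) impossible) impossible)
    impossible) impossible)))))) (node (node (leaf 0 5) (node (leaf 0 0) (node (leaf 0 0) (node
    (node (node (node (node (leaf 0 9) (node (leaf 0 11) (leaf 3 6))) (node (node (leaf 0 9)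
    (node (leaf 0 11) (leaf 3 6))) (node (node (leaf 0 9) (node (leaf 0 11) (leaf 3 6)))
    impossible))) (node (node (node (leaf 0 9) (node (leaf 0 11) (leaf 3 6))) (node (node
    (leaf 0 9) (node (leaf 0 11) (leaf 3 6))) impossible)) (node (node (node (leaf 0 9) (node
    (leaf 0 11) (leaf 3 6))) impossible) impossible))) (node (node (node (node (leaf 0 9) (node
    (leaf 0 23) (leaf 3 18))) (node (node (leaf 0 9) (node (leaf 0 11) (leaf 3 6))) impossible))
    (node (node (node (leaf 0 9) (node (leaf 0 11) (leaf 3 6))) impossible) impossible)) (node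
    (node (node (node (leaf 0 9) (node (leaf 0 11) (leaf 3 6))) impossible) impossible)
    impossible))) (node (node (node (node (node (leaf 0 21) (node (leaf 0 23) (leaf 3 18))) (node
    (node (leaf 0 9) (node (leaf 0 23) (leaf 3 6))) impossible)) (node (node (node (leaf 0 9)
    (node (leaf 0 11) (leaf 3 6))) impossible) impossible)) (node (node (node (node (leaf 0 9)
    (node (leaf 0 11) (leaf 3 6))) impossible) impossible) impossible)) (node (node (node (node
    (node (leaf 0 9) (node (leaf 0 11) (node (leaf 0 23) (node idle impossible)))) impossible)
    impossible) impossible) impossible)))))) impossible))))))),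
  ([([7, 9, 9], 0), ([8, 8, 9], 3), ([8, 8], 0)],
    (node (leaf 0 17) (node (node (leaf 0 5) (node (node (leaf 2 7) (leaf 1 0)) (leaf 0 0)))
    (node (node (leaf 0 5) (node (node (leaf 1 7) (leaf 0 0)) (node (leaf 0 0) (node (node (node
    (node (node (leaf 0 9) (leaf 4 6)) (node (node (leaf 0 9) (leaf 4 6)) (node (node (leaf 0 9)
    (leaf 4 6)) impossible))) (node (node (node (leaf 0 9) (leaf 4 6)) (node (node (leaf 0 9)
    (leaf 4 6)) impossible)) (node (node (node (leaf 0 9) (leaf 4 6)) impossible) impossible)))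
    (node (node (node (node (leaf 0 9) (leaf 4 18)) (node (node (leaf 0 9) (leaf 4 6))
    impossible)) (node (node (node (leaf 0 9) (leaf 4 6)) impossible) impossible)) (node (node
    (node (node (leaf 0 9) (leaf 4 6)) impossible) impossible) impossible))) (node (node (node
    (node (node (leaf 0 21) (leaf 4 18)) (node (node (leaf 0 9) (leaf 4 18)) impossible)) (node
    (node (node (leaf 0 9) (leaf 4 6)) impossible) impossible)) (node (node (node (node
    (leaf 0 9) (leaf 4 6)) impossible) impossible) impossible)) (node (node (node (node (node
    (leaf 0 9) (leaf 4 6)) impossible) impossible) impossible) impossible)))))) (node (node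
    (leaf 0 5) (node (leaf 0 0) (leaf 0 0))) (node (node (leaf 0 5) (node (leaf 0 0) (node
    (leaf 0 0) (node (node (node (node (node (leaf 0 9) (leaf 4 6)) (node (node (leaf 0 9)
    (leaf 4 6)) (node (node (leaf 0 9) (leaf 4 6)) impossible))) (node (node (node (leaf 0 9)
    (leaf 4 6)) (node (node (leaf 0 9) (leaf 4 6)) impossible)) (node (node (node (leaf 0 9)
    (leaf 4 6)) impossible) impossible))) (node (node (node (node (leaf 0 9) (leaf 3 18)) (node
    (node (leaf 0 9) (leaf 4 6)) impossible)) (node (node (node (leaf 0 9) (leaf 4 6))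
    impossible) impossible)) (node (node (node (node (leaf 0 9) (leaf 4 6)) impossible)
    impossible) impossible))) (node (node (node (node (node (leaf 0 21) (leaf 3 18)) (node (node
    (leaf 0 9) (leaf 3 6)) impossible)) (node (node (node (leaf 0 9) (leaf 4 6)) impossible)
    impossible)) (node (node (node (node (leaf 0 9) (leaf 4 6)) impossible) impossible)
    impossible)) (node (node (node (node (node (leaf 0 9) (leaf 4 6)) impossible) impossible)
    impossible) impossible)))))) (node (node (leaf 0 5) (node (leaf 0 0) (node (leaf 0 0) (node
    (node (node (node (node (leaf 0 9) (leaf 3 6)) (node (node (leaf 0 9) (leaf 3 6)) (node (node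
    (leaf 0 9) (leaf 3 6)) impossible))) (node (node (node (leaf 0 9) (leaf 3 6)) (node (node
    (leaf 0 9) (leaf 3 6)) impossible)) (node (node (node (leaf 0 9) (leaf 3 6)) impossible)
    impossible))) (node (node (node (node (leaf 0 9) (leaf 3 18)) (node (node (leaf 0 9)
    (leaf 3 6)) impossible)) (node (node (node (leaf 0 9) (leaf 3 6)) impossible) impossible))
    (node (node (node (node (leaf 0 9) (leaf 3 6)) impossible) impossible) impossible))) (node
    (node (node (node (node (leaf 0 21) (leaf 3 18)) (node (node (leaf 0 9) (leaf 3 6))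
    impossible)) (node (node (node (leaf 0 9) (leaf 3 6)) impossible) impossible)) (node (node
    (node (node (leaf 0 9) (leaf 3 6)) impossible) impossible) impossible)) (node (node (node
    (node (node (leaf 0 9) (node (leaf 0 11) (node idle impossible))) impossible) impossible)
    impossible) impossible)))))) impossible))))))),
  ([([7, 9, 9], 4), ([7, 9], 0)],
    (node (leaf 0 5) (node (node (leaf 1 20) (node (leaf 1 20) (leaf 0 0))) (node (node (node
    (node (node (node (leaf 0 9) (node (leaf 5 24) (leaf 4 24))) (node (leaf 0 20) (node (node
    (leaf 0 9) (node (leaf 5 24) (leaf 4 24))) (node (node (leaf 0 9) (node (leaf 5 24)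
    (leaf 4 24))) impossible)))) (node (leaf 0 20) (node (node (node (leaf 0 9) (node (leaf 5 24)
    (leaf 4 6))) (node (node (leaf 0 9) (node (leaf 5 24) (leaf 4 6))) impossible)) (node (node
    (node (leaf 0 9) (node (leaf 5 24) (leaf 4 6))) impossible) impossible)))) (node (leaf 0 20)
    (node (node (node (node (leaf 0 9) (node (leaf 3 24) (leaf 4 6))) (node (node (leaf 0 9)
    (node (leaf 5 24) (leaf 4 6))) impossible)) (node (node (node (leaf 0 9) (node (leaf 5 24)
    (leaf 4 6))) impossible) impossible)) (node (node (node (node (leaf 0 9) (node (leaf 5 24)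
    (leaf 4 6))) impossible) impossible) impossible)))) (node (leaf 0 0) (node (node (node (node
    (node (leaf 0 9) (node (leaf 0 11) (leaf 4 6))) (node (node (leaf 0 9) (node (leaf 4 24)
    (leaf 4 6))) impossible)) (node (node (node (leaf 0 9) (node (leaf 5 24) (leaf 4 6)))
    impossible) impossible)) (node (node (node (node (leaf 0 9) (node (leaf 5 24) (leaf 4 6)))
    impossible) impossible) impossible)) (node (node (node (node (node (leaf 0 9) (node
    (leaf 5 24) (leaf 4 6))) impossible) impossible) impossible) impossible)))) (node (leaf 0 0)
    (node (node (node (node (node (node (leaf 0 9) (node (leaf 0 11) (leaf 4 6))) (node (node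
    (leaf 0 9) (node (leaf 0 11) (leaf 4 6))) impossible)) (node (node (node (leaf 0 9) (node
    (leaf 5 24) (leaf 4 6))) impossible) impossible)) (node (node (node (node (leaf 0 9) (node
    (leaf 5 24) (leaf 4 6))) impossible) impossible) impossible)) (node (node (node (node (node
    (leaf 0 9) (node (leaf 5 24) (leaf 4 6))) impossible) impossible) impossible) impossible))
    (node (node (node (node (node (node (leaf 0 9) (node (leaf 0 11) (node (leaf 0 30) (node idle
    impossible)))) impossible) impossible) impossible) impossible) impossible))))))),
  ([([7, 9, 9], 4), ([8, 8], 0)],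
    (node (leaf 0 5) (node (node (node (node (node (node (leaf 0 9) (leaf 4 20)) (node (node
    (leaf 0 9) (leaf 4 20)) (leaf 3 7))) (node (node (node (leaf 0 9) (leaf 4 20)) (leaf 3 7))
    (leaf 2 7))) (node (node (node (node (leaf 0 9) (leaf 4 20)) (leaf 3 7)) (leaf 2 7))
    (leaf 1 0))) (node (node (node (node (node (leaf 0 9) (leaf 4 20)) (leaf 3 7)) (leaf 2 7))
    (leaf 1 0)) (leaf 0 0))) (node (node (node (node (node (node (leaf 0 9) (leaf 4 24)) (node
    (node (leaf 0 9) (leaf 0 20)) (node (node (leaf 0 9) (leaf 4 24)) (node (node (leaf 0 9)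
    (leaf 4 24)) impossible)))) (node (node (node (leaf 0 9) (leaf 1 20)) (node (node (leaf 0 9)
    (leaf 4 6)) (node (node (leaf 0 9) (leaf 4 6)) impossible))) (node (node (node (leaf 0 9)
    (leaf 4 6)) (node (node (leaf 0 9) (leaf 4 6)) impossible)) (node (node (node (leaf 0 9)
    (leaf 4 6)) impossible) impossible)))) (node (node (node (node (leaf 0 9) (leaf 2 20)) (node
    (node (leaf 0 9) (leaf 4 6)) (node (node (leaf 0 9) (leaf 4 6)) impossible))) (node (node
    (node (leaf 0 9) (leaf 4 6)) (node (node (leaf 0 9) (leaf 4 6)) impossible)) (node (node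
    (node (leaf 0 9) (leaf 4 6)) impossible) impossible))) (node (node (node (node (leaf 0 9)
    (leaf 4 6)) (node (node (leaf 0 9) (leaf 4 6)) impossible)) (node (node (node (leaf 0 9)
    (leaf 4 6)) impossible) impossible)) (node (node (node (node (leaf 0 9) (leaf 4 6))
    impossible) impossible) impossible)))) (node (leaf 0 0) (node (node (node (node (node
    (leaf 0 9) (leaf 4 6)) (node (node (leaf 0 9) (leaf 4 6)) impossible)) (node (node (node
    (leaf 0 9) (leaf 4 6)) impossible) impossible)) (node (node (node (node (leaf 0 9)
    (leaf 4 6)) impossible) impossible) impossible)) (node (node (node (node (node (leaf 0 9)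
    (leaf 4 6)) impossible) impossible) impossible) impossible)))) (node (leaf 0 0) (node (node
    (node (node (node (node (leaf 0 9) (leaf 4 6)) (node (node (leaf 0 9) (leaf 4 6))
    impossible)) (node (node (node (leaf 0 9) (leaf 4 6)) impossible) impossible)) (node (node
    (node (node (leaf 0 9) (leaf 4 6)) impossible) impossible) impossible)) (node (node (node
    (node (node (leaf 0 9) (leaf 4 6)) impossible) impossible) impossible) impossible)) (node
    (node (node (node (node (node (leaf 0 9) (node (leaf 0 11) (node idle impossible)))
    impossible) impossible) impossible) impossible) impossible))))))),
  ([([8, 8, 9], 3), ([8, 8], 0), ([8, 9], 0), ([9], 0)],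
    (node (leaf 0 2) (node (node (node (node (leaf 3 14) (leaf 2 1)) (leaf 1 1)) (leaf 0 1))
    (node (leaf 0 1) (node (node (node (node (node (leaf 0 0) (node (node (leaf 0 0) (node
    (leaf 0 4) (node (node (leaf 0 6) (leaf 5 28)) (node (node (leaf 0 6) (leaf 5 28))
    impossible)))) (node (node (leaf 0 0) (node (leaf 0 4) (node (node (leaf 0 6) (leaf 5 28))
    (node (node (leaf 0 6) (leaf 5 28)) impossible)))) impossible))) (node (node (leaf 0 0) (node
    (leaf 0 13) (leaf 3 33))) (node (node (leaf 0 0) (node (leaf 0 13) (leaf 3 33)))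
    impossible))) (node (node (node (leaf 0 0) (node (leaf 0 13) (leaf 3 33))) (node (node
    (leaf 0 0) (node (leaf 0 13) (leaf 3 33))) impossible)) (node (node (node (leaf 0 0) (node
    (leaf 0 13) (leaf 3 33))) impossible) impossible))) (node (node (node (node (leaf 0 0) (node
    (leaf 0 13) (leaf 3 33))) (node (node (leaf 0 0) (node (leaf 0 13) (leaf 3 33))) impossible))
    (node (node (node (leaf 0 0) (node (leaf 0 13) (leaf 3 33))) impossible) impossible)) (node
    (node (node (node (leaf 0 0) (node (leaf 0 13) (leaf 3 33))) impossible) impossible)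
    impossible))) (node (node (node (node (node (leaf 0 0) (node (node (leaf 0 0) (node
    (leaf 5 33) (leaf 0 38))) (node (node (leaf 0 0) (node (leaf 5 33) (node (leaf 0 38)
    (leaf 4 33)))) impossible))) (node (node (leaf 0 0) (node (leaf 0 13) (node (node (leaf 0 0)
    (node (leaf 5 33) (node (leaf 0 13) (leaf 4 33)))) impossible))) impossible)) (node (node
    (node (leaf 0 0) (node (leaf 0 13) (node (node (leaf 0 0) (node (leaf 5 33) (node (leaf 0 13)
    (leaf 4 33)))) impossible))) impossible) impossible)) (node (node (node (node (leaf 0 0)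
    (node (leaf 0 13) (node (node (leaf 0 0) (node (leaf 5 33) (node (leaf 0 13) (leaf 4 33))))
    impossible))) impossible) impossible) impossible)) (node (node (node (node (node (leaf 0 0)
    (node (leaf 0 13) (node (node (leaf 0 0) (node (leaf 0 4) (node (leaf 0 13) (node (node
    (leaf 0 6) (node idle impossible)) impossible)))) impossible))) impossible) impossible)
    impossible) impossible))))))),
  ([([8, 8, 9], 3), ([7, 9], 0), ([8, 9], 0), ([9], 0)],
    (node (leaf 0 2) (node (node (node (node (leaf 3 14) (leaf 2 1)) (leaf 1 1)) (leaf 0 1))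
    (node (leaf 0 1) (node (node (node (node (node (leaf 0 0) (node (leaf 0 4) (node (node
    (leaf 0 0) (node (leaf 0 4) (node (node (leaf 0 6) (leaf 5 28)) (node (node (leaf 0 6)
    (leaf 5 28)) impossible)))) (node (node (leaf 0 0) (node (leaf 0 4) (node (node (leaf 0 6)
    (leaf 5 28)) (node (node (leaf 0 6) (leaf 5 28)) impossible)))) impossible)))) (node (node
    (leaf 0 0) (node (leaf 0 4) (node (leaf 0 13) (leaf 3 33)))) (node (node (leaf 0 0) (node
    (leaf 0 4) (node (leaf 0 13) (leaf 3 33)))) impossible))) (node (node (node (leaf 0 0) (node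
    (leaf 0 4) (node (leaf 0 13) (leaf 3 33)))) (node (node (leaf 0 0) (node (leaf 0 4) (node
    (leaf 0 13) (leaf 3 33)))) impossible)) (node (node (node (leaf 0 0) (node (leaf 0 4) (node
    (leaf 0 13) (leaf 3 33)))) impossible) impossible))) (node (node (node (node (leaf 0 0) (node
    (leaf 0 13) (node (leaf 0 13) (leaf 3 33)))) (node (node (leaf 0 0) (node (leaf 0 4) (node
    (leaf 0 13) (leaf 3 33)))) impossible)) (node (node (node (leaf 0 0) (node (leaf 0 4) (node
    (leaf 0 13) (leaf 3 33)))) impossible) impossible)) (node (node (node (node (leaf 0 0) (node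
    (leaf 0 4) (node (leaf 0 13) (leaf 3 33)))) impossible) impossible) impossible))) (node (node
    (node (node (node (leaf 0 0) (node (node (leaf 0 0) (node (leaf 1 37) (leaf 0 38))) (node
    (node (leaf 0 0) (node (leaf 5 33) (node (node (leaf 0 18) (leaf 5 26)) (leaf 4 33))))
    (leaf 3 33)))) (node (node (leaf 0 0) (node (leaf 0 13) (node (leaf 0 13) (leaf 3 33))))
    impossible)) (node (node (node (leaf 0 0) (node (leaf 0 4) (node (leaf 0 13) (leaf 3 33))))
    impossible) impossible)) (node (node (node (node (leaf 0 0) (node (leaf 0 4) (node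
    (leaf 0 13) (leaf 3 33)))) impossible) impossible) impossible)) (node (node (node (node (node
    (leaf 0 0) (node (leaf 0 4) (node (leaf 0 13) (node (node (leaf 0 0) (node (leaf 0 4) (node
    (leaf 0 13) (node (node (leaf 0 6) (node idle impossible)) impossible)))) impossible))))
    impossible) impossible) impossible) impossible))))))),
  ([([8, 9, 9], 3), ([9, 9], 2)],
    (node (leaf 0 8) (node (node (node (leaf 2 28) (node (leaf 2 28) (leaf 1 26))) (node (node
    (leaf 2 28) (leaf 1 26)) (leaf 0 26))) (node (node (node (node (node (leaf 0 6) (leaf 3 16))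
    (node (node (leaf 0 6) (leaf 3 16)) (node (node (leaf 0 6) (leaf 3 16)) (node (node
    (leaf 0 6) (leaf 3 16)) impossible)))) (node (node (node (leaf 0 6) (leaf 1 33)) (node (node
    (leaf 0 6) (leaf 3 16)) (node (node (leaf 0 6) (leaf 3 16)) impossible))) (node (node (node
    (leaf 0 6) (leaf 3 16)) (node (node (leaf 0 6) (leaf 3 16)) impossible)) (node (node (node
    (leaf 0 6) (leaf 3 16)) impossible) impossible)))) (node (node (node (node (leaf 0 18)
    (leaf 2 33)) (node (node (leaf 0 6) (leaf 2 33)) (node (node (leaf 0 6) (leaf 2 33))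
    impossible))) (node (node (node (leaf 0 6) (leaf 2 33)) (node (node (leaf 0 6) (leaf 3 16))
    impossible)) (node (node (node (leaf 0 6) (leaf 3 16)) impossible) impossible))) (node (node
    (node (node (leaf 0 6) (leaf 3 34)) (node (node (leaf 0 6) (leaf 3 16)) impossible)) (node
    (node (node (leaf 0 6) (leaf 3 16)) impossible) impossible)) (node (node (node (node
    (leaf 0 6) (leaf 3 16)) impossible) impossible) impossible)))) (node (node (node (node (node
    (leaf 0 18) (leaf 3 33)) (node (node (leaf 0 18) (leaf 3 33)) (node (node (leaf 0 18)
    (leaf 3 33)) impossible))) (node (node (node (leaf 0 6) (leaf 3 33)) (node (node (leaf 0 6)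
    (leaf 3 33)) impossible)) (node (node (node (leaf 0 6) (leaf 3 33)) impossible) impossible)))
    (node (node (node (node (leaf 0 6) (leaf 3 33)) (node (node (leaf 0 6) (leaf 3 33))
    impossible)) (node (node (node (leaf 0 6) (leaf 3 33)) impossible) impossible)) (node (node
    (node (node (leaf 0 6) (leaf 3 33)) impossible) impossible) impossible))) (node (node (node
    (node (node (leaf 0 6) (leaf 3 34)) (node (node (leaf 0 6) (leaf 3 16)) impossible)) (node
    (node (node (leaf 0 6) (leaf 3 16)) impossible) impossible)) (node (node (node (node
    (leaf 0 6) (leaf 3 16)) impossible) impossible) impossible)) (node (node (node (node (node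
    (leaf 0 6) (node (leaf 0 45) (node (node (node idle impossible) impossible) impossible)))
    impossible) impossible) impossible) impossible))))))),
  ([([8, 9, 9], 4), ([8, 9], 0), ([9], 0)],
    (node (leaf 0 0) (node (node (node (leaf 2 4) (node (leaf 2 4) (leaf 1 13))) (node (node
    (leaf 2 4) (leaf 1 13)) (node (leaf 0 13) (leaf 0 4)))) (node (node (node (node (node (node
    (leaf 0 11) (node (node (leaf 0 43) (leaf 5 35)) (node (node (leaf 0 44) (leaf 5 31)) (node
    (node (leaf 0 43) (leaf 5 31)) impossible)))) (node (leaf 0 27) (node (node (leaf 0 11) (node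
    (leaf 5 29) (leaf 4 22))) (node (node (leaf 0 11) (node (leaf 5 29) (leaf 4 22)))
    impossible)))) (node (leaf 0 13) (node (node (node (leaf 0 11) (node (leaf 5 29)
    (leaf 4 22))) (node (node (leaf 0 11) (node (leaf 5 29) (leaf 4 22))) impossible)) (node
    (node (node (leaf 0 11) (node (leaf 5 29) (leaf 4 22))) impossible) impossible)))) (node
    (leaf 0 13) (node (node (node (node (leaf 0 11) (node (leaf 5 29) (leaf 4 22))) (node (node
    (leaf 0 11) (node (leaf 5 29) (leaf 4 22))) impossible)) (node (node (node (leaf 0 11) (node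
    (leaf 5 29) (leaf 4 22))) impossible) impossible)) (node (node (node (node (leaf 0 11) (node
    (leaf 5 29) (leaf 4 22))) impossible) impossible) impossible)))) (node (leaf 0 13) (node
    (node (node (node (node (leaf 0 11) (node (node (leaf 0 41) (leaf 5 46)) (node (node
    (leaf 0 42) (leaf 5 45)) (node (node (leaf 0 41) (leaf 5 45)) impossible)))) (node (node
    (leaf 0 11) (node (leaf 5 29) (leaf 4 22))) impossible)) (node (node (node (leaf 0 11) (node
    (leaf 5 29) (leaf 4 22))) impossible) impossible)) (node (node (node (node (leaf 0 11) (node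
    (leaf 5 29) (leaf 4 22))) impossible) impossible) impossible)) (node (node (node (node (node
    (leaf 0 11) (node (leaf 5 29) (leaf 4 22))) impossible) impossible) impossible)
    impossible)))) (node (node (node (node (node (node (leaf 0 36) (node (leaf 5 37)
    (leaf 4 38))) (leaf 3 13)) (leaf 2 13)) (leaf 1 13)) (leaf 0 13)) (node (node (node (node
    (node (node (leaf 0 11) (node (node (leaf 0 39) (leaf 5 46)) (node (node (leaf 0 40)
    (leaf 5 45)) (node (node (leaf 0 39) (leaf 5 45)) impossible)))) (node (node (leaf 0 11)
    (node (node (leaf 0 39) (leaf 5 46)) (node (node (leaf 0 40) (leaf 5 45)) (node (node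
    (leaf 0 39) (leaf 5 45)) impossible)))) impossible)) (node (node (node (leaf 0 11) (node
    (node (leaf 0 39) (leaf 5 46)) (node (node (leaf 0 40) (leaf 5 45)) (node (node (leaf 0 39)
    (leaf 5 45)) impossible)))) impossible) impossible)) (node (node (node (node (leaf 0 11)
    (node (leaf 0 19) (node (node (leaf 0 40) (leaf 5 45)) (node (node (leaf 0 39) (leaf 5 45))
    impossible)))) impossible) impossible) impossible)) (node (node (node (node (node (leaf 0 11)
    (node (leaf 0 19) (node (node (leaf 0 40) (leaf 5 45)) (node (node (leaf 0 39) (leaf 5 45))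
    impossible)))) impossible) impossible) impossible) impossible)) (node (node (node (node (node
    (node (leaf 0 11) (node (leaf 0 19) (node (node (leaf 0 40) (leaf 0 19)) (node (node
    (leaf 0 39) (node idle impossible)) impossible)))) impossible) impossible) impossible)
    impossible) impossible))))))),
  ([([9, 9, 9], 4), ([9, 9], 1)],
    (node (leaf 0 18) (node (node (node (node (node (node (leaf 0 40) (leaf 4 45)) (node (node
    (leaf 0 40) (leaf 4 45)) (node (node (leaf 0 40) (leaf 4 45)) impossible))) (node (node (node
    (leaf 0 40) (leaf 4 45)) (node (node (leaf 0 40) (leaf 4 45)) impossible)) (node (node (node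
    (leaf 0 40) (leaf 4 45)) impossible) impossible))) (node (node (node (node (leaf 0 40)
    (leaf 4 45)) (node (node (leaf 0 40) (leaf 4 45)) impossible)) (node (node (node (leaf 0 40)
    (leaf 4 45)) impossible) impossible)) (node (node (node (node (leaf 0 40) (leaf 4 45))
    impossible) impossible) impossible))) (node (node (node (node (node (leaf 0 40) (leaf 4 45))
    (node (node (leaf 0 40) (leaf 4 45)) impossible)) (node (node (node (leaf 0 40) (leaf 4 45))
    impossible) impossible)) (node (node (node (node (leaf 0 40) (leaf 4 45)) impossible)
    impossible) impossible)) (node (node (node (node (node (leaf 0 40) (leaf 4 45)) impossible)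
    impossible) impossible) impossible))) (node (node (node (node (node (node (leaf 0 40) (node
    (leaf 0 48) (leaf 4 47))) (node (node (leaf 0 40) (node (leaf 0 48) (leaf 4 47)))
    impossible)) (node (node (node (leaf 0 40) (node (leaf 0 48) (leaf 4 47))) impossible)
    impossible)) (node (node (node (node (leaf 0 40) (node (leaf 0 48) (leaf 4 47))) impossible)
    impossible) impossible)) (node (node (node (node (node (leaf 0 40) (node (leaf 0 48)
    (leaf 4 47))) impossible) impossible) impossible) impossible)) (node (node (node (node (node
    (node (leaf 0 40) (node (leaf 0 48) (node (node idle impossible) impossible))) impossible)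
    impossible) impossible) impossible) impossible)))))]

theorem checkTrees_moveTrees :
    checkTrees (monomials.map (List.map (List.map (· + 1)))) moveTrees = true := by
  decide +kernel

section ListerStates

variable {V : Type*} [Fintype V] [DecidableEq V] {G : SimpleGraph V} {r : ℕ}

/-- Each vertex in `q` occurs in `p` with at most as many presentations left. -/
def Entries.LE {α : Type*} (p q : List (α × ℕ)) : Prop := ∀ x ∈ q, ∃ y ∈ p, y.1 = x.1 ∧ y.2 ≤ x.2

/-- In the position `(U, t)` there are unpainted vertices with the list state `F`: they lie in
completely joined parts, and the numbers in `F` bound from above how often they may still be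
presented. -/
def HasListerState (G : SimpleGraph V) (r : ℕ) (U : Finset V) (t : V → ℕ)
    (F : List (List ℕ)) : Prop :=
  ∃ P : List (List (V × ℕ)), P.map (List.map Prod.snd) = F ∧
    (∀ p ∈ P, (p.map Prod.fst).Nodup) ∧
    P.Pairwise (fun p q => ∀ x ∈ p, ∀ y ∈ q, G.Adj x.1 y.1) ∧
    ∀ p ∈ P, ∀ x ∈ p, x.1 ∈ U ∧ r ≤ x.2 + t x.1

/-- Lister wins from all positions with the list state `F`. -/
def BadState (G : SimpleGraph V) (r : ℕ) (F : List (List ℕ)) : Prop :=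
  ∀ fuel U t, HasListerState G r U t F → (∀ v ∈ U, t v < r) → ¬ PainterWinsIn G r fuel U t

/-- The part `p` contains vertices that have at most the presentations left given by `q`. -/
def PartLE (p q : List ℕ) : Prop :=
  ∃ p' : List ℕ, p'.Perm p ∧ List.Forall₂ (· ≤ ·) (p'.take q.length) q

theorem PartLE.exists_lift {α : Type*} {p : List (α × ℕ)} {q : List ℕ}
    (h : PartLE (p.map Prod.snd) q) (hp : (p.map Prod.fst).Nodup) :
    ∃ p' : List (α × ℕ), p'.map Prod.snd = q ∧ (p'.map Prod.fst).Nodup ∧ Entries.LE p p' := by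
  obtain ⟨p₁, hp₁, hq⟩ := h
  obtain ⟨p₂, hp₂, rfl⟩ := exists_perm_of_map_perm hp₁.symm
  rw [← List.map_take] at hq
  have hlen : (p₂.take q.length).length = q.length := by simpa using hq.length_eq
  refine ⟨((p₂.take q.length).map Prod.fst).zip q, ?_, ?_, ?_⟩
  · exact List.map_snd_zip (by rw [List.length_map, hlen])
  · rw [List.map_fst_zip (by simp)]
    exact ((hp₂.map Prod.fst).nodup_iff.1 hp).sublist ((List.take_sublist _ _).map _)
  · have hsub : ∀ y ∈ p₂.take q.length, y ∈ p := fun y hy =>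
      hp₂.mem_iff.2 (List.mem_of_mem_take hy)
    generalize p₂.take q.length = l at hq hsub
    clear hlen hp₁ hp₂ hp
    induction l generalizing q with
    | nil => intro x hx; simp at hx
    | cons y l ih =>
      rw [List.map_cons] at hq
      cases hq with
      | @cons _ n _ q h hq =>
        intro x hx
        rw [List.map_cons, List.zip_cons_cons, List.mem_cons] at hx
        rcases hx with rfl | hx
        · exact ⟨y, hsub y (by simp), rfl, h⟩
        · exact ih hq (fun z hz => hsub z (by simp [hz])) x hx

theorem BadState.perm {F F' : List (List ℕ)} (h : BadState G r F') (hF : F.Perm F') :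
    BadState G r F := by
  rintro fuel U t ⟨P, rfl, hn, hadj, ht⟩
  obtain ⟨P', hP, hF'⟩ := exists_perm_of_map_perm hF
  refine h fuel U t ⟨P', hF', fun p hp => hn p (hP.mem_iff.2 hp), ?_,
    fun p hp => ht p (hP.mem_iff.2 hp)⟩
  exact (hP.pairwise_iff fun h x hx y hy => (h y hy x hx).symm).1 hadj

theorem BadState.append {F F' : List (List ℕ)} (h : BadState G r F) :
    BadState G r (F ++ F') := by
  rintro fuel U t ⟨P, hP, hn, hadj, ht⟩
  obtain ⟨P₁, P₂, rfl, h1, -⟩ := List.map_eq_append_iff.1 hP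
  exact h fuel U t ⟨P₁, h1, fun p hp => hn p (by simp [hp]), (List.pairwise_append.1 hadj).1,
    fun p hp => ht p (by simp [hp])⟩

theorem BadState.mono {F F' : List (List ℕ)} (h : BadState G r F')
    (hF : List.Forall₂ PartLE F F') : BadState G r F := by
  rintro fuel U t ⟨P, rfl, hn, hadj, ht⟩
  suffices ∃ P' : List (List (V × ℕ)), P'.map (List.map Prod.snd) = F' ∧
      (∀ p ∈ P', (p.map Prod.fst).Nodup) ∧ List.Forall₂ Entries.LE P P' by
    obtain ⟨P', h1, h2, h3⟩ := this
    refine h fuel U t ⟨P', h1, h2, ?_, ?_⟩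
    · clear hF h1 h2 hn ht h
      induction h3 with
      | nil => exact List.Pairwise.nil
      | @cons p q P P' hpq h3 ih =>
        rw [List.pairwise_cons] at hadj ⊢
        refine ⟨fun q' hq' x hx y hy => ?_, ih hadj.2⟩
        obtain ⟨p', hp', hpq'⟩ : ∃ p' ∈ P, Entries.LE p' q' := by
          clear ih hadj
          induction h3 with
          | nil => simp at hq'
          | cons h _ ih =>
            rcases List.mem_cons.1 hq' with rfl | hq'
            · exact ⟨_, by simp, h⟩
            · obtain ⟨p', h1, h2⟩ := ih hq'
              exact ⟨p', by simp [h1], h2⟩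
        obtain ⟨x', hx', hx, -⟩ := hpq x hx
        obtain ⟨y', hy', hy, -⟩ := hpq' y hy
        rw [← hx, ← hy]
        exact hadj.1 p' hp' x' hx' y' hy'
    · clear hF h1 h2 hn hadj h
      induction h3 with
      | nil => simp
      | cons h _ ih =>
        intro p' hp' x hx
        rcases List.mem_cons.1 hp' with rfl | hp'
        · obtain ⟨y, hy, hxy, hle⟩ := h x hx
          have := ht _ (by simp) y hy
          rw [hxy] at this
          exact ⟨this.1, this.2.trans (Nat.add_le_add_right hle _)⟩
        · exact ih (fun p hp => ht p (by simp [hp])) p' hp' x hx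
  clear hadj ht h
  induction P generalizing F' with
  | nil => cases hF; exact ⟨[], rfl, by simp, List.Forall₂.nil⟩
  | cons p P ih =>
    rw [List.map_cons] at hF
    cases hF with
    | @cons _ q _ F' h hF =>
      obtain ⟨P', h1, h2, h3⟩ := ih hF (fun p hp => hn p (by simp [hp]))
      obtain ⟨p', k1, k2, k3⟩ := h.exists_lift (hn p (by simp))
      refine ⟨p' :: P', by simp [h1, k1], ?_, List.Forall₂.cons k3 h3⟩
      intro q' hq'
      rcases List.mem_cons.1 hq' with rfl | hq'
      · exact k2
      · exact h2 q' hq'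

theorem badState_zero : BadState G r [[0]] := by
  rintro fuel U t ⟨P, hP, -, -, ht⟩ hU
  obtain ⟨p, rfl, hp⟩ := List.map_eq_singleton_iff.1 hP
  obtain ⟨x, rfl, hx⟩ := List.map_eq_singleton_iff.1 hp
  obtain ⟨h1, h2⟩ := ht [x] (by simp) x (by simp)
  have := hU _ h1
  omega

/-- Lister presents the first components of the parts in `M`, which split into two. -/
theorem badState_of_replies {M : List (List ℕ × List ℕ)} (hM : ∃ x ∈ M, x.1 ≠ [])
    (h : ∀ pre x post, M = pre ++ x :: post → x.1 ≠ [] →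
      BadState G r (x.2 :: (pre ++ post).map decPart)) :
    BadState G r (M.map fun x => x.1 ++ x.2) := by
  rintro fuel U t ⟨P, hP, hn, hadj, ht⟩ hU hw
  obtain ⟨Q, rfl, rfl⟩ : ∃ Q : List (List (V × ℕ) × List (V × ℕ)),
      Q.map (fun y => y.1 ++ y.2) = P ∧
      Q.map (fun y => (y.1.map Prod.snd, y.2.map Prod.snd)) = M := by
    clear hn hadj ht hM h
    induction M generalizing P with
    | nil => exact ⟨[], by simpa using hP.symm, rfl⟩
    | cons x M ih =>
      obtain ⟨p, P, rfl, hp, hP⟩ := List.map_eq_cons_iff.1 hP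
      obtain ⟨Q, rfl, rfl⟩ := ih P hP
      obtain ⟨a, b, rfl, ha, hb⟩ := List.map_eq_append_iff.1 hp
      exact ⟨(a, b) :: Q, rfl, by simp [ha, hb]⟩
  clear hP
  rw [List.forall_mem_map] at hn ht
  rw [List.pairwise_map] at hadj
  set S : Finset V := ((Q.map Prod.fst).flatten.map Prod.fst).toFinset with hS
  have hmem : ∀ v, v ∈ S ↔ ∃ y ∈ Q, v ∈ y.1.map Prod.fst := by
    intro v
    simp only [hS, List.mem_toFinset, List.mem_map, List.mem_flatten]
    constructor
    · rintro ⟨x, ⟨_, ⟨y, hy, rfl⟩, hx⟩, rfl⟩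
      exact ⟨y, hy, x, hx, rfl⟩
    · rintro ⟨y, hy, x, hx, rfl⟩
      exact ⟨x, ⟨_, ⟨y, hy, rfl⟩, hx⟩, rfl⟩
  obtain ⟨y₀, hy₀, hne₀⟩ : ∃ y ∈ Q, y.1 ≠ [] := by
    obtain ⟨x, hx, hx'⟩ := hM
    obtain ⟨y, hy, rfl⟩ := List.mem_map.1 hx
    exact ⟨y, hy, fun h => hx' (by simp [h])⟩
  have hSU : S ⊆ U := by
    intro v hv
    obtain ⟨y, hy, hv⟩ := (hmem v).1 hv
    obtain ⟨x, hx, rfl⟩ := List.mem_map.1 hv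
    exact (ht y hy x (by simp [hx])).1
  have hSne : S.Nonempty := by
    obtain ⟨x, l, hx⟩ := List.exists_cons_of_ne_nil hne₀
    exact ⟨x.1, (hmem _).2 ⟨y₀, hy₀, by simp [hx]⟩⟩
  cases fuel with
  | zero => exact (hSne.mono hSU).ne_empty hw
  | succ fuel =>
    obtain ⟨I, hIS, hI, hw⟩ := (hw.resolve_left (hSne.mono hSU).ne_empty) S hSU hSne
    obtain ⟨pre, y, post, rfl, hy, hIy⟩ : ∃ pre y post, Q = pre ++ y :: post ∧ y.1 ≠ [] ∧
        ∀ v ∈ I, v ∈ y.1.map Prod.fst := by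
      rcases I.eq_empty_or_nonempty with rfl | ⟨u, hu⟩
      · obtain ⟨pre, post, hQ⟩ := List.append_of_mem hy₀
        exact ⟨pre, y₀, post, hQ, hne₀, by simp⟩
      · obtain ⟨y, hy, hyu⟩ := (hmem u).1 (hIS hu)
        obtain ⟨pre, post, rfl⟩ := List.append_of_mem hy
        refine ⟨pre, y, post, rfl, fun h => by simp [h] at hyu, fun v hv => ?_⟩
        obtain ⟨z, hz, hzv⟩ := (hmem v).1 (hIS hv)
        obtain ⟨a, ha, rfl⟩ := List.mem_map.1 hyu
        obtain ⟨b, hb, rfl⟩ := List.mem_map.1 hzv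
        rw [List.pairwise_append, List.pairwise_cons] at hadj
        rcases List.mem_append.1 hz with hz | hz
        · exact absurd (hadj.2.2 z hz y (by simp) b (by simp [hb]) a (by simp [ha]))
            (hI _ hv _ hu)
        · rcases List.mem_cons.1 hz with rfl | hz
          · exact hzv
          · exact absurd (hadj.2.1.1 z hz a (by simp [ha]) b (by simp [hb])) (hI _ hu _ hv)
    set t' : V → ℕ := fun v => t v + if v ∈ S then 1 else 0 with ht'
    have hsymm : ∀ {y z : List (V × ℕ) × List (V × ℕ)},
        (∀ a ∈ y.1 ++ y.2, ∀ b ∈ z.1 ++ z.2, G.Adj a.1 b.1) →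
        ∀ a ∈ z.1 ++ z.2, ∀ b ∈ y.1 ++ y.2, G.Adj a.1 b.1 :=
      fun h a ha b hb => (h b hb a ha).symm
    have hperm : (pre ++ y :: post).Perm (y :: (pre ++ post)) := List.perm_middle
    have hadj' := (hperm.pairwise_iff hsymm).1 hadj
    rw [List.pairwise_cons] at hadj'
    have hold : ∀ z ∈ pre ++ post, ∀ x ∈ (z.1.map fun x => (x.1, x.2.pred)) ++ z.2,
        ∃ x' ∈ z.1 ++ z.2, x'.1 = x.1 := by
      intro z _ x hx
      rcases List.mem_append.1 hx with hx | hx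
      · obtain ⟨x', hx', rfl⟩ := List.mem_map.1 hx
        exact ⟨x', by simp [hx'], rfl⟩
      · exact ⟨x, by simp [hx], rfl⟩
    have hstate : HasListerState G r (U \ I) t' ((y.2.map Prod.snd) ::
        ((pre ++ post).map (fun y => (y.1.map Prod.snd, y.2.map Prod.snd))).map decPart) := by
      refine ⟨y.2 :: (pre ++ post).map (fun z => (z.1.map fun x => (x.1, x.2.pred)) ++ z.2),
        ?_, ?_, ?_, ?_⟩
      · simp [decPart, Function.comp_def]
      · intro p hp
        rcases List.mem_cons.1 hp with rfl | hp
        · have := hn y (by simp)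
          rw [List.map_append, List.nodup_append] at this
          exact this.2.1
        · obtain ⟨z, hz, rfl⟩ := List.mem_map.1 hp
          have := hn z (hperm.mem_iff.2 (List.mem_cons_of_mem _ hz))
          simpa [Function.comp_def] using this
      · rw [List.pairwise_cons, List.pairwise_map]
        refine ⟨fun p hp a ha b hb => ?_, hadj'.2.imp_of_mem fun {z w} hz hw h a ha b hb => ?_⟩
        · obtain ⟨z, hz, rfl⟩ := List.mem_map.1 hp
          obtain ⟨b', hb', h⟩ := hold z hz b hb
          rw [← h]
          exact hadj'.1 z hz a (by simp [ha]) b' hb'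
        · obtain ⟨a', ha', e⟩ := hold z hz a ha
          obtain ⟨b', hb', e'⟩ := hold w hw b hb
          rw [← e, ← e']
          exact h a' ha' b' hb'
      · intro p hp
        rcases List.mem_cons.1 hp with rfl | hp
        · intro x hx
          have h1 := ht y (by simp) x (by simp [hx])
          refine ⟨Finset.mem_sdiff.2 ⟨h1.1, fun hxI => ?_⟩, h1.2.trans (by simp [ht'])⟩
          have := hn y (by simp)
          rw [List.map_append, List.nodup_append] at this
          exact this.2.2 x.1 (hIy _ hxI) x.1 (List.mem_map_of_mem hx) rfl
        · obtain ⟨z, hz, rfl⟩ := List.mem_map.1 hp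
          have hzQ := hperm.mem_iff.2 (List.mem_cons_of_mem _ hz)
          intro x hx
          constructor
          · obtain ⟨x', hx', e⟩ := hold z hz x hx
            rw [← e]
            refine Finset.mem_sdiff.2 ⟨(ht z hzQ x' hx').1, fun hxI => ?_⟩
            obtain ⟨a, ha, e⟩ := List.mem_map.1 (hIy _ hxI)
            have := hadj'.1 z hz a (by simp [ha]) x' hx'
            rw [e] at this
            exact G.irrefl this
          · rcases List.mem_append.1 hx with hx | hx
            · obtain ⟨x', hx', rfl⟩ := List.mem_map.1 hx
              have h1 := (ht z hzQ x' (by simp [hx'])).2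
              have h2 : x'.1 ∈ S := (hmem _).2 ⟨z, hzQ, List.mem_map_of_mem hx'⟩
              simp only [ht', h2, if_true, Nat.pred_eq_sub_one]
              omega
            · exact (ht z hzQ x (by simp [hx])).2.trans (by simp [ht'])
    have hb := h (pre.map fun y => (y.1.map Prod.snd, y.2.map Prod.snd))
      (y.1.map Prod.snd, y.2.map Prod.snd)
      (post.map fun y => (y.1.map Prod.snd, y.2.map Prod.snd)) (by simp) (by simpa using hy)
    rw [← List.map_append] at hb
    rcases hw with hw | hw
    · exact hb 0 (U \ I) t' hstate (by simp [hw]) hw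
    · exact hb fuel (U \ I) t' hstate hw.1 hw.2

/-- Entrywise comparison with an initial segment. -/
def tokensLE : List ℕ → List ℕ → Bool
  | _, [] => true
  | a :: p, b :: q => Nat.ble a b && tokensLE p q
  | [], _ :: _ => false

theorem forall₂_of_tokensLE {p q : List ℕ} (h : tokensLE p q = true) :
    List.Forall₂ (· ≤ ·) (p.take q.length) q := by
  induction q generalizing p with
  | nil => simp
  | cons b q ih => cases p with
    | nil => cases h
    | cons a p =>
      rw [tokensLE, Bool.and_eq_true] at h
      exact List.Forall₂.cons (Nat.le_of_ble_eq_true h.1) (ih h.2)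

/-- `stateLE F F'` holds if the parts of `F'` can be matched with some of those of `F` such that
each of them bounds its partner. -/
def stateLE : List (List ℕ) → List (List ℕ) → Bool
  | _, [] => true
  | F, q :: F' => aux F' (fun F₀ => stateLE F₀ F') q [] F
where
  /-- Tries the elements of the last argument as partners of `q`. -/
  aux (F' : List (List ℕ)) (k : List (List ℕ) → Bool) (q : List ℕ) :
      List (List ℕ) → List (List ℕ) → Bool
  | _, [] => false
  | pre, p :: F => (tokensLE (sortPart p) q && k (pre ++ F)) || aux F' k q (p :: pre) F

theorem stateLE_aux {F' : List (List ℕ)} {k : List (List ℕ) → Bool} {q : List ℕ}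
    {pre F : List (List ℕ)} (h : stateLE.aux F' k q pre F = true) :
    ∃ p F₀, (pre ++ F).Perm (p :: F₀) ∧ tokensLE (sortPart p) q = true ∧ k F₀ = true := by
  induction F generalizing pre with
  | nil => cases h
  | cons p F ih =>
    rw [stateLE.aux, Bool.or_eq_true, Bool.and_eq_true] at h
    rcases h with h | h
    · exact ⟨p, _, List.perm_middle, h⟩
    · obtain ⟨p', F₀, h1, h2⟩ := ih h
      exact ⟨p', F₀, (List.perm_middle.trans h1), h2⟩

theorem exists_of_stateLE {F F' : List (List ℕ)} (h : stateLE F F' = true) :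
    ∃ F₁ D, F.Perm (F₁ ++ D) ∧ List.Forall₂ PartLE F₁ F' := by
  induction F' generalizing F with
  | nil => exact ⟨[], F, List.Perm.refl _, List.Forall₂.nil⟩
  | cons q F' ih =>
    rw [stateLE] at h
    obtain ⟨p, F₀, h1, h2, h3⟩ := stateLE_aux h
    obtain ⟨F₁, D, h4, h5⟩ := ih h3
    exact ⟨p :: F₁, D, h1.trans (h4.cons p),
      List.Forall₂.cons ⟨_, sortPart_perm p, forall₂_of_tokensLE h2⟩ h5⟩

theorem badState_of_stateLE {F F' : List (List ℕ)} (h : BadState G r F')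
    (hF : stateLE F F' = true) : BadState G r F := by
  obtain ⟨F₁, D, h1, h2⟩ := exists_of_stateLE hF
  exact (h.mono h2).append.perm h1

/-- Checks that every reply of Painter leads to one of the bad states in `T`. -/
def checkReplies (T : List (List (List ℕ))) :
    List (List ℕ × List ℕ) → List (List ℕ × List ℕ) → Bool
  | _, [] => true
  | pre, x :: post =>
    (x.1.isEmpty || T.any (stateLE (x.2 :: (pre ++ post).map decPart))) &&
      checkReplies T (pre ++ [x]) post

/-- Checks a sequence of moves, where each may use the states of the earlier ones. -/
def checkMoves (T : List (List (List ℕ))) : List (List (List ℕ × List ℕ)) → Bool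
  | [] => true
  | M :: L =>
    M.any (fun x => !x.1.isEmpty) && checkReplies T [] M &&
      checkMoves ((M.map fun x => sortPart (x.1 ++ x.2)) :: T) L

theorem badState_of_checkReplies {T : List (List (List ℕ))} (hT : ∀ F ∈ T, BadState G r F)
    {pre₀ M : List (List ℕ × List ℕ)} (h : checkReplies T pre₀ M = true) :
    ∀ pre x post, M = pre ++ x :: post → x.1 ≠ [] →
      BadState G r (x.2 :: (pre₀ ++ pre ++ post).map decPart) := by
  induction M generalizing pre₀ with
  | nil => simp
  | cons z M ih =>
    rw [checkReplies, Bool.and_eq_true, Bool.or_eq_true, List.isEmpty_iff, List.any_eq_true] at h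
    intro pre x post hM hx
    cases pre with
    | nil =>
      obtain ⟨rfl, rfl⟩ := List.cons.inj hM
      obtain ⟨F, hF, hle⟩ := h.1.resolve_left hx
      rw [List.append_nil]
      exact badState_of_stateLE (hT F hF) hle
    | cons z' pre =>
      obtain ⟨rfl, hM'⟩ := List.cons.inj hM
      have := ih h.2 pre x post hM' hx
      simpa using this

theorem badState_of_checkMoves {T : List (List (List ℕ))} (hT : ∀ F ∈ T, BadState G r F)
    {L : List (List (List ℕ × List ℕ))} (h : checkMoves T L = true) :
    ∀ M ∈ L, BadState G r (M.map fun x => x.1 ++ x.2) := by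
  induction L generalizing T with
  | nil => simp
  | cons M L ih =>
    rw [checkMoves, Bool.and_eq_true, Bool.and_eq_true, List.any_eq_true] at h
    obtain ⟨⟨⟨x, hx, hx'⟩, h2⟩, h3⟩ := h
    have key : BadState G r (M.map fun x => x.1 ++ x.2) :=
      badState_of_replies ⟨x, hx, by simpa using hx'⟩ fun pre x post hM hx => by
        simpa using badState_of_checkReplies hT h2 pre x post hM hx
    intro M' hM'
    rcases List.mem_cons.1 hM' with rfl | hM'
    · exact key
    · refine ih (fun F hF => ?_) h3 M' hM'
      rcases List.mem_cons.1 hF with rfl | hF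
      · refine key.mono ?_
        rw [List.forall₂_map_left_iff, List.forall₂_map_right_iff]
        exact List.forall₂_same.2 fun y _ => ⟨_, (sortPart_perm _).symm, by
          rw [List.take_length]
          exact List.forall₂_same.2 fun _ _ => le_rfl⟩
      · exact hT F hF

end ListerStates

/-- Moves of Lister. The components of each pair are the presented and the other vertices of a
part. -/
def listerMoves : List (List (List ℕ × List ℕ)) := [
  [([1], []), ([1], [])],
  [([2], []), ([2], []), ([2], [])],
  [([3], []), ([3], []), ([3], []), ([3], [])],
  [([4], []), ([4], []), ([4], []), ([4], []), ([4], [])],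
  [([5], []), ([5], []), ([5], []), ([5], []), ([5], []), ([5], [])],
  [([6], []), ([6], []), ([6], []), ([6], []), ([6], []), ([6], []), ([6], [])],
  [([2], []), ([1], [1])],
  [([2], []), ([3], []), ([2, 2], [2])],
  [([1], []), ([3], []), ([2, 2], [])],
  [([2], [1]), ([2], [2])],
  [([2], []), ([3, 3], []), ([2, 3], [3])],
  [([3], []), ([3], []), ([4, 4], []), ([3, 4], [3])],
  [([3], [2]), ([2], [1, 2])],
  [([3], []), ([3], [3]), ([2, 3], [2])],
  [([3], []), ([2], [2]), ([3], [2])],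
  [([3], [2]), ([3], [3]), ([3], [3])],
  [([4], [3]), ([4], [3]), ([3], [2, 3])],
  [([2], []), ([3], []), ([1, 2], [1])],
  [([3], []), ([3], [3]), ([2, 2], [2])],
  [([2], []), ([4], []), ([4], [3]), ([3, 3], [2])],
  [([3], []), ([4], [4]), ([4], [4]), ([3, 4], [3])],
  [([4], []), ([4], []), ([5, 5], []), ([5, 5], []), ([4, 4], [4])],
  [([3], [1]), ([2], [2, 2])],
  [([3], []), ([2], [3]), ([3, 3], [2])],
  [([], [3]), ([4], [2, 3]), ([4], [2, 3])],
  [([3], []), ([2], [2]), ([2], [2])],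
  [([3], [2]), ([3], [2]), ([3], [3])],
  [([4], [2]), ([4], [3]), ([4], [2, 3])],
  [([5], [3]), ([4], [2, 4]), ([4], [2, 4])],
  [([2], []), ([3], []), ([4], []), ([3, 3], [2])],
  [([2, 2], [2]), ([2, 2], [2])],
  [([4], []), ([3, 3], [2]), ([3, 3], [2])],
  [([4], []), ([5], []), ([4, 4], [2]), ([4, 4], [2])],
  [([3], []), ([4], []), ([4], [3]), ([3, 3], [2])],
  [([4], []), ([5], [3]), ([4], [4]), ([4, 4], [2])],
  [([5], []), ([4], [5]), ([3], [4, 4]), ([3], [4, 4])],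
  [([4], []), ([4], [4]), ([4], [4]), ([3, 4], [3])],
  [([2], [2]), ([1, 2], [1])],
  [([4], []), ([3], [3]), ([3], [3]), ([4], [3])],
  [([4], [3]), ([4], [3]), ([4], [4]), ([4], [4])],
  [([4], [4]), ([5], [4]), ([5], [4]), ([4], [3, 4])],
  [([5], [5]), ([5], [5]), ([4], [4, 4]), ([4], [4, 4])],
  [([2], []), ([3], [4]), ([2, 2], [2])],
  [([3], []), ([3], []), ([4], [4]), ([3, 3], [2])],
  [([4], []), ([2, 2], [2]), ([2, 2], [2])],
  [([4], [4]), ([3, 3], [2]), ([3, 3], [2])],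
  [([3], []), ([2, 2], [2]), ([2, 2], [2])],
  [([3], []), ([4], []), ([3, 3], [2]), ([3, 3], [2])],
  [([4], []), ([5], [4]), ([3, 4], [3]), ([3, 4], [3])],
  [([2], []), ([3], []), ([4], [4]), ([3, 3], [2])],
  [([3], []), ([5], [4]), ([3, 4], [3]), ([3, 4], [3])],
  [([3], []), ([4], []), ([5], []), ([3, 4], [3]), ([3, 4], [3])],
  [([4], []), ([5], []), ([5], [5]), ([4, 4], [4]), ([4, 4], [4])],
  [([5], []), ([6], [5]), ([6], [5]), ([5, 5], [4]), ([5, 5], [4])],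
  [([4], []), ([5], []), ([6], []), ([6], [5]), ([5, 5], [4]), ([5, 5], [4])],
  [([5], []), ([6], []), ([6], [6]), ([6], [6]), ([5, 6], [5]), ([5, 6], [5])],
  [([5], []), ([3, 4], [3]), ([3, 4], [3]), ([3, 4], [3])],
  [([5], [5]), ([4, 4], [4]), ([4, 4], [4]), ([4, 4], [4])],
  [([4], []), ([3, 4], [3]), ([3, 4], [3]), ([3, 4], [3])],
  [([5], []), ([5], []), ([4, 4], [4]), ([4, 4], [4]), ([4, 4], [4])],
  [([6], []), ([6], [5]), ([5, 5], [4]), ([5, 5], [4]), ([5, 5], [4])],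
  [([6], [6]), ([6], [6]), ([5, 6], [5]), ([5, 6], [5]), ([5, 6], [5])],
  [([4], []), ([4], []), ([5], [5]), ([4, 4], [4]), ([4, 4], [4])],
  [([4], []), ([5], []), ([4, 4], [4]), ([4, 4], [4]), ([4, 4], [4])],
  [([5], []), ([6], [5]), ([5, 5], [4]), ([5, 5], [4]), ([5, 5], [4])],
  [([4], []), ([5], []), ([6], []), ([5, 5], [4]), ([5, 5], [4]), ([5, 5], [4])],
  [([5], []), ([6], []), ([6], [6]), ([5, 6], [5]), ([5, 6], [5]), ([5, 6], [5])],
  [([6], []), ([7], [6]), ([7], [6]), ([6, 6], [6]), ([6, 6], [6]), ([6, 6], [6])],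
  [([6], []), ([6], []), ([7], []), ([7], [6]), ([6, 6], [6]), ([6, 6], [6]), ([6, 6], [6])],
  [([7], []), ([7], []), ([7], [7]), ([7], [7]), ([7, 7], [6]), ([7, 7], [6]), ([7, 7], [6])],
  [([5], []), ([5], []), ([6], []), ([5, 5], [4]), ([5, 5], [4]), ([5, 5], [4])],
  [([6], []), ([6], []), ([6], [6]), ([5, 6], [5]), ([5, 6], [5]), ([5, 6], [5])],
  [([4, 4], [4]), ([4, 4], [4]), ([4, 4], [4]), ([4, 4], [4])],
  [([6], []), ([5, 5], [4]), ([5, 5], [4]), ([5, 5], [4]), ([5, 5], [4])],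
  [([6], [6]), ([5, 6], [5]), ([5, 6], [5]), ([5, 6], [5]), ([5, 6], [5])],
  [([5], []), ([5, 5], [4]), ([5, 5], [4]), ([5, 5], [4]), ([5, 5], [4])],
  [([6], []), ([6], []), ([5, 6], [5]), ([5, 6], [5]), ([5, 6], [5]), ([5, 6], [5])],
  [([7], []), ([7], [6]), ([6, 6], [6]), ([6, 6], [6]), ([6, 6], [6]), ([6, 6], [6])],
  [([7], [7]), ([7], [7]), ([7, 7], [6]), ([7, 7], [6]), ([7, 7], [6]), ([7, 7], [6])],
  [([5], []), ([6], []), ([5, 6], [5]), ([5, 6], [5]), ([5, 6], [5]), ([5, 6], [5])],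
  [([6], []), ([7], [6]), ([6, 6], [6]), ([6, 6], [6]), ([6, 6], [6]), ([6, 6], [6])],
  [([6], []), ([6], []), ([7], []), ([6, 6], [6]), ([6, 6], [6]), ([6, 6], [6]), ([6, 6], [6])],
  [([7], []), ([7], []), ([7], [7]), ([7, 7], [6]), ([7, 7], [6]), ([7, 7], [6]), ([7, 7], [6])],
  [([8], []), ([8], [7]), ([8], [7]), ([7, 8], [7]), ([7, 8], [7]), ([7, 8], [7]), ([7, 8], [7])],
  [([5, 6], [5]), ([5, 6], [5]), ([5, 6], [5]), ([5, 6], [5]), ([5, 6], [5])],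
  [([7], []), ([6, 6], [6]), ([6, 6], [6]), ([6, 6], [6]), ([6, 6], [6]), ([6, 6], [6])],
  [([7], [7]), ([7, 7], [6]), ([7, 7], [6]), ([7, 7], [6]), ([7, 7], [6]), ([7, 7], [6])],
  [([6], []), ([6, 6], [6]), ([6, 6], [6]), ([6, 6], [6]), ([6, 6], [6]), ([6, 6], [6])],
  [([7], []), ([7], []), ([7, 7], [6]), ([7, 7], [6]), ([7, 7], [6]), ([7, 7], [6]),
    ([7, 7], [6])],
  [([8], []), ([8], [7]), ([7, 8], [7]), ([7, 8], [7]), ([7, 8], [7]), ([7, 8], [7]),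
    ([7, 8], [7])],
  [([8], [8]), ([8], [8]), ([8, 8], [8]), ([8, 8], [8]), ([8, 8], [8]), ([8, 8], [8]),
    ([8, 8], [8])]]

theorem checkMoves_listerMoves : checkMoves [[[0]]] listerMoves = true := by
  decide +kernel

section Conclusion

theorem goodState_of_mem_monomials {V : Type*} [Fintype V] [DecidableEq V] {G : SimpleGraph V}
    {r : ℕ} {Ms : List (List ℕ)} (h : Ms ∈ monomials) :
    GoodState G r (Ms.map (List.map (· + 1))) := by
  have hshape : ∀ Ms ∈ monomials, ∀ M ∈ Ms,
      (1 ≤ M.length ∧ M.length ≤ 3) ∧ (M.length = 3 → M ∈ triples) := by decide +kernel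
  refine goodState_of_partOperators (R := Residue) (fun M hM => (hshape Ms h M hM).1) ?_
  refine partOperators_ne_zero (List.all_eq_true.1 checkCoefficient_monomials Ms h)
    fun M hM h3 => ?_
  exact List.all_eq_true.1 checkPartTerms_triples M ((hshape Ms h M hM).2 h3)

theorem painterWinsIn_mono_threshold {V : Type*} [Fintype V] [DecidableEq V]
    {G : SimpleGraph V} {r s : ℕ} (hrs : r ≤ s) {fuel : ℕ} {U : Finset V} {t : V → ℕ}
    (h : PainterWinsIn G r fuel U t) : PainterWinsIn G s fuel U t := by
  induction fuel generalizing U t with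
  | zero => exact h
  | succ n ih =>
    refine h.imp id fun h S hS hS' => ?_
    obtain ⟨I, h1, h2, h3⟩ := h S hS hS'
    exact ⟨I, h1, h2, h3.imp id fun h3 => ⟨fun v hv => (h3.1 v hv).trans_le hrs, ih h3.2⟩⟩

/-- The complete multipartite graph with two parts of size two and five parts of size three. -/
abbrev K2x2_3x5 : SimpleGraph (Σ i : Fin 7, Fin (if (i : ℕ) < 2 then 2 else 3)) :=
  SimpleGraph.completeMultipartiteGraph (fun i : Fin 7 => Fin (if (i : ℕ) < 2 then 2 else 3))

/-- The parts of `K2x2_3x5`, beginning with the large ones. -/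
def vertexParts : List (List (Σ i : Fin 7, Fin (if (i : ℕ) < 2 then 2 else 3))) :=
  ([2, 3, 4, 5, 6, 0, 1] : List (Fin 7)).map fun (i : Fin 7) =>
    (List.finRange (if (i : ℕ) < 2 then 2 else 3)).map (Sigma.mk i)

theorem not_adj_of_mem_vertexParts : ∀ p ∈ vertexParts, ∀ x ∈ p, ∀ y ∈ p, x.1 = y.1 := by
  decide +kernel

theorem mem_vertexParts_flatten : ∀ v, v ∈ vertexParts.flatten := by decide +kernel

theorem nodup_vertexParts_flatten : vertexParts.flatten.Nodup := by decide +kernel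

theorem pairwise_vertexParts :
    vertexParts.Pairwise fun p q => ∀ x ∈ p, ∀ y ∈ q, x.1 ≠ y.1 := by
  decide +kernel

theorem paintable_K2x2_3x5 : Paintable K2x2_3x5 9 := by
  have hgood : GoodState K2x2_3x5 9 (expandState [([9, 9, 9], 4), ([9, 9], 1)]) := by
    have hT : ∀ F ∈ monomials.map (List.map (List.map (· + 1))), GoodState K2x2_3x5 9 F := by
      intro F hF
      obtain ⟨Ms, h, rfl⟩ := List.mem_map.1 hF
      exact goodState_of_mem_monomials h
    have hmem : [([9, 9, 9], 4), ([9, 9], 1)] ∈ moveTrees.map Prod.fst := by decide +kernel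
    obtain ⟨x, hx, hx'⟩ := List.mem_map.1 hmem
    rw [← hx']
    exact goodState_of_checkTrees hT checkTrees_moveTrees x hx
  have hstate : HasState K2x2_3x5 9 Finset.univ (fun _ => 0)
      (expandState [([9, 9, 9], 4), ([9, 9], 1)]) := by
    refine ⟨vertexParts.map (List.map fun v => (v, 9)), by decide +kernel, ?_, ?_, ?_⟩
    · rw [← List.map_flatten, List.map_map]
      refine (List.perm_ext_iff_of_nodup (by simpa [Function.comp_def] using
        nodup_vertexParts_flatten) (Finset.nodup_toList _)).2 fun v => ?_
      simpa [Function.comp_def] using mem_vertexParts_flatten v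
    · simp only [List.forall_mem_map]
      intro p hp x hx y hy h
      exact h (not_adj_of_mem_vertexParts p hp x hx y hy)
    · simp only [List.forall_mem_map]
      simp
  exact (hgood _ _ hstate).2

theorem not_paintable_K2x2_3x5 : ¬ Paintable K2x2_3x5 8 := by
  rintro ⟨fuel, h⟩
  have hbad : BadState K2x2_3x5 8
      [[8, 8, 8], [8, 8, 8], [8, 8, 8], [8, 8, 8], [8, 8, 8], [8, 8], [8, 8]] := by
    have hmem : [[8, 8, 8], [8, 8, 8], [8, 8, 8], [8, 8, 8], [8, 8, 8], [8, 8], [8, 8]] ∈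
        listerMoves.map fun M => M.reverse.map fun x => x.1 ++ x.2 := by decide +kernel
    obtain ⟨M, hM, hM'⟩ := List.mem_map.1 hmem
    rw [← hM']
    exact (badState_of_checkMoves (by simp [badState_zero]) checkMoves_listerMoves M hM).perm
      ((List.reverse_perm M).map _)
  refine hbad fuel Finset.univ (fun _ => 0) ⟨vertexParts.map (List.map fun v => (v, 8)),
    by decide +kernel, ?_, ?_, ?_⟩ (by simp) h
  · simp only [List.forall_mem_map, List.map_map]
    intro p hp
    simpa [Function.comp_def] using (List.nodup_flatten.1 nodup_vertexParts_flatten).1 p hp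
  · rw [List.pairwise_map]
    refine pairwise_vertexParts.imp fun {p q} h => ?_
    simp only [List.forall_mem_map]
    exact h
  · simp only [List.forall_mem_map]
    simp

end Conclusion

end OnlineColoring

/-- The complete multipartite graph with `2` parts of size `2` and `5` parts of
size `3` has paintability `9`: `χ_P(K_{2⋆2,3⋆5}) = 9`. -/
theorem paintability_K2x2_3x5 :
    paintability (SimpleGraph.completeMultipartiteGraph
      (fun i : Fin 7 => Fin (if (i : ℕ) < 2 then 2 else 3))) = 9 := by
  refine le_antisymm (Nat.sInf_le OnlineColoring.paintable_K2x2_3x5)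
    (le_csInf ⟨9, OnlineColoring.paintable_K2x2_3x5⟩ ?_)
  rintro r ⟨fuel, h⟩
  by_contra! hr
  exact OnlineColoring.not_paintable_K2x2_3x5
    ⟨fuel, OnlineColoring.painterWinsIn_mono_threshold (by omega) h⟩
end

section
/- Let m, k ≥ 2 be integers and define f : ℕ → ℕ by f(0) = 1 and f(r) = f(r-1) + ⌈f(r-1)/(m-1)⌉ for r ≥ 1. Then the paintability of the complete multipartite graph with m parts, each of size m·(k+1)·f(k), satisfies χ_P(K_{(m(k+1)f(k))⋆m}) > k. -/
/-- The number of vertices of level `s` needed to form `n` units, where `d` units make up a brick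
of `f s` vertices and a single unit needs `f (s + 1) - f s` vertices. -/
def unitCost (d : ℕ) (f : ℕ → ℕ) (s n : ℕ) : ℕ :=
  n / d * f s + n % d * (f (s + 1) - f s)

lemma unitCost_add_brick {d : ℕ} (hd : 0 < d) (f : ℕ → ℕ) (s n : ℕ) :
    unitCost d f s (n + d) = unitCost d f s n + f s := by
  simp only [unitCost, Nat.add_div_right n hd, Nat.add_mod_right]
  ring

lemma unitCost_succ_le {d : ℕ} (hd : 0 < d) {f : ℕ → ℕ}
    {s : ℕ} (hf : f s ≤ d * (f (s + 1) - f s)) (n : ℕ) :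
    unitCost d f s (n + 1) ≤ unitCost d f s n + (f (s + 1) - f s) := by
  unfold unitCost
  generalize f (s + 1) - f s = c at *
  have h₁ := Nat.div_add_mod n d
  have h₂ := Nat.mod_lt n hd
  generalize n / d = a at *
  generalize n % d = b at *
  subst h₁
  rcases Nat.lt_or_ge (b + 1) d with h | h
  · rw [add_assoc, Nat.mul_add_div hd, Nat.mul_add_mod, Nat.div_eq_of_lt h, Nat.mod_eq_of_lt h]
    apply le_of_eq
    ring
  · obtain rfl : d = b + 1 := by omega
    rw [show (b + 1) * a + b + 1 = (b + 1) * (a + 1) by ring, Nat.mul_div_cancel_left _ hd,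
      Nat.mul_mod_right]
    nlinarith

lemma unitCost_add_succ_le {d : ℕ} (hd : 0 < d) {f : ℕ → ℕ} {s : ℕ} (hmono : f s ≤ f (s + 1))
    (hf : f s ≤ d * (f (s + 1) - f s)) (n : ℕ) :
    unitCost d f s (n + (d + 1)) ≤ unitCost d f s n + f (s + 1) := by
  have h₁ := unitCost_succ_le hd hf (n + d)
  have h₂ := unitCost_add_brick hd f s n
  rw [← add_assoc]
  omega

lemma le_unitCost {d : ℕ} {f : ℕ → ℕ} {s n : ℕ} (hn : d ≤ n) (hd : 0 < d) :
    f s ≤ unitCost d f s n := by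
  obtain ⟨l, rfl⟩ := Nat.exists_eq_add_of_le' hn
  rw [unitCost_add_brick hd]
  omega

/-- Unit counts after a brick of level `s` is painted. -/
def paintBrick (d s : ℕ) (n : ℕ → ℕ) (i : ℕ) : ℕ :=
  if i = s then n i - d else n i

/-- Unit counts after a brick of level `s` drops to level `s - 1`. -/
def lowerBrick (d s : ℕ) (n : ℕ → ℕ) (i : ℕ) : ℕ :=
  if i = s then n i - d else if i + 1 = s then n i + (d + 1) else n i

lemma sum_paintBrick {d s : ℕ} {n : ℕ → ℕ} (hn : d ≤ n s) (A : Finset ℕ) :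
    ∑ i ∈ A, paintBrick d s n i + (if s ∈ A then d else 0) = ∑ i ∈ A, n i := by
  rw [← Finset.sum_ite_eq' A s (fun _ => d), ← Finset.sum_add_distrib]
  refine Finset.sum_congr rfl fun i _ => ?_
  unfold paintBrick
  split_ifs with h
  · subst h
    omega
  · rfl

lemma sum_lowerBrick {d s : ℕ} {n : ℕ → ℕ} (hn : d ≤ n (s + 1)) (A : Finset ℕ) :
    ∑ i ∈ A, lowerBrick d (s + 1) n i + (if s + 1 ∈ A then d else 0) =
      ∑ i ∈ A, n i + (if s ∈ A then d + 1 else 0) := by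
  rw [← Finset.sum_ite_eq' A (s + 1) (fun _ => d), ← Finset.sum_ite_eq' A s (fun _ => d + 1),
    ← Finset.sum_add_distrib, ← Finset.sum_add_distrib]
  refine Finset.sum_congr rfl fun i _ => ?_
  unfold lowerBrick
  split_ifs with h <;> first | omega | (subst h; omega)

lemma sum_paintBrick_le {d s : ℕ} {n : ℕ → ℕ} (hn : d ≤ n s) (A : Finset ℕ) :
    ∑ i ∈ A, paintBrick d s n i ≤ ∑ i ∈ A, n i :=
  (Nat.le_add_right _ _).trans_eq (sum_paintBrick hn A)

lemma sum_Icc_lowerBrick_le {d s r M : ℕ} {n : ℕ → ℕ} (hn : d ≤ n (s + 1)) (hs : s + 1 ≤ r)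
    (hlow : ∀ i < s + 1, n i < d)
    (hbound : ∀ q ≤ r, ∑ i ∈ Finset.Icc q r, n i ≤ d * (M + (r - q))) {q : ℕ} (hq : q ≤ r) :
    ∑ i ∈ Finset.Icc q r, lowerBrick d (s + 1) n i ≤ d * (M + (r - q)) := by
  have hsum := sum_lowerBrick hn (Finset.Icc q r)
  rcases Nat.lt_or_ge s q with h | h
  · have hb := hbound q hq
    rw [if_neg (show s ∉ Finset.Icc q r by simp; omega)] at hsum
    omega
  · have hb := hbound (q + 1) (by omega)
    have hl := hlow q (by omega)
    rw [if_pos (Finset.mem_Icc.2 ⟨h, by omega⟩), if_pos (Finset.mem_Icc.2 ⟨by omega, hs⟩),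
      ← Finset.insert_Icc_add_one_left_eq_Icc hq, Finset.sum_insert (by simp),
      Finset.sum_insert (by simp)] at hsum
    rw [← Finset.insert_Icc_add_one_left_eq_Icc hq, Finset.sum_insert (by simp)]
    obtain ⟨e, he⟩ : ∃ e, r - q = e + 1 := ⟨r - q - 1, by omega⟩
    rw [show r - (q + 1) = e by omega] at hb
    rw [he, ← add_assoc, Nat.mul_succ]
    omega

lemma exists_brick {d r M : ℕ} (hd : 0 < d) (hM : (d + 1) * (r + 1) ≤ M)
    {n : Fin (d + 1) → ℕ → ℕ}
    (hbound : ∀ j, ∀ q ≤ r, ∑ i ∈ Finset.Icc q r, n j i ≤ d * (M + (r - q)))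
    (htotal : (d + 1) * d * M ≤ ∑ j, ∑ i ∈ Finset.Icc 0 r, n j i) (j : Fin (d + 1)) :
    ∃ s ≤ r, d ≤ n j s ∧ ∀ i < s, n j i < d := by
  classical
  have hex : ∃ s, s ≤ r ∧ d ≤ n j s := by
    by_contra! h
    have h₁ : ∑ i ∈ Finset.Icc 0 r, n j i ≤ (r + 1) * (d - 1) := by
      have := Finset.sum_le_card_nsmul (Finset.Icc 0 r) (n j) (d - 1) fun i hi => by
        have := h i (Finset.mem_Icc.1 hi).2
        omega
      simpa using this
    have h₂ : ∑ l ∈ Finset.univ.erase j, ∑ i ∈ Finset.Icc 0 r, n l i ≤ d * (d * (M + r)) := by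
      have := Finset.sum_le_card_nsmul (Finset.univ.erase j)
        (fun l => ∑ i ∈ Finset.Icc 0 r, n l i) (d * (M + r)) fun l _ => by
          simpa using hbound l 0 (Nat.zero_le r)
      simpa [Finset.card_erase_of_mem] using this
    rw [← Finset.add_sum_erase _ _ (Finset.mem_univ j)] at htotal
    obtain ⟨e, rfl⟩ : ∃ e, d = e + 1 := ⟨d - 1, by omega⟩
    simp only [Nat.add_sub_cancel] at h₁
    nlinarith [Nat.mul_le_mul_left (e + 1) hM]
  refine ⟨Nat.find hex, (Nat.find_spec hex).1, (Nat.find_spec hex).2, fun i hi => ?_⟩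
  have h₁ := Nat.find_min hex hi
  have h₂ := (Nat.find_spec hex).1
  by_contra! h
  exact h₁ ⟨by omega, h⟩

section Game

variable {V : Type*} [DecidableEq V]

/-- The unpainted vertices of part `j` that may be presented `s` more times before reaching the
threshold `r`. -/
def levelSet {ι : Type*} [DecidableEq ι] (part : V → ι) (r : ℕ) (U : Finset V) (t : V → ℕ)
    (j : ι) (s : ℕ) : Finset V :=
  {v ∈ U | part v = j ∧ t v + s = r}

/-- If every part of `G` carries enough units of unpainted vertices, then Painter loses. -/
theorem not_painterWinsIn_of_units [Fintype V] {d r M : ℕ} (hd : 0 < d)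
    (hM : (d + 1) * (r + 1) ≤ M) {f : ℕ → ℕ} (hpos : ∀ s, 0 < f s) (hmono : Monotone f)
    (hf : ∀ s, f s ≤ d * (f (s + 1) - f s)) {G : SimpleGraph V} {part : V → Fin (d + 1)}
    (hG : ∀ u v, part u ≠ part v → G.Adj u v) (fuel : ℕ) (U : Finset V) (t : V → ℕ)
    (n : Fin (d + 1) → ℕ → ℕ)
    (hcost : ∀ j s, unitCost d f s (n j s) ≤ (levelSet part r U t j s).card)
    (hbound : ∀ j, ∀ q ≤ r, ∑ i ∈ Finset.Icc q r, n j i ≤ d * (M + (r - q)))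
    (htotal : (d + 1) * d * M ≤ ∑ j, ∑ i ∈ Finset.Icc 0 r, n j i) :
    ¬ PainterWinsIn G r fuel U t := by
  induction fuel generalizing U t n with
  | zero =>
    choose s hsr hsd hlow using exists_brick hd hM hbound htotal
    rintro rfl
    have := hcost 0 (s 0)
    have h₁ := le_unitCost (f := f) (s := s 0) (hsd 0) hd
    have h₂ := hpos (s 0)
    simp [levelSet] at this
    omega
  | succ fuel ih =>
    choose s hsr hsd hlow using exists_brick hd hM hbound htotal
    have hbrick : ∀ j, ∃ B ⊆ levelSet part r U t j (s j), B.card = f (s j) := fun j =>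
      Finset.exists_subset_card_eq ((le_unitCost (hsd j) hd).trans (hcost j (s j)))
    choose B hB hBcard using hbrick
    have hBmem : ∀ {j v}, v ∈ B j → v ∈ U ∧ part v = j ∧ t v + s j = r := fun {j v} hv => by
      simpa [levelSet] using hB j hv
    have hBne : ∀ j, (B j).Nonempty := fun j => Finset.card_pos.1 (hBcard j ▸ hpos _)
    set S := Finset.univ.biUnion B with hS
    have hSmem : ∀ {v}, v ∈ S ↔ v ∈ B (part v) := fun {v} => by
      simp only [hS, Finset.mem_biUnion, Finset.mem_univ, true_and]
      refine ⟨?_, fun h => ⟨_, h⟩⟩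
      rintro ⟨j, hj⟩
      rwa [(hBmem hj).2.1]
    rintro (rfl | hwin)
    · obtain ⟨v, hv⟩ := hBne 0
      simpa using (hBmem hv).1
    obtain ⟨v₀, hv₀⟩ := hBne 0
    obtain ⟨I, hIS, hind, hres⟩ := hwin S (fun v hv => (hBmem (hSmem.1 hv)).1)
      ⟨v₀, Finset.mem_biUnion.2 ⟨0, Finset.mem_univ _, hv₀⟩⟩
    obtain ⟨p, hp⟩ : ∃ p, ∀ v ∈ I, part v = p := by
      rcases I.eq_empty_or_nonempty with rfl | ⟨u, hu⟩
      · exact ⟨0, by simp⟩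
      · exact ⟨part u, fun v hv => by_contra fun h => hind v hv u hu (hG v u h)⟩
    have hBI : ∀ {j v}, j ≠ p → v ∈ B j → v ∈ U \ I := fun {j v} hj hv =>
      Finset.mem_sdiff.2 ⟨(hBmem hv).1, fun h => hj ((hBmem hv).2.1.symm.trans (hp v h))⟩
    have hBS : ∀ {j v}, v ∈ B j → v ∈ S := fun {j v} hv =>
      Finset.mem_biUnion.2 ⟨j, Finset.mem_univ _, hv⟩
    rcases hres with hemp | ⟨hlt, hwin⟩
    · have : Nontrivial (Fin (d + 1)) := Fin.nontrivial_iff_two_le.2 (by omega)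
      obtain ⟨j, hj⟩ := exists_ne p
      obtain ⟨v, hv⟩ := hBne j
      simpa [hemp] using hBI hj hv
    have hs_pos : ∀ j ≠ p, ∃ a, s j = a + 1 := fun j hj => by
      obtain ⟨v, hv⟩ := hBne j
      have h₁ := hlt v (hBI hj hv)
      have h₂ := (hBmem hv).2.2
      rw [if_pos (hBS hv)] at h₁
      exact ⟨s j - 1, by omega⟩
    set t' : V → ℕ := fun v => t v + if v ∈ S then 1 else 0 with ht'
    have hkeep : ∀ j i, levelSet part r U t j i \ B j ⊆ levelSet part r (U \ I) t' j i := by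
      intro j i v hv
      simp only [levelSet, Finset.mem_sdiff, Finset.mem_filter] at hv ⊢
      obtain ⟨⟨hvU, rfl, hvt⟩, hvB⟩ := hv
      have hvS : v ∉ S := fun h => hvB (hSmem.1 h)
      exact ⟨⟨hvU, fun h => hvS (hIS h)⟩, rfl, by simpa [ht', hvS] using hvt⟩
    have hdisj : ∀ j i, i ≠ s j → Disjoint (levelSet part r U t j i) (B j) := by
      intro j i hi
      refine Finset.disjoint_left.2 fun v hv hvB => hi ?_
      have h₁ := (hBmem hvB).2.2
      have h₂ := (Finset.mem_filter.1 hv).2.2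
      omega
    have hcard_same : ∀ j, unitCost d f (s j) (n j (s j) - d) ≤
        (levelSet part r (U \ I) t' j (s j)).card := by
      intro j
      have h₁ := Finset.card_le_card (hkeep j (s j))
      rw [Finset.card_sdiff_of_subset (hB j), hBcard] at h₁
      have h₂ := unitCost_add_brick hd f (s j) (n j (s j) - d)
      rw [Nat.sub_add_cancel (hsd j)] at h₂
      have h₃ := hcost j (s j)
      omega
    have hcard_other : ∀ j i, i ≠ s j → unitCost d f i (n j i) ≤
        (levelSet part r (U \ I) t' j i).card := by
      intro j i hi
      have h₁ := Finset.card_le_card (hkeep j i)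
      rw [Finset.sdiff_eq_self_of_disjoint (hdisj j i hi)] at h₁
      exact (hcost j i).trans h₁
    have hcard_lower : ∀ j ≠ p, ∀ i, i + 1 = s j → unitCost d f i (n j i + (d + 1)) ≤
        (levelSet part r (U \ I) t' j i).card := by
      intro j hj i hi
      have hsub : levelSet part r U t j i ∪ B j ⊆ levelSet part r (U \ I) t' j i := by
        refine Finset.union_subset ?_ fun v hv => ?_
        · rw [← Finset.sdiff_eq_self_of_disjoint (hdisj j i (by omega))]
          exact hkeep j i
        · have h₁ := hBmem hv
          refine Finset.mem_filter.2 ⟨hBI hj hv, h₁.2.1, ?_⟩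
          simp only [ht', if_pos (hBS hv)]
          omega
      have h₁ := Finset.card_le_card hsub
      rw [Finset.card_union_of_disjoint (hdisj j i (by omega)), hBcard, ← hi] at h₁
      have h₂ := unitCost_add_succ_le hd (hmono (Nat.le_succ i)) (hf i) (n j i)
      have h₃ := hcost j i
      omega
    refine ih (U \ I) t'
      (fun j => if j = p then paintBrick d (s j) (n j) else lowerBrick d (s j) (n j))
      ?_ ?_ ?_ hwin
    · intro j i
      split_ifs with hj
      · unfold paintBrick
        split_ifs with hi
        · subst hi
          exact hcard_same j
        · exact hcard_other j i hi
      · unfold lowerBrick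
        split_ifs with hi hi'
        · subst hi
          exact hcard_same j
        · exact hcard_lower j hj i hi'
        · exact hcard_other j i hi
    · intro j q hq
      split_ifs with hj
      · exact (sum_paintBrick_le (hsd j) _).trans (hbound j q hq)
      · obtain ⟨a, ha⟩ := hs_pos j hj
        have h₁ := hsd j
        have h₂ := hsr j
        have h₃ := hlow j
        rw [ha] at h₁ h₂ h₃ ⊢
        exact sum_Icc_lowerBrick_le h₁ h₂ h₃ (hbound j) hq
    · have hstep : ∀ j, ∑ i ∈ Finset.Icc 0 r, (if j = p then paintBrick d (s j) (n j)
          else lowerBrick d (s j) (n j)) i + (if j = p then d + 1 else 0) =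
          ∑ i ∈ Finset.Icc 0 r, n j i + 1 := by
        intro j
        split_ifs with hj
        · have h₁ := sum_paintBrick (hsd j) (Finset.Icc 0 r)
          rw [if_pos (Finset.mem_Icc.2 ⟨Nat.zero_le _, hsr j⟩)] at h₁
          omega
        · obtain ⟨a, ha⟩ := hs_pos j hj
          have h₁ := hsd j
          have h₂ := hsr j
          rw [ha] at h₁ h₂ ⊢
          have h₃ := sum_lowerBrick h₁ (Finset.Icc 0 r)
          rw [if_pos (Finset.mem_Icc.2 ⟨Nat.zero_le _, h₂⟩),
            if_pos (Finset.mem_Icc.2 ⟨Nat.zero_le _, by omega⟩)] at h₃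
          omega
      have hsum := Finset.sum_congr (rfl : (Finset.univ : Finset (Fin (d + 1))) = _)
        fun j _ => hstep j
      rw [Finset.sum_add_distrib, Finset.sum_add_distrib, Finset.sum_ite_eq' _ p] at hsum
      simp only [Finset.mem_univ, if_true, Finset.sum_const, Finset.card_univ, Fintype.card_fin,
        smul_eq_mul, mul_one] at hsum
      omega

/-- Painting one vertex per round wins when the threshold is large. -/
lemma painterWinsIn_of_card_le [Fintype V] (G : SimpleGraph V) (r fuel : ℕ) (U : Finset V)
    (t : V → ℕ) (hU : U.card ≤ fuel) (ht : ∀ v ∈ U, t v + fuel < r) :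
    PainterWinsIn G r fuel U t := by
  induction fuel generalizing U t with
  | zero => exact Finset.card_eq_zero.1 (Nat.le_zero.1 hU)
  | succ fuel ih =>
    refine Or.inr fun S hS ⟨v, hv⟩ => ⟨{v}, by simpa using hv, by simp, Or.inr ⟨?_, ?_⟩⟩
    · intro u hu
      have := ht u (Finset.mem_sdiff.1 hu).1
      split_ifs <;> omega
    · refine ih _ _ ?_ fun u hu => ?_
      · rw [Finset.card_sdiff_of_subset (by simpa using hS hv), Finset.card_singleton]
        omega
      · have := ht u (Finset.mem_sdiff.1 hu).1
        split_ifs <;> omega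

lemma exists_paintable [Fintype V] (G : SimpleGraph V) : ∃ r, Paintable G r :=
  ⟨Fintype.card V + 1, Fintype.card V, painterWinsIn_of_card_le G _ _ _ _ le_rfl (by simp)⟩

/-- A complete multipartite graph with `d + 1` parts of size at least `M * f r`, where
`(d + 1) * (r + 1) ≤ M`, is not `r`-paintable. -/
theorem not_paintable_completeMultipartiteGraph {d r M N : ℕ} (hd : 0 < d)
    (hM : (d + 1) * (r + 1) ≤ M) {f : ℕ → ℕ} (hpos : ∀ s, 0 < f s) (hmono : Monotone f)
    (hf : ∀ s, f s ≤ d * (f (s + 1) - f s)) (hN : M * f r ≤ N) :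
    ¬ Paintable (SimpleGraph.completeMultipartiteGraph (fun _ : Fin (d + 1) => Fin N)) r := by
  rintro ⟨fuel, hwin⟩
  refine not_painterWinsIn_of_units hd hM hpos hmono hf (part := Sigma.fst)
    (fun u v h => h) fuel _ _ (fun _ s => if s = r then d * M else 0) ?_ ?_ ?_ hwin
  · intro j s
    split_ifs with hs
    · subst hs
      have hinj : N ≤ (levelSet Sigma.fst s (Finset.univ : Finset (Σ _ : Fin (d + 1), Fin N))
          (fun _ => 0) j s).card := by
        calc N = (Finset.univ.map (Function.Embedding.sigmaMk
              (β := fun _ : Fin (d + 1) => Fin N) j)).card := by simp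
          _ ≤ _ := Finset.card_le_card fun v hv => by
            obtain ⟨x, -, rfl⟩ := Finset.mem_map.1 hv
            simp [levelSet]
      refine le_trans ?_ (hN.trans hinj)
      simp [unitCost, Nat.mul_div_cancel_left _ hd]
    · simp [unitCost]
  · intro j q hq
    rw [Finset.sum_ite_eq', if_pos (Finset.mem_Icc.2 ⟨hq, le_rfl⟩)]
    exact Nat.mul_le_mul_left _ (Nat.le_add_right _ _)
  · simp [mul_assoc]

end Game

/-- Let `m, k ≥ 2` and define `f : ℕ → ℕ` by `f 0 = 1` and
`f r = f (r-1) + ⌈f (r-1) / (m-1)⌉` for `r ≥ 1`. Then the complete multipartite graph with `m`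
parts, each of size `m·(k+1)·f k`, satisfies `χ_P(K_{(m(k+1)f(k))⋆m}) > k`. -/
theorem paintability_brick_lower_bound (m k : ℕ) (hm : 2 ≤ m) (hk : 2 ≤ k)
    (f : ℕ → ℕ) (hf0 : f 0 = 1)
    (hf : ∀ r : ℕ, (f (r + 1) : ℤ) = f r + ⌈(f r : ℚ) / ((m : ℚ) - 1)⌉) :
    k < paintability (SimpleGraph.completeMultipartiteGraph
      (fun _ : Fin m => Fin (m * (k + 1) * f k))) := by
  obtain ⟨d, rfl⟩ : ∃ d, m = d + 1 := ⟨m - 1, by omega⟩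
  have hd : 0 < d := by omega
  have hdq : (0 : ℚ) < d := by exact_mod_cast hd
  have hle : ∀ s, f s ≤ f (s + 1) := fun s => by
    have h₁ := hf s
    have h₂ : 0 ≤ ⌈(f s : ℚ) / (((d + 1 : ℕ) : ℚ) - 1)⌉ := by
      push_cast
      rw [add_sub_cancel_right]
      positivity
    omega
  have hmono : Monotone f := monotone_nat_of_le_succ hle
  have hstep : ∀ s, f s ≤ d * (f (s + 1) - f s) := fun s => by
    have h₁ := hf s
    push_cast at h₁
    rw [add_sub_cancel_right] at h₁
    have h₂ := Int.le_ceil ((f s : ℚ) / d)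
    rw [show ⌈(f s : ℚ) / d⌉ = ((f (s + 1) - f s : ℕ) : ℤ) by have := hle s; omega,
      div_le_iff₀ hdq, mul_comm] at h₂
    exact_mod_cast h₂
  have hpos : ∀ s, 0 < f s := fun s => by
    have := hmono (Nat.zero_le s)
    omega
  by_contra! hlt
  exact not_paintable_completeMultipartiteGraph hd
    (Nat.mul_le_mul_left _ (Nat.succ_le_succ hlt)) hpos hmono hstep
    (Nat.mul_le_mul_left _ (hmono hlt)) (Nat.sInf_mem (exists_paintable _))
end
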